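/- arXiv:math/0303386 — 2 statements merged into one kernel-verified Lean document; each statement's English description precedes it below -/
import Mathlib

section
/- For every w ∈ F_k, the automorphic orbit Aut(F_k)w is exponentially negligible in F_k, and the set C ∩ Aut(F_k)w is exponentially negligible in C. -/
/-! Common definitions: free group `FG k = F(a_1,…,a_k)`, reduced and cyclically
reduced words, Whitehead automorphisms, strict minimality, counting functions and
exponential genericity, following Kapovich–Schupp–Shpilrain. -/

/-- The free group of rank `k` on the basis `a_1,…,a_k`. -/
abbrev FG (k : ℕ) := FreeGroup (Fin k)

/-- The alphabet `Σ = {a_1,…,a_k}^{±1}`: a letter is a basis index together with a sign. -/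
abbrev Letter (k : ℕ) := Fin k × Bool

/-- The inverse of a letter. -/
def linv {k : ℕ} (x : Letter k) : Letter k := (x.1, !x.2)

/-- The length `|g|` of the reduced word representing `g`. -/
def wordLength {k : ℕ} (g : FG k) : ℕ := (FreeGroup.toWord g).length

/-- A word is (freely) reduced if it equals its free reduction. -/
def ReducedWord {k : ℕ} (w : List (Letter k)) : Prop := FreeGroup.reduce w = w

/-- A word is cyclically reduced if all of its cyclic permutations are reduced;
equivalently, `w ++ w` is reduced. -/
def CyclicallyReducedWord {k : ℕ} (w : List (Letter k)) : Prop :=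
  FreeGroup.reduce (w ++ w) = w ++ w

/-- An element of `FG k` is cyclically reduced if its reduced word is. -/
def IsCyclicallyReduced {k : ℕ} (g : FG k) : Prop :=
  CyclicallyReducedWord (FreeGroup.toWord g)

/-- `C`, the set of all cyclically reduced elements of `FG k`. -/
def Cset (k : ℕ) : Set (FG k) := {g | IsCyclicallyReduced g}

/-- The cyclic length `‖g‖`: the length of the cyclically reduced form of `g`
(the unique cyclically reduced `u` with `g = x u x⁻¹`). -/
noncomputable def cyclicLength {k : ℕ} (g : FG k) : ℕ :=
  sInf {n | ∃ x u : FG k, IsCyclicallyReduced u ∧ g = x * u * x⁻¹ ∧ wordLength u = n}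

/-- The set `Σ = {a_1,…,a_k}^{±1}` inside the free group. -/
def letterSet (k : ℕ) : Set (FG k) :=
  {g | ∃ i : Fin k, g = FreeGroup.of i ∨ g = (FreeGroup.of i)⁻¹}

/-- A Whitehead automorphism of the first kind: a relabeling automorphism,
i.e. one whose restriction to `Σ` is a permutation of `Σ`. -/
def IsRelabeling {k : ℕ} (τ : MulAut (FG k)) : Prop :=
  (⇑τ) '' letterSet k = letterSet k

/-- A Whitehead automorphism of the second kind, with multiplier `a ∈ Σ`:
`τ a = a` and `τ x ∈ {x, xa, a⁻¹x, a⁻¹xa}` for all `x ∈ Σ`. -/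
def IsWhitehead2 {k : ℕ} (τ : MulAut (FG k)) : Prop :=
  ∃ a ∈ letterSet k, τ a = a ∧
    ∀ x ∈ letterSet k, τ x = x ∨ τ x = x * a ∨ τ x = a⁻¹ * x ∨ τ x = a⁻¹ * x * a

/-- An automorphism is inner if it is conjugation by some element. -/
def IsInner {k : ℕ} (α : MulAut (FG k)) : Prop := ∃ g : FG k, α = MulAut.conj g

/-- `SM`: the set of strictly minimal cyclically reduced elements, those `w` with
`‖τ w‖ > |w|` for every non-inner Whitehead automorphism `τ` of the second kind. -/
def SM (k : ℕ) : Set (FG k) :=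
  {w | IsCyclicallyReduced w ∧
    ∀ τ : MulAut (FG k), IsWhitehead2 τ → ¬ IsInner τ → wordLength w < cyclicLength (τ w)}

/-- `SM'`: elements whose cyclically reduced form lies in `SM`. -/
def SM' (k : ℕ) : Set (FG k) := {g | ∃ x u : FG k, u ∈ SM k ∧ g = x * u * x⁻¹}

/-- `γ(n,S)`: the number of elements of `S` of length `n`. -/
noncomputable def gammaC {k : ℕ} (S : Set (FG k)) (n : ℕ) : ℕ :=
  {g ∈ S | wordLength g = n}.ncard

/-- `ρ(n,S)`: the number of elements of `S` of length at most `n`. -/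
noncomputable def rhoC {k : ℕ} (S : Set (FG k)) (n : ℕ) : ℕ :=
  {g ∈ S | wordLength g ≤ n}.ncard

/-- `B ⊆ S` is exponentially generic in `S` if `ρ(n,B)/ρ(n,S) → 1`
exponentially fast. -/
def ExpGenericIn {k : ℕ} (B S : Set (FG k)) : Prop :=
  B ⊆ S ∧ ∃ K : ℝ, 0 < K ∧ ∃ σ : ℝ, 0 < σ ∧ σ < 1 ∧
    ∀ n : ℕ, |1 - (rhoC B n : ℝ) / (rhoC S n : ℝ)| ≤ K * σ ^ n

/-- `B` is exponentially negligible in `S` if `S \ B` is exponentially generic in `S`. -/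
def ExpNegligibleIn {k : ℕ} (B S : Set (FG k)) : Prop := ExpGenericIn (S \ B) S

/-- The orbit `Aut(F_k) w`. -/
def autOrbit {k : ℕ} (w : FG k) : Set (FG k) := {g | ∃ α : MulAut (FG k), α w = g}

/-- `u` is a cyclic permutation of `v`: the reduced word of `u` is a rotation of
the reduced word of `v`. -/
def IsCyclicPerm {k : ℕ} (u v : FG k) : Prop :=
  ∃ n : ℕ, FreeGroup.toWord u = (FreeGroup.toWord v).rotate n

/-- `w` is a proper power: `w = uⁿ` for some `n ≥ 2`. -/
def IsProperPower {k : ℕ} (w : FG k) : Prop := ∃ (u : FG k) (n : ℕ), 2 ≤ n ∧ w = u ^ n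

/-- `TS`: strictly minimal cyclically reduced `w` which are not proper powers and
are not conjugate to `τ w` for any nontrivial relabeling automorphism `τ`. -/
def TS (k : ℕ) : Set (FG k) :=
  {w | w ∈ SM k ∧ ¬ IsProperPower w ∧
    ∀ τ : MulAut (FG k), IsRelabeling τ → τ ≠ 1 → ¬ IsConj (τ w) w}

/-- `TS'`: elements whose cyclically reduced form lies in `TS`. -/
def TS' (k : ℕ) : Set (FG k) := {g | ∃ x u : FG k, u ∈ TS k ∧ g = x * u * x⁻¹}

/-- `Z`: elements of `TS` such that no relabeling automorphism sends `w` to a cyclic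
permutation of `w⁻¹`. -/
def Zset (k : ℕ) : Set (FG k) :=
  {w | w ∈ TS k ∧ ¬ ∃ τ : MulAut (FG k), IsRelabeling τ ∧ IsCyclicPerm (τ w) w⁻¹}

/-- Growth entropy `H(S) = limsup ρ(n,S)^{1/n}`. -/
noncomputable def entropyH {k : ℕ} (S : Set (FG k)) : ℝ :=
  Filter.limsup (fun n : ℕ => (rhoC S n : ℝ) ^ ((n : ℝ)⁻¹)) Filter.atTop

/-- Number of occurrences of the two-letter word `xy` as a subword of `w`. -/
def countPair {k : ℕ} (w : List (Letter k)) (x y : Letter k) : ℕ :=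
  (w.zip w.tail).count (x, y)

/-- The label `ŵ_{xy}` of the edge `[x⁻¹, y]` in the weighted Whitehead graph of the
cyclically reduced word `w`: occurrences of `xy` and of `y⁻¹x⁻¹` in `wc`, where `c` is
the first letter of `w`. -/
def whLabel {k : ℕ} (w : List (Letter k)) (x y : Letter k) : ℕ :=
  countPair (w ++ w.take 1) x y + countPair (w ++ w.take 1) (linv y) (linv x)

/-- The one-relator group `G_u = ⟨a_1,…,a_k ∣ u = 1⟩`. -/
abbrev OneRel (k : ℕ) (u : FG k) := FG k ⧸ Subgroup.normalClosure ({u} : Set (FG k))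

/-- `u` is primitive: it belongs to some free basis of `FG k`, equivalently it is the
image of a basis element under an automorphism. -/
def IsPrimitive {k : ℕ} (u : FG k) : Prop :=
  ∃ (α : MulAut (FG k)) (i : Fin k), α (FreeGroup.of i) = u

section Geom

open FreeGroup in
theorem head_mul_letter {k : ℕ} (z : FG k) (b : Letter k) (hz : z ≠ 1)
    (hzb : z * FreeGroup.mk [b] ≠ 1) :
    (FreeGroup.toWord (z * FreeGroup.mk [b])).head? = (FreeGroup.toWord z).head? := by
  have hne : z.toWord ≠ [] := by simpa using hz
  obtain ⟨W, c, hW⟩ : ∃ W c, z.toWord = W ++ [c] :=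
    ⟨_, _, (List.dropLast_append_getLast hne).symm⟩
  have hred : FreeGroup.IsReduced (W ++ [c]) := hW ▸ FreeGroup.isReduced_toWord
  have hz' : z = FreeGroup.mk (W ++ [c]) := by rw [← hW, FreeGroup.mk_toWord]
  by_cases hcb : c.1 = b.1 → c.2 = b.2
  · have h2 : FreeGroup.IsReduced (W ++ [c] ++ [b]) :=
      FreeGroup.IsReduced.append_overlap hred (by simpa using hcb) (by simp)
    rw [hW, hz', FreeGroup.mul_mk, FreeGroup.toWord_mk, h2.reduce_eq]
    cases W <;> simp
  · have h3 : z * FreeGroup.mk [b] = FreeGroup.mk W := by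
      rw [hz', ← FreeGroup.mul_mk, mul_assoc]
      have : FreeGroup.mk [c] * FreeGroup.mk [b] = 1 := by
        obtain ⟨c1, c2⟩ := c
        obtain ⟨b1, b2⟩ := b
        push Not at hcb
        obtain ⟨h1, h2⟩ := hcb
        simp only at h1 h2
        subst h1
        have : b2 = !c2 := by cases b2 <;> cases c2 <;> simp_all
        subst this
        rw [FreeGroup.mul_mk]
        exact Quot.sound (FreeGroup.Red.Step.not (L₁ := []) (L₂ := []))
      rw [this, mul_one]
    have hWr : FreeGroup.IsReduced W := hred.infix ⟨[], [c], by simp⟩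
    have hWne : W ≠ [] := by
      rintro rfl
      exact hzb h3
    rw [h3, hW, FreeGroup.toWord_mk, hWr.reduce_eq]
    cases W
    · exact absurd rfl hWne
    · simp

def StB {k : ℕ} (b : Letter k) (z : FG k) : Prop := (FreeGroup.toWord z).head? = some b

theorem stB_path {k : ℕ} (b : Letter k) (x : FG k) (L : List (Letter k))
    (hx : ∀ i ≤ L.length, x ≠ FreeGroup.mk (L.take i)) :
    StB b x⁻¹ ↔ StB b (x⁻¹ * FreeGroup.mk L) := by
  induction L using List.reverseRecOn with
  | nil => 
    have : (FreeGroup.mk [] : FG k) = 1 := rfl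
    rw [this, mul_one]
  | append_singleton L c ih =>
    have h1 := ih (fun i hi => by
      have := hx i (by simp; omega)
      rwa [List.take_append_of_le_length hi] at this)
    rw [h1, ← FreeGroup.mul_mk, ← mul_assoc]
    unfold StB
    rw [head_mul_letter]
    · have := hx L.length (by simp)
      rw [List.take_left'] at this
      · intro h
        apply this
        rw [inv_mul_eq_one] at h
        exact h
      · rfl
    · have := hx (L ++ [c]).length le_rfl
      rw [List.take_length, ← FreeGroup.mul_mk] at this
      intro h
      apply this
      rw [mul_assoc, inv_mul_eq_one] at h
      exact h

theorem finite_norm_le {k : ℕ} (n : ℕ) : {z : FG k | FreeGroup.norm z ≤ n}.Finite := by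
  refine Set.Finite.of_finite_image ((List.finite_length_le (Letter k) n).subset ?_)
    (FreeGroup.toWord_injective.injOn)
  rintro _ ⟨z, hz, rfl⟩
  exact hz

theorem exists_R {k : ℕ} (β : MulAut (FG k)) (b : Letter k) :
    ∃ R : ℕ, ∀ l y : List (Letter k), FreeGroup.IsReduced (l ++ y) → R < l.length →
      (StB b (β (FreeGroup.mk l)) ↔ StB b (β (FreeGroup.mk (l ++ y)))) := by
  classical
  obtain ⟨L, hL⟩ : ∃ L : ℕ, ∀ a : Letter k, FreeGroup.norm (β (FreeGroup.mk [a])) ≤ L :=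
    ⟨Finset.univ.sup fun a => FreeGroup.norm (β (FreeGroup.mk [a])), fun a =>
      Finset.le_sup (f := fun a => FreeGroup.norm (β (FreeGroup.mk [a]))) (Finset.mem_univ a)⟩
  have hfin : {z : FG k | FreeGroup.norm (β z) ≤ L}.Finite :=
    Set.Finite.preimage (f := β) (β.injective.injOn) (finite_norm_le L)
  obtain ⟨R, hR⟩ : ∃ R : ℕ, ∀ z : FG k, FreeGroup.norm (β z) ≤ L → FreeGroup.norm z ≤ R := by
    obtain ⟨R, hR⟩ := (hfin.image FreeGroup.norm).bddAbove
    exact ⟨R, fun z hz => hR ⟨z, hz, rfl⟩⟩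
  refine ⟨R, fun l y => ?_⟩
  induction y using List.reverseRecOn with
  | nil => simp
  | append_singleton y a ih =>
    intro hred hl
    have hred' : FreeGroup.IsReduced (l ++ y) := hred.infix ⟨[], [a], by simp⟩
    rw [ih hred' hl, ← List.append_assoc, ← FreeGroup.mul_mk (L₁ := l ++ y), map_mul]
    have hn : L < FreeGroup.norm (β (FreeGroup.mk (l ++ y))) := by
      by_contra hcon
      have := hR _ (not_lt.mp hcon)
      rw [FreeGroup.norm, FreeGroup.toWord_mk, hred'.reduce_eq] at this
      simp at this
      omega
    set z := β (FreeGroup.mk (l ++ y)) with hz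
    have hp := stB_path b z⁻¹ (β (FreeGroup.mk [a])).toWord (by
      intro i hi heq
      have h1 : FreeGroup.norm z ≤ i := by
        rw [← FreeGroup.norm_inv_eq, heq]
        refine FreeGroup.norm_mk_le.trans ?_
        simp
      have h2 := hL a
      unfold FreeGroup.norm at h2
      omega)
    rw [inv_inv, FreeGroup.mk_toWord] at hp
    exact hp

theorem exists_far {k : ℕ} (β : MulAut (FG k)) (f : ℕ → FG k) (hf : Function.Injective f)
    (R : ℕ) : ∃ n, R ≤ FreeGroup.norm (β.symm (f n)) := by
  by_contra hcon
  push Not at hcon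
  have hinj : Function.Injective (fun n => β.symm (f n)) := β.symm.injective.comp hf
  refine Set.infinite_of_injective_forall_mem hinj (s := {z | FreeGroup.norm z ≤ R})
    (fun n => (hcon n).le) (finite_norm_le R)

def PureDir {k : ℕ} (β : MulAut (FG k)) (b : Letter k) (h : FG k) (a : Letter k) (s : Prop) :
    Prop :=
  ∃ R : ℕ, ∀ l : List (Letter k), FreeGroup.IsReduced (a :: l) → R ≤ l.length →
    (StB b (β (h * FreeGroup.mk (a :: l))) ↔ s)

theorem exists_split {k : ℕ} (i0 : Fin k) (β : MulAut (FG k)) :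
    ∃ (h : FG k) (a a' : Letter k), a ≠ a' ∧ PureDir β (i0, true) h a True ∧
      PureDir β (i0, true) h a' False := by
  classical
  set b : Letter k := (i0, true) with hb
  by_contra hcon
  push Not at hcon
  obtain ⟨R, hR⟩ := exists_R β b
  let Pure' : List (Letter k) → Prop → Prop := fun l s =>
    ∃ R : ℕ, ∀ y : List (Letter k), FreeGroup.IsReduced (l ++ y) → R ≤ y.length →
      (StB b (β (FreeGroup.mk (l ++ y))) ↔ s)
  have key : ∀ d : ℕ, ∀ l : List (Letter k), FreeGroup.IsReduced l → R + 1 ≤ l.length + d →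
      (Pure' l True ∨ Pure' l False) := by
    intro d
    induction d with
    | zero =>
      intro l hl hlen
      by_cases hs : StB b (β (FreeGroup.mk l))
      · left
        exact ⟨0, fun y hy _ => by rw [← hR l y hy (by omega)]; simp [hs]⟩
      · right
        exact ⟨0, fun y hy _ => by rw [← hR l y hy (by omega)]; simp [hs]⟩
    | succ d ih =>
      intro l hl hlen
      have hch : ∀ a : Letter k, FreeGroup.IsReduced (l ++ [a]) →
          (Pure' (l ++ [a]) True ∨ Pure' (l ++ [a]) False) := fun a ha =>
        ih _ ha (by simp; omega)
      have hdir : ∀ (a : Letter k) (s : Prop), FreeGroup.IsReduced (l ++ [a]) →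
          Pure' (l ++ [a]) s → PureDir β b (FreeGroup.mk l) a s := by
        rintro a s ha ⟨r, hr⟩
        refine ⟨r, fun y hy hlen => ?_⟩
        have := hr y (FreeGroup.IsReduced.append_overlap ha (by simpa using hy) (by simp)) hlen
        rw [FreeGroup.mul_mk]
        simpa using this
      have hall : ∀ s : Prop, (∀ a, FreeGroup.IsReduced (l ++ [a]) → Pure' (l ++ [a]) s) →
          Pure' l s := by
        intro s hs
        have : ∀ a, ∃ r : ℕ, FreeGroup.IsReduced (l ++ [a]) → ∀ y : List (Letter k),
            FreeGroup.IsReduced (l ++ [a] ++ y) → r ≤ y.length →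
            (StB b (β (FreeGroup.mk (l ++ [a] ++ y))) ↔ s) := by
          intro a
          by_cases ha : FreeGroup.IsReduced (l ++ [a])
          · obtain ⟨r, hr⟩ := hs a ha
            exact ⟨r, fun _ => hr⟩
          · exact ⟨0, fun h => absurd h ha⟩
        choose f hf using this
        refine ⟨Finset.univ.sup f + 1, fun y hy hlen => ?_⟩
        cases y with
        | nil => simp at hlen
        | cons a y =>
          have hle : f a ≤ Finset.univ.sup f := Finset.le_sup (Finset.mem_univ a)
          have := hf a (hy.infix ⟨[], y, by simp⟩) y (by simpa using hy)
            (by rw [List.length_cons] at hlen; omega)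
          simpa using this
      by_cases hT : ∀ a, FreeGroup.IsReduced (l ++ [a]) → Pure' (l ++ [a]) True
      · exact Or.inl (hall True hT)
      · right
        push Not at hT
        obtain ⟨a0, ha0, hna0⟩ := hT
        have hF0 := (hch a0 ha0).resolve_left hna0
        apply hall
        intro a ha
        rcases hch a ha with h1 | h1
        · by_cases haa : a = a0
          · subst haa
            exact hF0
          · exact absurd (hdir a0 False ha0 hF0) (hcon _ _ _ haa (hdir a True ha h1))
        · exact h1
  have hroot := key (R + 1) [] (by simp) (by simp)
  have hfar : ∀ s, Pure' [] s → ∀ f : ℕ → FG k, Function.Injective f → ∃ n, (StB b (f n) ↔ s) := by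
    rintro s ⟨r, hr⟩ f hf
    obtain ⟨n, hn⟩ := exists_far β f hf r
    refine ⟨n, ?_⟩
    have := hr (β.symm (f n)).toWord (by simpa using FreeGroup.isReduced_toWord) hn
    simpa [FreeGroup.mk_toWord] using this
  have hpow : Function.Injective (fun n : ℕ => (FreeGroup.of i0 : FG k) ^ n) := by
    intro n m h
    have := congrArg FreeGroup.norm h
    simpa using this
  rcases hroot with h | h
  · obtain ⟨n, hn⟩ := hfar _ h (fun n => ((FreeGroup.of i0 : FG k) ^ n)⁻¹)
      (fun n m h => hpow (inv_injective h))
    simp [StB, FreeGroup.toWord_inv, FreeGroup.toWord_of_pow, FreeGroup.invRev, hb,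
      List.head?_replicate] at hn
  · obtain ⟨n, hn⟩ := hfar _ h (fun n => (FreeGroup.of i0 : FG k) ^ (n+1))
      (fun n m h => by have := hpow h; omega)
    simp [StB, FreeGroup.toWord_of_pow, hb, List.head?_replicate] at hn


theorem mk_flatten_replicate {k : ℕ} (u : List (Letter k)) (n : ℕ) :
    (FreeGroup.mk (List.replicate n u).flatten : FG k) = (FreeGroup.mk u) ^ n := by
  induction n with
  | zero => rfl
  | succ n ih => rw [List.replicate_succ, List.flatten_cons, ← FreeGroup.mul_mk, ih, pow_succ']

theorem fg_norm_pow_le {k : ℕ} (w : FG k) (n : ℕ) :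
    FreeGroup.norm (w ^ n) ≤ n * FreeGroup.norm w := by
  induction n with
  | zero => simp
  | succ n ih =>
    rw [pow_succ]
    refine (FreeGroup.norm_mul_le _ _).trans ?_
    rw [Nat.succ_mul]
    omega

/-- The key geometric fact. -/
theorem geom_main {k : ℕ} (i0 : Fin k) (w : FG k) (α : MulAut (FG k)) (y : FG k)
    (u : List (Letter k)) (hu : FreeGroup.IsCyclicallyReduced u)
    (hconj : FreeGroup.mk u = y * α w * y⁻¹)
    (hV : ∀ x z : Letter k, FreeGroup.IsReduced [x, z] →
      (List.replicate (FreeGroup.norm w + 1) [x, z]).flatten <:+: u) : False := by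
  classical
  set m := FreeGroup.norm w with hm
  obtain ⟨h, a, a', haa, ⟨R1, hR1⟩, ⟨R2, hR2⟩⟩ := exists_split i0 α.symm
  set b : Letter k := (i0, true) with hb
  set R := max R1 R2 with hR
  have hax : FreeGroup.IsReduced [linv a, a'] := by
    rw [FreeGroup.isReduced_cons_cons]
    refine ⟨fun h1 => ?_, by simp⟩
    obtain ⟨a1, a2⟩ := a
    obtain ⟨b1, b2⟩ := a'
    simp only [linv] at h1 ⊢
    subst h1
    cases a2 <;> cases b2 <;> simp_all
  obtain ⟨pre, post, hpp⟩ := hV _ _ hax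
  have hulen : u.length = pre.length + 2 * (m + 1) + post.length := by
    rw [← hpp]; simp; ring
  set C := FreeGroup.norm (α.symm y) with hC
  set N := 2 * R * m + 2 * C + 2 with hN
  set n := N + 2 * R with hn
  set Un := (List.replicate n u).flatten with hUn
  have hUnred : FreeGroup.IsReduced Un := (hu.flatten_replicate n).isReduced
  let P : ℕ × ℕ → List (Letter k) := fun p =>
    (List.replicate (R + p.1) u).flatten ++ pre ++ (List.replicate p.2 [linv a, a']).flatten
  let Q : ℕ × ℕ → List (Letter k) := fun p =>
    (List.replicate (m - p.2) [linv a, a']).flatten ++ post ++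
      (List.replicate (N + R - 1 - p.1) u).flatten
  have hdec : ∀ p ∈ Finset.range N ×ˢ Finset.range (m + 1),
      Un = P p ++ [linv a] ++ a' :: Q p := by
    rintro ⟨i, j⟩ hp
    simp only [Finset.mem_product, Finset.mem_range] at hp
    obtain ⟨hi, hj⟩ := hp
    have e1 : n = (R + i) + (1 + (N + R - 1 - i)) := by omega
    have e2 : m + 1 = j + (1 + (m - j)) := by omega
    rw [hUn, e1, List.replicate_add (R + i), List.replicate_add 1]
    simp only [List.flatten_append, P, Q]
    have : (List.replicate 1 u).flatten = pre ++ (List.replicate j [linv a, a']).flatten ++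
        ([linv a, a'] ++ (List.replicate (m - j) [linv a, a']).flatten) ++ post := by
      rw [e2, List.replicate_add j, List.replicate_add 1] at hpp
      simp only [List.flatten_append] at hpp
      simpa using hpp.symm
    rw [this]
    simp
  have hPlen : ∀ p, (P p).length = (R + p.1) * u.length + pre.length + 2 * p.2 := by
    intro p
    simp [P]; ring
  let X : ℕ × ℕ → FG k := fun p => FreeGroup.mk (P p ++ [linv a]) * h⁻¹
  have hXinj : Set.InjOn (fun p => α.symm (X p))
      (Finset.range N ×ˢ Finset.range (m + 1) : Finset (ℕ × ℕ)) := by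
    intro p hp p' hp' heq
    have h1 := mul_right_cancel (α.symm.injective heq)
    have hr : ∀ p ∈ Finset.range N ×ˢ Finset.range (m + 1),
        FreeGroup.IsReduced (P p ++ [linv a]) := fun p hp =>
      hUnred.infix ⟨[], a' :: Q p, by rw [hdec p hp]; simp⟩
    have h2 := FreeGroup.reduce.sound h1
    rw [(hr p hp).reduce_eq, (hr p' hp').reduce_eq] at h2
    have h3 := congrArg List.length h2
    simp only [List.length_append, hPlen, List.length_singleton] at h3
    have hj : p.2 < m + 1 := by simpa using (Finset.mem_product.mp hp).2
    have hj' : p'.2 < m + 1 := by simpa using (Finset.mem_product.mp hp').2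
    have hpos : 0 < u.length := by omega
    have h4 : 2 * p.2 + (R + p.1) * u.length = 2 * p'.2 + (R + p'.1) * u.length := by omega
    have h5 : R + p.1 = R + p'.1 := by
      have e := congrArg (· / u.length) h4
      simp only [Nat.add_mul_div_right _ _ hpos] at e
      rwa [Nat.div_eq_of_lt (by omega), Nat.div_eq_of_lt (by omega), zero_add, zero_add] at e
    rw [h5] at h4
    exact Prod.ext (by omega) (by omega)
  set L := (α.symm (FreeGroup.mk Un)).toWord with hL
  have hmem : ∀ p ∈ Finset.range N ×ˢ Finset.range (m + 1),
      α.symm (X p) ∈ (Finset.range (L.length + 1)).image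
        (fun i => (FreeGroup.mk (L.take i) : FG k)) := by
    intro p hp
    by_contra hnot
    have hpath := stB_path b (α.symm (X p)) L (by
      intro i hi heq
      exact hnot (Finset.mem_image.mpr ⟨i, by simp; omega, heq.symm⟩))
    have hd := hdec p hp
    have hp2 := hp
    simp only [Finset.mem_product, Finset.mem_range] at hp2
    obtain ⟨hi, hj⟩ := hp2
    have hpos : 1 ≤ u.length := by omega
    rw [hL, FreeGroup.mk_toWord, ← map_inv, ← map_mul] at hpath
    have e1 : (X p)⁻¹ = h * FreeGroup.mk (a :: FreeGroup.invRev (P p)) := by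
      simp [X, FreeGroup.inv_mk, FreeGroup.invRev, linv]
    have e2 : (X p)⁻¹ * FreeGroup.mk Un = h * FreeGroup.mk (a' :: Q p) := by
      rw [hd, ← FreeGroup.mul_mk (L₁ := P p ++ [linv a])]
      simp only [X]
      group
    have r1 : FreeGroup.IsReduced (a :: FreeGroup.invRev (P p)) := by
      have : FreeGroup.IsReduced (P p ++ [linv a]) :=
        hUnred.infix ⟨[], a' :: Q p, by rw [hd]; simp⟩
      have h2 : FreeGroup.IsReduced (FreeGroup.invRev (P p ++ [linv a])) := by
        rw [FreeGroup.isReduced_iff_reduce_eq, FreeGroup.reduce_invRev, this.reduce_eq]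
      simpa [FreeGroup.invRev, linv] using h2
    have r2 : FreeGroup.IsReduced (a' :: Q p) :=
      hUnred.infix ⟨P p ++ [linv a], [], by rw [hd]; simp⟩
    have l1 : R1 ≤ (FreeGroup.invRev (P p)).length := by
      rw [FreeGroup.invRev_length, hPlen]
      have : R + p.1 ≤ (R + p.1) * u.length := Nat.le_mul_of_pos_right _ hpos
      have : R1 ≤ R := le_max_left _ _
      omega
    have l2 : R2 ≤ (Q p).length := by
      have : (Q p).length = (m - p.2) * 2 + post.length + (N + R - 1 - p.1) * u.length := by
        simp [Q]; ring
      have : N + R - 1 - p.1 ≤ (N + R - 1 - p.1) * u.length := Nat.le_mul_of_pos_right _ hpos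
      have : R2 ≤ R := le_max_right _ _
      omega
    have c1 := hR1 _ r1 l1
    have c2 := hR2 _ r2 l2
    rw [← e1] at c1
    rw [← e2] at c2
    exact c2.mp (hpath.mp (c1.mpr trivial))
  have hcard := Finset.card_le_card_of_injOn _ hmem hXinj
  have hcard2 := hcard.trans Finset.card_image_le
  simp only [Finset.card_product, Finset.card_range] at hcard2
  have hLlen : L.length ≤ n * m + 2 * C := by
    have e : α.symm (FreeGroup.mk Un) = α.symm y * w ^ n * (α.symm y)⁻¹ := by
      rw [hUn, mk_flatten_replicate, hconj, conj_pow, map_mul, map_mul, map_pow, map_inv]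
      simp
    have : L.length = FreeGroup.norm (α.symm (FreeGroup.mk Un)) := rfl
    rw [this, e]
    have h1 := FreeGroup.norm_mul_le (α.symm y * w ^ n) (α.symm y)⁻¹
    have h2 := FreeGroup.norm_mul_le (α.symm y) (w ^ n)
    have h3 := fg_norm_pow_le w n
    rw [← hm] at h3
    rw [FreeGroup.norm_inv_eq] at h1
    omega
  have hLlen' : L.length ≤ (N + 2 * R) * m + 2 * C := hLlen
  have : N * (m + 1) ≤ (N + 2 * R) * m + 2 * C + 1 := by omega
  nlinarith

end Geom

section Count

noncomputable def EF {k : ℕ} (c : Letter k) (n : ℕ) (P : List (Letter k) → Prop) :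
    Finset (List (Letter k)) :=
  ((List.finite_length_eq (Letter k) n).subset
    (t := {l : List (Letter k) | l.length = n ∧ FreeGroup.IsReduced (c :: l) ∧ P l}) (fun _ h => h.1)).toFinset

theorem mem_EF {k : ℕ} {c : Letter k} {n : ℕ} {P : List (Letter k) → Prop}
    {l : List (Letter k)} :
    l ∈ EF c n P ↔ l.length = n ∧ FreeGroup.IsReduced (c :: l) ∧ P l := by
  simp [EF]

theorem card_next {k : ℕ} (c : Letter k) :
    (Finset.univ.filter fun d : Letter k => (c.1 = d.1 → c.2 = d.2)).card = 2 * k - 1 := by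
  have : (Finset.univ.filter fun d : Letter k => (c.1 = d.1 → c.2 = d.2))
      = Finset.univ.erase (linv c) := by
    ext ⟨d1, d2⟩
    obtain ⟨c1, c2⟩ := c
    simp only [Finset.mem_filter, Finset.mem_univ, true_and, Finset.mem_erase, linv, and_true,
      ne_eq, Prod.mk.injEq, not_and]
    cases c2 <;> cases d2 <;> simp [eq_comm]
  rw [this, Finset.card_erase_of_mem (Finset.mem_univ _)]
  simp
  omega

theorem card_EF_true {k : ℕ} (n : ℕ) (c : Letter k) :
    (EF c n (fun _ => True)).card = (2 * k - 1) ^ n := by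
  classical
  induction n generalizing c with
  | zero =>
    have : EF c 0 (fun _ => True) = {[]} := by
      ext l
      rw [mem_EF]
      simp only [List.length_eq_zero_iff, Finset.mem_singleton, and_true]
      constructor
      · exact fun h => h.1
      · rintro rfl
        simp
    rw [this]; simp
  | succ n ih =>
    have : EF c (n + 1) (fun _ => True) =
        (Finset.univ.filter fun d : Letter k => (c.1 = d.1 → c.2 = d.2)).biUnion
          (fun d => (EF d n (fun _ => True)).image (List.cons d)) := by
      ext l
      simp only [mem_EF, Finset.mem_biUnion, Finset.mem_image, Finset.mem_filter,
        Finset.mem_univ, true_and, and_true]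
      constructor
      · rintro ⟨h1, h2⟩
        cases l with
        | nil => simp at h1
        | cons d l =>
          rw [FreeGroup.isReduced_cons_cons] at h2
          exact ⟨d, h2.1, l, ⟨by simpa using h1, h2.2⟩, rfl⟩
      · rintro ⟨d, hd, l, ⟨h1, h2⟩, rfl⟩
        exact ⟨by simpa using h1, FreeGroup.isReduced_cons_cons.mpr ⟨hd, h2⟩⟩
    rw [this, Finset.card_biUnion]
    · rw [Finset.sum_congr rfl (fun d _ => by
        rw [Finset.card_image_of_injective _ (List.cons_injective), ih d])]
      rw [Finset.sum_const, card_next, smul_eq_mul, pow_succ']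
    · intro d _ d' _ hdd
      rw [Function.onFun, Finset.disjoint_left]
      simp only [Finset.mem_image]
      rintro _ ⟨l, _, rfl⟩ ⟨l', _, h⟩
      exact hdd (List.cons.inj h).1.symm

theorem EF_star {k : ℕ} (c : Letter k) (a b : ℕ) (P Q R : List (Letter k) → Prop)
    (hP : ∀ l, l.length = a + b → P l → Q (l.take a) ∧ R (l.drop a)) (N : ℕ)
    (hN : ∀ c', (EF c' b R).card ≤ N) :
    (EF c (a + b) P).card ≤ (EF c a Q).card * N := by
  classical
  rw [mul_comm]
  refine Finset.card_le_mul_card_image_of_maps_to (f := List.take a) ?_ N ?_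
  · intro l hl
    rw [mem_EF] at hl
    rw [mem_EF]
    refine ⟨by simp [hl.1], hl.2.1.infix ⟨[], l.drop a, by simp⟩, (hP l hl.1 hl.2.2).1⟩
  · intro t ht
    rw [mem_EF] at ht
    refine le_trans ?_ (hN ((c :: t).getLast (by simp)))
    refine Finset.card_le_card_of_injOn (List.drop a) ?_ ?_
    · intro l hl
      rw [Finset.mem_coe, Finset.mem_filter, mem_EF] at hl
      obtain ⟨⟨h1, h2, h3⟩, h4⟩ := hl
      rw [Finset.mem_coe, mem_EF]
      refine ⟨by simp [h1], h2.infix ⟨(c :: t).dropLast, [], ?_⟩, (hP l h1 h3).2⟩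
      have e1 := List.dropLast_append_getLast (l := c :: t) (by simp)
      rw [List.append_nil]
      calc _ = ((c :: t).dropLast ++ [(c :: t).getLast (by simp)]) ++ l.drop a := by
            simp only [List.append_assoc, List.singleton_append]
        _ = c :: l := by rw [e1, ← h4]; simp
    · intro l hl l' hl' heq
      rw [Finset.mem_coe, Finset.mem_filter] at hl hl'
      rw [← List.take_append_drop a l, ← List.take_append_drop a l', hl.2, hl'.2, heq]

theorem EF_mono {k : ℕ} (c : Letter k) (n : ℕ) (P Q : List (Letter k) → Prop)
    (h : ∀ l, P l → Q l) : EF c n P ⊆ EF c n Q := by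
  intro l hl
  rw [mem_EF] at hl ⊢
  exact ⟨hl.1, hl.2.1, h _ hl.2.2⟩

theorem card_EF_le {k : ℕ} (n : ℕ) (c : Letter k) (P : List (Letter k) → Prop) :
    (EF c n P).card ≤ (2 * k - 1) ^ n := by
  rw [← card_EF_true n c]
  exact Finset.card_le_card (EF_mono c n P _ (fun _ _ => trivial))

theorem exists_connector {k : ℕ} (hk : 2 ≤ k) (c e : Letter k) :
    ∃ d : Letter k, (c.1 = d.1 → c.2 = d.2) ∧ (d.1 = e.1 → d.2 = e.2) := by
  by_cases h : c.1 = e.1 ∧ c.2 ≠ e.2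
  · obtain ⟨i, hi⟩ : ∃ i : Fin k, i ≠ c.1 := by
      have : Nontrivial (Fin k) := Fin.nontrivial_iff_two_le.mpr hk
      exact exists_ne c.1
    refine ⟨(i, true), fun h1 => absurd h1.symm hi, fun h1 => absurd (h1.trans h.1.symm) hi⟩
  · refine ⟨c, fun _ => rfl, fun h1 => ?_⟩
    by_contra h2
    exact h ⟨h1, h2⟩

theorem card_EF_avoid_block {k : ℕ} (hk : 2 ≤ k) (V : List (Letter k))
    (hV : FreeGroup.IsReduced V) (hne : V ≠ []) (c : Letter k) :
    (EF c (V.length + 1) (fun l => ¬ V <:+: l)).card ≤ (2 * k - 1) ^ (V.length + 1) - 1 := by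
  classical
  apply Nat.le_sub_one_of_lt
  rw [← card_EF_true (V.length + 1) c]
  apply Finset.card_lt_card
  rw [Finset.ssubset_iff_of_subset (EF_mono c _ _ _ (fun _ _ => trivial))]
  cases V with
  | nil => exact absurd rfl hne
  | cons e V =>
    obtain ⟨d, hd1, hd2⟩ := exists_connector hk c e
    refine ⟨d :: e :: V, ?_, ?_⟩
    · rw [mem_EF]
      refine ⟨by simp, ?_, trivial⟩
      rw [FreeGroup.isReduced_cons_cons, FreeGroup.isReduced_cons_cons]
      exact ⟨hd1, hd2, hV⟩
    · rw [mem_EF]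
      rintro ⟨_, _, h⟩
      exact h ⟨[d], [], by simp⟩

theorem card_EF_avoid {k : ℕ} (hk : 2 ≤ k) (V : List (Letter k))
    (hV : FreeGroup.IsReduced V) (hne : V ≠ []) (j r : ℕ) (c : Letter k) :
    (EF c ((V.length + 1) * j + r) (fun l => ¬ V <:+: l)).card ≤
      ((2 * k - 1) ^ (V.length + 1) - 1) ^ j * (2 * k - 1) ^ r := by
  induction j generalizing c with
  | zero => simpa using card_EF_le r c _
  | succ j ih =>
    have e : (V.length + 1) * (j + 1) + r = (V.length + 1) + ((V.length + 1) * j + r) := by ring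
    rw [e]
    refine (EF_star c _ _ _ (fun l => ¬ V <:+: l) (fun l => ¬ V <:+: l) ?_ _ ih).trans ?_
    · intro l _ h
      exact ⟨fun h' => h (h'.trans (List.take_prefix _ _).isInfix),
        fun h' => h (h'.trans (List.drop_suffix _ _).isInfix)⟩
    · rw [pow_succ' _ j, mul_assoc]
      exact Nat.mul_le_mul_right _ (card_EF_avoid_block hk V hV hne c)

theorem card_EF_middle {k : ℕ} (t N M : ℕ) (V : List (Letter k))
    (hM : ∀ c : Letter k, (EF c N (fun l => ¬ V <:+: l)).card ≤ M) (c : Letter k) :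
    (EF c (t + (N + t)) (fun l => ¬ V <:+: (l.drop t).take N)).card ≤
      (2 * k - 1) ^ t * (M * (2 * k - 1) ^ t) := by
  refine (EF_star c t (N + t) _ (fun _ => True) (fun l => ¬ V <:+: l.take N) ?_
    (M * (2 * k - 1) ^ t) ?_).trans ?_
  · exact fun l _ h => ⟨trivial, h⟩
  · intro c'
    refine (EF_star c' N t _ (fun l => ¬ V <:+: l) (fun _ => True) ?_
      ((2 * k - 1) ^ t) ?_).trans ?_
    · exact fun l _ h => ⟨h, trivial⟩
    · exact fun c'' => card_EF_le _ _ _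
    · exact Nat.mul_le_mul_right _ (hM c')
  · exact Nat.mul_le_mul_right _ (card_EF_le _ _ _)

theorem card_EF_sym {k : ℕ} (n t : ℕ) (ht : 2 * t ≤ n) (c : Letter k) :
    (EF c n (fun l => l.drop (n - t) = FreeGroup.invRev (l.take t))).card ≤
      (2 * k - 1) ^ (n - t) := by
  refine le_trans ?_ (card_EF_le (n - t) c (fun _ => True))
  refine Finset.card_le_card_of_injOn (List.take (n - t)) ?_ ?_
  · intro l hl
    rw [Finset.mem_coe, mem_EF] at hl ⊢
    exact ⟨by simp [hl.1], hl.2.1.infix ⟨[], l.drop (n - t), by simp⟩, trivial⟩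
  · intro l hl l' hl' heq
    rw [Finset.mem_coe, mem_EF] at hl hl'
    have h1 : l.take t = l'.take t := by
      have := congrArg (List.take t) heq
      rwa [List.take_take, List.take_take, min_eq_left (by omega)] at this
    rw [← List.take_append_drop (n - t) l, ← List.take_append_drop (n - t) l', heq,
      hl.2.2, hl'.2.2, h1]

end Count

section Assemble

def Vw {k : ℕ} (m : ℕ) (x z : Letter k) : List (Letter k) :=
  (List.replicate (m + 1) [x, z]).flatten

theorem Vw_length {k : ℕ} (m : ℕ) (x z : Letter k) : (Vw m x z).length = 2 * m + 2 := by
  simp [Vw]; ring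

theorem Vw_reduced {k : ℕ} (m : ℕ) (x z : Letter k) (h : FreeGroup.IsReduced [x, z]) :
    FreeGroup.IsReduced (Vw m x z) := by
  have : FreeGroup.IsCyclicallyReduced [x, z] := by
    refine ⟨h, ?_⟩
    rw [FreeGroup.isReduced_cons_cons] at h
    intro a ha b hb
    simp at ha hb
    subst ha hb
    exact fun e => (h.1 e.symm).symm
  exact (this.flatten_replicate _).isReduced

theorem orbit_dichotomy {k : ℕ} (i0 : Fin k) (w g : FG k) (hg : g ∈ autOrbit w) (n t : ℕ)
    (hn : wordLength g = n) (ht : 2 * t ≤ n) :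
    (g.toWord.drop (n - t) = FreeGroup.invRev (g.toWord.take t)) ∨
    ∃ x z : Letter k, FreeGroup.IsReduced [x, z] ∧
      ¬ Vw (FreeGroup.norm w) x z <:+: (g.toWord.drop t).take (n - 2 * t) := by
  obtain ⟨α, rfl⟩ := hg
  set l := (α w).toWord with hl
  have hdec := FreeGroup.reduceCyclically.conj_conjugator_reduceCyclically l
  have hcyc := FreeGroup.reduceCyclically.isCyclicallyReduced
    (FreeGroup.isReduced_toWord (x := α w))
  rw [← hl] at hcyc
  set cj := FreeGroup.reduceCyclically.conjugator l
  set u := FreeGroup.reduceCyclically l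
  have hlen : n = 2 * cj.length + u.length := by
    rw [← hn, wordLength, ← hl, ← hdec]
    simp [FreeGroup.invRev_length]
    ring
  by_cases hc : t ≤ cj.length
  · left
    have e : l = cj.take t ++ (cj.drop t ++ u ++ FreeGroup.invRev (cj.drop t)) ++
        FreeGroup.invRev (cj.take t) := by
      have h1 : FreeGroup.invRev cj =
          FreeGroup.invRev (cj.drop t) ++ FreeGroup.invRev (cj.take t) := by
        rw [← FreeGroup.invRev_append, List.take_append_drop]
      have h2 : cj = cj.take t ++ cj.drop t := (List.take_append_drop _ _).symm
      calc l = cj ++ u ++ FreeGroup.invRev cj := hdec.symm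
        _ = (cj.take t ++ cj.drop t) ++ u ++
          (FreeGroup.invRev (cj.drop t) ++ FreeGroup.invRev (cj.take t)) := by
            rw [← h1, ← h2]
        _ = _ := by simp only [List.append_assoc]
    have ht1 : l.take t = cj.take t := by
      rw [e, List.append_assoc, List.take_left' (by simp [hc])]
    rw [ht1]
    conv_lhs => rw [e]
    rw [List.drop_left']
    simp [FreeGroup.invRev_length]
    omega
  · right
    by_contra hcon
    push Not at hcon hc
    refine geom_main i0 w α (FreeGroup.mk cj)⁻¹ u hcyc ?_ ?_
    · have : α w = FreeGroup.mk cj * FreeGroup.mk u * (FreeGroup.mk cj)⁻¹ := by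
        rw [FreeGroup.inv_mk, FreeGroup.mul_mk, FreeGroup.mul_mk, hdec, hl, FreeGroup.mk_toWord]
      rw [this]
      group
    · intro x z hxz
      refine (hcon x z hxz).trans ?_
      have : (l.drop t).take (n - 2 * t) = (u.drop (t - cj.length)).take (n - 2 * t) := by
        conv_lhs => rw [← hdec]
        rw [List.append_assoc, List.drop_append, List.drop_eq_nil_of_le hc.le, List.nil_append,
          List.drop_append_of_le_length (by omega), List.take_append_of_le_length]
        simp
        omega
      rw [this]
      exact (List.take_prefix _ _).isInfix.trans (List.drop_suffix _ _).isInfix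

theorem orbit_count {k : ℕ} (hk : 2 ≤ k) (w : FG k) (n t B : ℕ) (ht : 2 * t ≤ n)
    (hB : ∀ (x z c : Letter k), FreeGroup.IsReduced [x, z] →
      (EF c n (fun l => ¬ Vw (FreeGroup.norm w) x z <:+: (l.drop t).take (n - 2 * t))).card ≤ B) :
    {g ∈ autOrbit w | wordLength g = n}.ncard ≤
      2 * k * ((2 * k - 1) ^ (n - t) + 2 * k * (2 * k) * B) := by
  classical
  have i0 : Fin k := ⟨0, by omega⟩
  let S : Letter k → Finset (List (Letter k)) := fun c =>
    EF c n (fun l => l.drop (n - t) = FreeGroup.invRev (l.take t)) ∪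
    (Finset.univ.filter fun p : Letter k × Letter k => FreeGroup.IsReduced [p.1, p.2]).biUnion
      (fun p => EF c n
        (fun l => ¬ Vw (FreeGroup.norm w) p.1 p.2 <:+: (l.drop t).take (n - 2 * t)))
  have hS : ∀ c, (S c).card ≤ (2 * k - 1) ^ (n - t) + 2 * k * (2 * k) * B := by
    intro c
    refine (Finset.card_union_le _ _).trans (add_le_add (card_EF_sym n t ht c) ?_)
    refine (Finset.card_biUnion_le_card_mul _ _ B ?_).trans (Nat.mul_le_mul_right _ ?_)
    · intro p hp
      exact hB p.1 p.2 c (Finset.mem_filter.mp hp).2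
    · refine (Finset.card_filter_le _ _).trans ?_
      simp [mul_comm]
  have hsub : ∀ g ∈ {g ∈ autOrbit w | wordLength g = n},
      g.toWord ∈ (↑(Finset.univ.biUnion S) : Set (List (Letter k))) := by
    rintro g ⟨hg, hgn⟩
    rw [Finset.mem_coe, Finset.mem_biUnion]
    obtain ⟨c, hc⟩ : ∃ c : Letter k, FreeGroup.IsReduced (c :: g.toWord) := by
      have hr := FreeGroup.isReduced_toWord (x := g)
      cases hgw : g.toWord with
      | nil => exact ⟨(i0, true), by simp⟩
      | cons d l =>
        rw [hgw] at hr
        exact ⟨d, FreeGroup.isReduced_cons_cons.mpr ⟨fun _ => rfl, hr⟩⟩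
    refine ⟨c, Finset.mem_univ _, ?_⟩
    rw [Finset.mem_union]
    rcases orbit_dichotomy i0 w g hg n t hgn ht with h | ⟨x, z, hxz, h⟩
    · left
      exact mem_EF.mpr ⟨hgn, hc, h⟩
    · right
      rw [Finset.mem_biUnion]
      exact ⟨(x, z), by simpa using hxz, mem_EF.mpr ⟨hgn, hc, h⟩⟩
  have h1 := Set.ncard_le_ncard_of_injOn FreeGroup.toWord hsub
    (FreeGroup.toWord_injective.injOn) (Finset.finite_toSet _)
  rw [Set.ncard_coe_finset] at h1
  refine h1.trans ((Finset.card_biUnion_le_card_mul _ _ _ (fun c _ => hS c)).trans ?_)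
  apply Nat.mul_le_mul_right
  simp [mul_comm]

theorem gamma_bound {k : ℕ} (hk : 2 ≤ k) (w : FG k) :
    ∃ K : ℝ, 0 < K ∧ ∃ σ : ℝ, 0 < σ ∧ σ < 1 ∧ 2 ≤ (2 * k - 1) * σ ∧
    ∀ n : ℕ, ({g ∈ autOrbit w | wordLength g = n}.ncard : ℝ) ≤ K * ((2 * k - 1) * σ) ^ n := by
  set m := FreeGroup.norm w with hm
  set L := 2 * m + 3 with hL
  set q : ℝ := 2 * k - 1 with hq
  have hkR : (2 : ℝ) ≤ k := by exact_mod_cast hk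
  have hq3 : 3 ≤ q := by linarith
  have hq0 : 0 < q := by linarith
  have hqn : ((2 * k - 1 : ℕ) : ℝ) = q := by
    rw [Nat.cast_sub (by omega)]; push_cast; rfl
  have hqL : q ≤ q ^ L := le_self_pow₀ (by linarith) (by omega)
  have hqL0 : 0 < q ^ L := by positivity
  set e : ℝ := 1 - (q ^ L)⁻¹ with he
  have hinv : (q ^ L)⁻¹ ≤ q⁻¹ := inv_anti₀ hq0 hqL
  have hinv3 : q⁻¹ ≤ 3⁻¹ := inv_anti₀ (by norm_num) hq3
  have he0 : 0 < e := by
    have : (3 : ℝ)⁻¹ < 1 := by norm_num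
    linarith
  have he1 : e < 1 := by
    have : 0 < (q ^ L)⁻¹ := by positivity
    linarith
  obtain ⟨σ, hσ0, hσ1, hσe⟩ : ∃ σ : ℝ, 0 < σ ∧ σ < 1 ∧ σ ^ (3 * L) = e := by
    refine ⟨e ^ (((3 * L : ℕ) : ℝ)⁻¹), Real.rpow_pos_of_pos he0 _,
      Real.rpow_lt_one he0.le he1 (by positivity), ?_⟩
    exact Real.rpow_inv_natCast_pow he0.le (by omega)
  have hσle : ∀ j : ℕ, j ≤ 3 * L → e ≤ σ ^ j := fun j hj => by
    rw [← hσe]; exact pow_le_pow_of_le_one hσ0.le hσ1.le hj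
  have hσq : 2 ≤ q * σ := by
    have h1 : e ≤ σ := by simpa using hσle 1 (by omega)
    have h2 : q * (1 - q⁻¹) ≤ q * σ := by
      apply mul_le_mul_of_nonneg_left _ hq0.le
      linarith
    have h3 : q * (1 - q⁻¹) = q - 1 := by field_simp
    linarith
  have hblock : q ^ L - 1 = q ^ L * σ ^ (3 * L) := by
    rw [hσe, he]; field_simp
  refine ⟨2 * k * (1 + 2 * k * (2 * k)) / e, by positivity, σ, hσ0, hσ1, hσq, fun n => ?_⟩
  set t := n / 3 with ht
  set N := n - 2 * t with hN
  have ht2 : 2 * t ≤ n := by omega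
  have hn : n = t + (N + t) := by omega
  set j := N / L with hj
  set r := N % L with hr
  have hNj : N = L * j + r := (Nat.div_add_mod N L).symm
  have hrL : r < L := Nat.mod_lt _ (by omega)
  have hc := orbit_count hk w n t
    ((2 * k - 1) ^ t * ((((2 * k - 1) ^ L - 1) ^ j * (2 * k - 1) ^ r) * (2 * k - 1) ^ t)) ht2 (by
      intro x z c hxz
      have hlen : (Vw m x z).length + 1 = L := by rw [Vw_length]
      have := card_EF_middle t N _ (Vw m x z) (fun c => by
        have h1 := card_EF_avoid hk (Vw m x z) (Vw_reduced m x z hxz)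
          (by rw [← List.length_pos_iff, Vw_length]; omega) j r c
        rw [hlen, ← hNj] at h1
        exact h1) c
      rw [← hn] at this
      exact this)
  have hcR : ({g ∈ autOrbit w | wordLength g = n}.ncard : ℝ) ≤
      2 * k * (q ^ (n - t) + 2 * k * (2 * k) *
        (q ^ t * (((q ^ L - 1) ^ j * q ^ r) * q ^ t))) := by
    have h1 : 1 ≤ (2 * k - 1) ^ L := Nat.one_le_pow _ _ (by omega)
    have := (Nat.cast_le (α := ℝ)).mpr hc
    push_cast [Nat.cast_sub h1, hqn] at this
    exact this
  refine hcR.trans ?_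
  have hA : q ^ (n - t) ≤ (q * σ) ^ n / e := by
    rw [le_div_iff₀ he0]
    have h1 : e ≤ q ^ t * σ ^ n := by
      have h2 : 1 ≤ (q * σ ^ 3) ^ t := by
        apply one_le_pow₀
        have h3 : e ≤ σ ^ 3 := hσle 3 (by omega)
        have h4 : 3 * (2 / 3) ≤ q * σ ^ 3 := by
          apply mul_le_mul hq3 _ (by norm_num) hq0.le
          norm_num at hinv3
          linarith
        linarith
      have h5 : e ≤ σ ^ (n - 3 * t) := hσle _ (by omega)
      have h6 : q ^ t * σ ^ n = (q * σ ^ 3) ^ t * σ ^ (n - 3 * t) := by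
        rw [mul_pow, ← pow_mul, mul_assoc, ← pow_add]
        congr 2
        omega
      rw [h6]
      calc e = 1 * e := (one_mul e).symm
        _ ≤ _ := mul_le_mul h2 h5 he0.le (by linarith)
    calc q ^ (n - t) * e ≤ q ^ (n - t) * (q ^ t * σ ^ n) :=
          mul_le_mul_of_nonneg_left h1 (by positivity)
      _ = (q * σ) ^ n := by
          rw [← mul_assoc, ← pow_add, mul_pow]
          congr 2
          omega
  have hBb : q ^ t * (((q ^ L - 1) ^ j * q ^ r) * q ^ t) ≤ (q * σ) ^ n / e := by
    have h1 : q ^ t * (((q ^ L - 1) ^ j * q ^ r) * q ^ t) = q ^ n * σ ^ (3 * L * j) := by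
      rw [hblock, mul_pow, ← pow_mul, ← pow_mul]
      have : q ^ n = q ^ t * (q ^ (L * j) * q ^ r * q ^ t) := by
        rw [← pow_add, ← pow_add, ← pow_add]
        congr 1
        omega
      rw [this]
      ring
    rw [h1, le_div_iff₀ he0, mul_pow, mul_assoc]
    apply mul_le_mul_of_nonneg_left _ (by positivity)
    rw [← hσe, ← pow_add]
    apply pow_le_pow_of_le_one hσ0.le hσ1.le
    have : 3 * L * j = 3 * (L * j) := by ring
    omega
  have h2 : 2 * k * (1 + 2 * k * (2 * k)) / e * (q * σ) ^ n =
      2 * k * ((q * σ) ^ n / e + 2 * k * (2 * k) * ((q * σ) ^ n / e)) := by ring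
  rw [h2]
  gcongr

theorem finite_wl {k : ℕ} (S : Set (FG k)) (n : ℕ) : {g ∈ S | wordLength g ≤ n}.Finite :=
  (finite_norm_le n).subset fun _ h => h.2

theorem rho_bound {k : ℕ} (S : Set (FG k)) (K x : ℝ) (hK : 0 < K) (hx : 2 ≤ x)
    (h : ∀ n : ℕ, ({g ∈ S | wordLength g = n}.ncard : ℝ) ≤ K * x ^ n) (n : ℕ) :
    (rhoC S n : ℝ) ≤ 2 * K * x ^ n := by
  induction n with
  | zero =>
    have : rhoC S 0 = {g ∈ S | wordLength g = 0}.ncard := by simp [rhoC]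
    rw [this]
    have := h 0
    simp at this ⊢
    linarith
  | succ n ih =>
    have e : {g ∈ S | wordLength g ≤ n + 1} =
        {g ∈ S | wordLength g ≤ n} ∪ {g ∈ S | wordLength g = n + 1} := by
      ext g
      simp only [Set.mem_setOf_eq, Set.mem_union, Nat.le_succ_iff]
      tauto
    have h1 : (rhoC S (n + 1) : ℝ) ≤ rhoC S n + {g ∈ S | wordLength g = n + 1}.ncard := by
      rw [rhoC, e]
      exact_mod_cast Set.ncard_union_le _ _
    have h2 := h (n + 1)
    have h3 : x ^ (n + 1) = x * x ^ n := pow_succ' x n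
    have h4 : 0 < x ^ n := by positivity
    have h5 : 2 * (K * x ^ n) ≤ x * (K * x ^ n) :=
      mul_le_mul_of_nonneg_right hx (by positivity)
    rw [h3] at h2 ⊢
    nlinarith

theorem rho_mono {k : ℕ} {S T : Set (FG k)} (h : S ⊆ T) (n : ℕ) : rhoC S n ≤ rhoC T n :=
  Set.ncard_le_ncard (fun _ hg => ⟨h hg.1, hg.2⟩) (finite_wl T n)

theorem rho_Cset_lower {k : ℕ} (hk : 2 ≤ k) (n : ℕ) :
    (2 * k - 1) ^ n ≤ rhoC (Cset k) n * (2 * k - 1) ^ 2 := by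
  have hpos : 0 < 2 * k - 1 := by omega
  by_cases hn : n < 2
  · have h1 : 1 ≤ rhoC (Cset k) n := by
      rw [rhoC, Nat.one_le_iff_ne_zero, ← Nat.pos_iff_ne_zero,
        Set.ncard_pos (finite_wl _ _)]
      refine ⟨1, ?_, ?_⟩
      · simp [Cset, IsCyclicallyReduced, CyclicallyReducedWord]
      · simp [wordLength]
    calc (2 * k - 1) ^ n ≤ (2 * k - 1) ^ 2 := Nat.pow_le_pow_right hpos hn.le
      _ = 1 * (2 * k - 1) ^ 2 := (one_mul _).symm
      _ ≤ _ := Nat.mul_le_mul_right _ h1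
  · obtain ⟨p, rfl⟩ : ∃ p, n = p + 2 := ⟨n - 2, by omega⟩
    rw [pow_add]
    apply Nat.mul_le_mul_right
    let c : Letter k := (⟨0, by omega⟩, true)
    rw [← card_EF_true p c, ← Set.ncard_coe_finset]
    have hex : ∀ l : List (Letter k), ∃ d : Letter k,
        (((c :: l).getLast (by simp)).1 = d.1 → ((c :: l).getLast (by simp)).2 = d.2) ∧
          (d.1 = c.1 → d.2 = c.2) := fun l => exists_connector hk _ _
    choose d hd1 hd2 using hex
    have hred : ∀ l, FreeGroup.IsReduced (c :: l) → FreeGroup.IsReduced (c :: l ++ [d l]) := by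
      intro l hl
      have e1 := List.dropLast_append_getLast (l := c :: l) (by simp)
      rw [← e1] at hl
      have := FreeGroup.IsReduced.append_overlap hl (L₃ := [d l])
        (by simpa using hd1 l) (by simp)
      rwa [e1] at this
    have hw : ∀ l, FreeGroup.IsReduced (c :: l) →
        (FreeGroup.mk (c :: l ++ [d l]) : FG k).toWord = c :: l ++ [d l] := by
      intro l hl
      rw [FreeGroup.toWord_mk, (hred l hl).reduce_eq]
    refine Set.ncard_le_ncard_of_injOn (fun l => FreeGroup.mk (c :: l ++ [d l])) ?_ ?_
      (finite_wl _ _)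
    · intro l hl
      rw [Finset.mem_coe, mem_EF] at hl
      refine ⟨?_, ?_⟩
      · change FreeGroup.reduce _ = _
        rw [hw l hl.2.1, ← FreeGroup.isReduced_iff_reduce_eq]
        have hcyc : FreeGroup.IsCyclicallyReduced (c :: l ++ [d l]) :=
          FreeGroup.isCyclicallyReduced_cons_append_iff.mpr ⟨hred l hl.2.1, hd2 l⟩
        simpa using (hcyc.flatten_replicate 2).isReduced
      · change wordLength _ ≤ _
        rw [wordLength, hw l hl.2.1]
        simp [hl.1]
    · intro l hl l' hl' heq
      rw [Finset.mem_coe, mem_EF] at hl hl'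
      have := congrArg FreeGroup.toWord heq
      simp only at this
      rw [hw l hl.2.1, hw l' hl'.2.1] at this
      exact (List.cons.inj (List.append_inj_left' this rfl)).2

theorem negl_of {k : ℕ} (hk : 2 ≤ k) (w : FG k) (B S : Set (FG k)) (hBS : B ⊆ S)
    (hB : B ⊆ autOrbit w) (hS : Cset k ⊆ S) : ExpNegligibleIn B S := by
  refine ⟨Set.diff_subset, ?_⟩
  obtain ⟨K, hK, σ, hσ0, hσ1, hσ2, hb⟩ := gamma_bound hk w
  have hkR : (2 : ℝ) ≤ k := by exact_mod_cast hk
  have hq0 : (0 : ℝ) < 2 * k - 1 := by linarith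
  refine ⟨2 * K * (2 * k - 1) ^ 2, by positivity, σ, hσ0, hσ1, fun n => ?_⟩
  have hsum : rhoC (S \ B) n + rhoC B n = rhoC S n := by
    have e : {g ∈ S | wordLength g ≤ n} \ {g ∈ B | wordLength g ≤ n} =
        {g ∈ S \ B | wordLength g ≤ n} := by
      ext g
      simp only [Set.mem_diff, Set.mem_setOf_eq]
      tauto
    rw [rhoC, ← e, rhoC, rhoC]
    exact Set.ncard_diff_add_ncard_of_subset (fun g hg => ⟨hBS hg.1, hg.2⟩) (finite_wl S n)
  have hlow : (2 * k - 1 : ℝ) ^ n ≤ rhoC S n * (2 * k - 1) ^ 2 := by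
    have h1 := (rho_Cset_lower hk n).trans (Nat.mul_le_mul_right _ (rho_mono hS n))
    have h2 := (Nat.cast_le (α := ℝ)).mpr h1
    have hqn : ((2 * k - 1 : ℕ) : ℝ) = 2 * k - 1 := by
      rw [Nat.cast_sub (by omega)]; push_cast; rfl
    push_cast [hqn] at h2
    exact h2
  have hSpos : (0 : ℝ) < rhoC S n := by
    by_contra hcon
    have h0 : (rhoC S n : ℝ) = 0 := le_antisymm (not_lt.mp hcon) (Nat.cast_nonneg _)
    rw [h0, zero_mul] at hlow
    exact absurd hlow (not_le.mpr (by positivity))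
  have hup : (rhoC B n : ℝ) ≤ 2 * K * ((2 * k - 1) * σ) ^ n :=
    le_trans (by exact_mod_cast rho_mono hB n) (rho_bound _ K _ hK hσ2 hb n)
  have heq : 1 - (rhoC (S \ B) n : ℝ) / rhoC S n = rhoC B n / rhoC S n := by
    rw [eq_div_iff hSpos.ne', sub_mul, div_mul_cancel₀ _ hSpos.ne', ← hsum]
    push_cast
    ring
  rw [heq, abs_of_nonneg (by positivity), div_le_iff₀ hSpos]
  calc (rhoC B n : ℝ) ≤ 2 * K * ((2 * k - 1) * σ) ^ n := hup
    _ = 2 * K * σ ^ n * (2 * k - 1) ^ n := by rw [mul_pow]; ring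
    _ ≤ 2 * K * σ ^ n * (rhoC S n * (2 * k - 1) ^ 2) :=
        mul_le_mul_of_nonneg_left hlow (by positivity)
    _ = _ := by ring

end Assemble

/-- for every `w`, the orbit `Aut(F_k) w` is exponentially negligible in
`F_k` and `C ∩ Aut(F_k) w` is exponentially negligible in `C`. -/
theorem autOrbit_negligible (k : ℕ) (hk : 2 ≤ k) (w : FG k) :
    ExpNegligibleIn (autOrbit w) (Set.univ : Set (FG k)) ∧
    ExpNegligibleIn (Cset k ∩ autOrbit w) (Cset k) := by
  exact ⟨negl_of hk w _ _ (Set.subset_univ _) subset_rfl (Set.subset_univ _),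
    negl_of hk w _ _ Set.inter_subset_left Set.inter_subset_right subset_rfl⟩
end

section
/- For every w ∈ F_k, the growth entropy of the automorphic orbit satisfies H(Aut(F_k)w) ≤ H(F_k − SM') < 2k − 1, where 2k − 1 = H(F_k). In particular there is a single constant α < 2k − 1, independent of w, such that H(Aut(F_k)w) ≤ α for all w ∈ F_k. -/
namespace EB
variable {k : ℕ}

def lt (x : Letter k) : FG k := FreeGroup.mk [x]

def hd (g : FG k) : Option (Letter k) := g.toWord.head?

/-- elements whose first letter lies in `A` -/
def V (A : Set (Letter k)) : Set (FG k) := {g | ∃ x ∈ A, hd g = some x}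

theorem linv_linv (x : Letter k) : linv (linv x) = x := by simp [linv]

theorem linv_ne (x : Letter k) : linv x ≠ x := by
  intro h
  have := congrArg Prod.snd h
  simp [linv] at this

theorem lt_inv (x : Letter k) : (lt x)⁻¹ = lt (linv x) := by
  simp [lt, linv, FreeGroup.inv_mk, FreeGroup.invRev]

theorem lt_linv (x : Letter k) : lt (linv x) = (lt x)⁻¹ := (lt_inv x).symm

theorem toWord_lt (x : Letter k) : (lt x).toWord = [x] := by
  simp [lt, FreeGroup.toWord_mk, FreeGroup.reduce_singleton]

theorem lt_inj {x y : Letter k} (h : lt x = lt y) : x = y := by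
  have := congrArg FreeGroup.toWord h
  simpa [toWord_lt] using this

theorem lt_ne_one (x : Letter k) : lt x ≠ 1 := by
  intro h
  have := congrArg FreeGroup.toWord h
  simp [toWord_lt] at this

theorem hd_one : hd (1 : FG k) = none := by simp [hd]
theorem hd_lt (x : Letter k) : hd (lt x) = some x := by simp [hd, toWord_lt]

theorem hd_none {g : FG k} (h : hd g = none) : g = 1 := by
  simpa [hd] using h

theorem cancel_iff (x y : Letter k) : (x.1 = y.1 → x.2 = y.2) ↔ y ≠ linv x := by
  obtain ⟨a, b⟩ := x
  obtain ⟨c, d⟩ := y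
  simp only [linv, ne_eq, Prod.mk.injEq, not_and]
  constructor
  · rintro h rfl h2
    have := h rfl
    cases b <;> cases d <;> simp at this h2
  · rintro h rfl
    have := h rfl
    cases b <;> cases d <;> simp at this ⊢

theorem red_cons (x : Letter k) (g : FG k) (h : hd g ≠ some (linv x)) :
    (lt x * g).toWord = x :: g.toWord := by
  have : FreeGroup.IsReduced (x :: g.toWord) := by
    have hr := FreeGroup.isReduced_toWord (x := g)
    unfold hd at h
    cases hl : g.toWord with
    | nil => simp
    | cons y l =>
      rw [hl] at h hr
      rw [FreeGroup.isReduced_cons_cons]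
      refine ⟨?_, hr⟩
      rw [cancel_iff]
      simpa using h
  have h2 : lt x * g = FreeGroup.mk (x :: g.toWord) := by
    conv_lhs => rw [← FreeGroup.mk_toWord (x := g)]
    simp [lt, FreeGroup.mul_mk]
  rw [h2, FreeGroup.toWord_mk, this.reduce_eq]

theorem hd_cons (x : Letter k) (g : FG k) (h : hd g ≠ some (linv x)) :
    hd (lt x * g) = some x := by
  simp [hd, red_cons x g h]

theorem mk_cons (x : Letter k) (l : List (Letter k)) :
    (FreeGroup.mk (x :: l) : FG k) = lt x * FreeGroup.mk l := by
  simp [lt, FreeGroup.mul_mk]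

/-- induction on reduced words -/
theorem red_ind {P : FG k → Prop} (h1 : P 1)
    (hc : ∀ (x : Letter k) (g : FG k), hd g ≠ some (linv x) → P g → P (lt x * g)) (g : FG k) :
    P g := by
  have key : ∀ l : List (Letter k), FreeGroup.IsReduced l → P (FreeGroup.mk l) := by
    intro l
    induction l with
    | nil => intro _; exact h1
    | cons x l ih =>
      intro h
      have hl : FreeGroup.IsReduced l := h.infix ⟨[x], [], by simp⟩
      rw [mk_cons]
      apply hc _ _ _ (ih hl)
      unfold hd
      rw [FreeGroup.toWord_mk, hl.reduce_eq]
      cases l with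
      | nil => simp
      | cons y l =>
        rw [FreeGroup.isReduced_cons_cons, cancel_iff] at h
        simpa using h.1
  have := key g.toWord FreeGroup.isReduced_toWord
  rwa [FreeGroup.mk_toWord] at this

theorem hd_mul_lt (g : FG k) (y : Letter k) (h1 : g ≠ 1) (h2 : g ≠ lt (linv y)) :
    hd (g * lt y) = hd g := by
  induction g using red_ind with
  | h1 => exact absurd rfl h1
  | hc x g hx ih =>
    rw [hd_cons x g hx]
    by_cases hg : g = 1
    · subst hg
      rw [mul_one] at *
      apply hd_cons
      rw [hd_lt]
      intro h
      simp only [Option.some.injEq] at h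
      apply h2
      rw [h, linv_linv]
    · by_cases hg2 : g = lt (linv y)
      · subst hg2
        rw [mul_assoc, lt_linv, inv_mul_cancel, mul_one, hd_lt]
      · rw [mul_assoc]
        apply hd_cons
        rw [ih hg hg2]
        exact hx

open Classical in
theorem mem_V_mul (A : Set (Letter k)) (g : FG k) (y : Letter k) :
    (g * lt y ∈ V A) ↔ (if g = 1 then y ∈ A else if g = lt (linv y) then False else g ∈ V A) := by
  split_ifs with h1 h2
  · subst h1
    rw [one_mul]
    simp only [V, hd_lt, Set.mem_ofPred_eq, Option.some.injEq]
    exact ⟨by rintro ⟨x, h, rfl⟩; exact h, fun h => ⟨_, h, rfl⟩⟩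
  · subst h2
    simp [V, lt_linv, hd_one]
  · simp [V, hd_mul_lt g y h1 h2]

theorem one_notMem_V (A : Set (Letter k)) : (1 : FG k) ∉ V A := by simp [V, hd_one]

theorem lt_mem_V (A : Set (Letter k)) (x : Letter k) : lt x ∈ V A ↔ x ∈ A := by
  simp only [V, hd_lt, Set.mem_ofPred_eq, Option.some.injEq]
  exact ⟨by rintro ⟨x, h, rfl⟩; exact h, fun h => ⟨_, h, rfl⟩⟩

theorem mem_V_of_hd {A : Set (Letter k)} {g : FG k} {x : Letter k} (h : hd g = some x) :
    g ∈ V A ↔ x ∈ A := by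
  simp only [V, h, Set.mem_ofPred_eq, Option.some.injEq]
  exact ⟨by rintro ⟨x, h, rfl⟩; exact h, fun h => ⟨_, h, rfl⟩⟩

/-- the `h`-coboundary of `S` -/
def D (S : Set (FG k)) (h : FG k) : Set (FG k) := {g | ¬(g ∈ S ↔ g * h ∈ S)}

noncomputable def d (S : Set (FG k)) (h : FG k) : ℕ := (D S h).ncard

def AI (S : Set (FG k)) : Prop := ∀ h, (D S h).Finite

theorem ncard_pre_mul_right (S : Set (FG k)) (v : FG k) :
    ((fun g => g * v) ⁻¹' S).ncard = S.ncard :=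
  Set.ncard_preimage_of_injective_subset_range (mul_left_injective v)
    (fun x _ => ⟨x * v⁻¹, by simp⟩)

theorem ncard_pre_mul_left (S : Set (FG k)) (v : FG k) :
    ((fun g => v * g) ⁻¹' S).ncard = S.ncard :=
  Set.ncard_preimage_of_injective_subset_range (mul_right_injective v)
    (fun x _ => ⟨v⁻¹ * x, by simp⟩)

theorem finite_pre_mul_right {S : Set (FG k)} (hS : S.Finite) (v : FG k) :
    ((fun g => g * v) ⁻¹' S).Finite := hS.preimage (mul_left_injective v).injOn

theorem finite_pre_mul_left {S : Set (FG k)} (hS : S.Finite) (v : FG k) :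
    ((fun g => v * g) ⁻¹' S).Finite := hS.preimage (mul_right_injective v).injOn

theorem D_mul_sub (S : Set (FG k)) (a b : FG k) :
    D S (a * b) ⊆ D S a ∪ (fun g => g * a) ⁻¹' (D S b) := by
  intro g hg
  simp only [D, Set.mem_ofPred_eq, Set.mem_union, Set.mem_preimage, ← mul_assoc] at *
  tauto

theorem AI_of_letters {S : Set (FG k)} (h : ∀ x, (D S (lt x)).Finite) : AI S := by
  intro g
  induction g using red_ind with
  | h1 => simp [D]
  | hc x g _ ih =>
    exact ((h x).union (finite_pre_mul_right ih _)).subset (D_mul_sub _ _ _)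

theorem AI_V (A : Set (Letter k)) : AI (V A) := by
  classical
  apply AI_of_letters
  intro y
  apply (Set.toFinite {1, lt (linv y)}).subset
  intro g hg
  simp only [D, Set.mem_ofPred_eq, mem_V_mul] at hg
  by_contra hc
  simp only [Set.mem_insert_iff, Set.mem_singleton_iff, not_or] at hc
  simp [hc.1, hc.2] at hg

theorem D_compl (S : Set (FG k)) (h : FG k) : D Sᶜ h = D S h := by
  ext g; simp only [D, Set.mem_ofPred_eq, Set.mem_compl_iff]; tauto

theorem d_compl (S : Set (FG k)) (h : FG k) : d Sᶜ h = d S h := by simp [d, D_compl]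

theorem AI.compl {S : Set (FG k)} (h : AI S) : AI Sᶜ := fun g => by rw [D_compl]; exact h g

theorem D_trans (S : Set (FG k)) (v h : FG k) :
    D ((fun g => v * g) ⁻¹' S) h = (fun g => v * g) ⁻¹' (D S h) := by
  ext g; simp [D, mul_assoc]

theorem d_trans (S : Set (FG k)) (v h : FG k) : d ((fun g => v * g) ⁻¹' S) h = d S h := by
  simp only [d, D_trans, ncard_pre_mul_left]

theorem AI.trans {S : Set (FG k)} (h : AI S) (v : FG k) : AI ((fun g => v * g) ⁻¹' S) := fun g => by
  rw [D_trans]; exact finite_pre_mul_left (h g) v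

theorem D_map (S : Set (FG k)) (τ : MulAut (FG k)) (h : FG k) :
    D (τ ⁻¹' S) h = τ ⁻¹' (D S (τ h)) := by
  ext g; simp [D]

theorem d_map (S : Set (FG k)) (τ : MulAut (FG k)) (h : FG k) : d (τ ⁻¹' S) h = d S (τ h) := by
  simp only [d, D_map]
  exact Set.ncard_preimage_of_injective_subset_range τ.injective
    (fun x _ => ⟨τ.symm x, by simp⟩)

theorem AI.map {S : Set (FG k)} (h : AI S) (τ : MulAut (FG k)) : AI (τ ⁻¹' S) := fun g => by
  rw [D_map]; exact (h _).preimage τ.injective.injOn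

theorem AI.union {S T : Set (FG k)} (hS : AI S) (hT : AI T) : AI (S ∪ T) := fun h =>
  ((hS h).union (hT h)).subset (by intro g; simp only [D, Set.mem_ofPred_eq, Set.mem_union]; tauto)

theorem AI.inter {S T : Set (FG k)} (hS : AI S) (hT : AI T) : AI (S ∩ T) := fun h =>
  ((hS h).union (hT h)).subset
    (by intro g; simp only [D, Set.mem_ofPred_eq, Set.mem_union, Set.mem_inter_iff]; tauto)

theorem submod {S T : Set (FG k)} (hS : AI S) (hT : AI T) (h : FG k) :
    d (S ∪ T) h + d (S ∩ T) h ≤ d S h + d T h := by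
  have e1 := Set.ncard_union_add_ncard_inter (D (S ∪ T) h) (D (S ∩ T) h)
    (hS.union hT h) (hS.inter hT h)
  have e2 := Set.ncard_union_add_ncard_inter (D S h) (D T h) (hS h) (hT h)
  have i1 : D (S ∪ T) h ∪ D (S ∩ T) h ⊆ D S h ∪ D T h := by
    intro g; simp only [D, Set.mem_ofPred_eq, Set.mem_union, Set.mem_inter_iff]; tauto
  have i2 : D (S ∪ T) h ∩ D (S ∩ T) h ⊆ D S h ∩ D T h := by
    intro g; simp only [D, Set.mem_ofPred_eq, Set.mem_union, Set.mem_inter_iff]; tauto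
  have j1 := Set.ncard_le_ncard i1 ((hS h).union (hT h))
  have j2 := Set.ncard_le_ncard i2 ((hS h).inter_of_left _)
  unfold d
  omega

theorem d_finite_change {S T X : Set (FG k)} (hT : AI T) (hX : X.Finite)
    (hST : ∀ g ∉ X, (g ∈ S ↔ g ∈ T)) (h : FG k) : d S h ≤ d T h + 2 * X.ncard := by
  have i : D S h ⊆ D T h ∪ (X ∪ (fun g => g * h) ⁻¹' X) := by
    intro g hg
    by_contra hc
    simp only [D, Set.mem_ofPred_eq, Set.mem_union, Set.mem_preimage, not_or] at *
    rw [hST g hc.2.1, hST _ hc.2.2] at hg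
    exact hc.1 hg
  have hXh := finite_pre_mul_right hX h
  have j := Set.ncard_le_ncard i ((hT h).union (hX.union hXh))
  have j2 := Set.ncard_union_le (D T h) (X ∪ (fun g => g * h) ⁻¹' X)
  have j3 := Set.ncard_union_le X ((fun g => g * h) ⁻¹' X)
  rw [ncard_pre_mul_right] at j3
  unfold d
  omega

theorem AI_finite_change {S T X : Set (FG k)} (hT : AI T) (hX : X.Finite)
    (hST : ∀ g ∉ X, (g ∈ S ↔ g ∈ T)) : AI S := fun h => by
  have i : D S h ⊆ D T h ∪ (X ∪ (fun g => g * h) ⁻¹' X) := by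
    intro g hg
    by_contra hc
    simp only [D, Set.mem_ofPred_eq, Set.mem_union, Set.mem_preimage, not_or] at *
    rw [hST g hc.2.1, hST _ hc.2.2] at hg
    exact hc.1 hg
  exact ((hT h).union (hX.union (finite_pre_mul_right hX h))).subset i

theorem d_cons (S : Set (FG k)) (y : Letter k) (h : FG k) :
    d S (lt y * h) = {g | ¬(g * lt (linv y) ∈ S ↔ g * h ∈ S)}.ncard := by
  unfold d
  rw [← ncard_pre_mul_right {g | ¬(g * lt (linv y) ∈ S ↔ g * h ∈ S)} (lt y)]
  congr 1
  ext g
  simp [D, lt_linv, mul_assoc]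

theorem mem_V_lt_mul {A : Set (Letter k)} {y : Letter k} {h : FG k}
    (hh : hd h ≠ some (linv y)) : lt y * h ∈ V A ↔ y ∈ A := mem_V_of_hd (hd_cons y h hh)

theorem eq_or_of_fst {x y : Letter k} (h : y.1 = x.1) : y = x ∨ y = linv x := by
  obtain ⟨a, b⟩ := x
  obtain ⟨c, e⟩ := y
  simp only at h
  subst h
  cases b <;> cases e <;> simp [linv]

theorem d_letter (x : Letter k) (h : FG k) :
    d (V {x}) h = h.toWord.countP (fun y => decide (y.1 = x.1)) := by
  classical
  induction h using red_ind with
  | h1 => simp [d, D]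
  | hc y h hh ih =>
    rw [red_cons y h hh, List.countP_cons, ← ih, d_cons]
    by_cases hy : y.1 = x.1
    · rw [if_pos (by simpa using hy)]
      rcases eq_or_of_fst hy with rfl | rfl
      · have : {g | ¬(g * lt (linv y) ∈ V {y} ↔ g * h ∈ V {y})} = insert (lt y) (D (V {y}) h) := by
          ext g
          simp only [mem_V_mul, linv_linv, Set.mem_ofPred_eq, Set.mem_insert_iff, D]
          split_ifs with h1 h2
          · subst h1
            simp [one_notMem_V, linv_ne, (lt_ne_one y).symm]
          · subst h2
            simp [mem_V_lt_mul hh]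
          · simp [h2]
        rw [this, Set.ncard_insert_of_notMem _ (AI_V _ _)]
        · rfl
        · simp [D, mem_V_lt_mul hh, lt_mem_V]
      · have hh' : hd h ≠ some x := by rwa [linv_linv] at hh
        have hV : h ∉ V {x} := by simpa [V] using hh'
        have : {g | ¬(g * lt (linv (linv x)) ∈ V {x} ↔ g * h ∈ V {x})} = insert 1 (D (V {x}) h) := by
          ext g
          rw [linv_linv]
          simp only [mem_V_mul, Set.mem_ofPred_eq, Set.mem_insert_iff, D]
          split_ifs with h1 h2
          · subst h1
            simp [hV]
          · subst h2
            simp [h1, lt_mem_V, linv_ne]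
          · simp [h1]
        rw [this, Set.ncard_insert_of_notMem _ (AI_V _ _)]
        · rfl
        · simp [D, hV, one_notMem_V]
    · rw [if_neg (by simpa using hy)]
      have : {g | ¬(g * lt (linv y) ∈ V {x} ↔ g * h ∈ V {x})} = D (V {x}) h := by
        have h1 : y ≠ x := by rintro rfl; exact hy rfl
        have h2 : linv y ≠ x := by rintro rfl; exact hy rfl
        ext g
        simp only [mem_V_mul, linv_linv, Set.mem_ofPred_eq, D]
        split_ifs with h3 h4
        · subst h3
          simp [one_notMem_V, h2]
        · subst h4
          simp [lt_mem_V, h1]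
        · rfl
      rw [this]
      rfl

theorem sum_countP (l : List (Letter k)) :
    ∑ i : Fin k, l.countP (fun y => decide (y.1 = i)) = l.length := by
  induction l with
  | nil => simp
  | cons x l ih => simp [List.countP_cons, Finset.sum_add_distrib, ih]

theorem sum_d (h : FG k) : ∑ i : Fin k, d (V {((i, true) : Letter k)}) h = wordLength h := by
  simp only [d_letter]
  exact sum_countP _

open Classical in
noncomputable def turns (A : Set (Letter k)) : List (Letter k) → ℕ
  | [] => 0
  | [_] => 0
  | (y :: z :: l) => (if (linv y ∈ A ↔ z ∈ A) then 0 else 1) + turns A (z :: l)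

theorem turns_le (A : Set (Letter k)) (h : FG k) :
    turns A h.toWord ≤ (D (V A) h \ {1}).ncard := by
  classical
  induction h using red_ind with
  | h1 => simp [turns]
  | hc y h hh ih =>
    rw [red_cons y h hh]
    have e1 : (D (V A) (lt y * h) \ {1}).ncard =
        {g | ¬(g * lt (linv y) ∈ V A ↔ g * h ∈ V A) ∧ g ≠ lt y}.ncard := by
      rw [← ncard_pre_mul_right {g | ¬(g * lt (linv y) ∈ V A ↔ g * h ∈ V A) ∧ g ≠ lt y} (lt y)]
      congr 1
      ext g
      simp [D, lt_linv, mul_assoc]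
    have hfin : {g | ¬(g * lt (linv y) ∈ V A ↔ g * h ∈ V A) ∧ g ≠ lt y}.Finite := by
      apply ((AI_V A (lt (linv y))).union (AI_V A h)).subset
      intro g
      simp only [D, Set.mem_ofPred_eq, Set.mem_union]
      tauto
    rw [e1]
    have hsub : D (V A) h \ {1} ⊆ {g | ¬(g * lt (linv y) ∈ V A ↔ g * h ∈ V A) ∧ g ≠ lt y} := by
      rintro g ⟨hg, hg1⟩
      rw [Set.mem_singleton_iff] at hg1
      have hgy : g ≠ lt y := by
        rintro rfl
        simp [D, mem_V_lt_mul hh, lt_mem_V] at hg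
      refine ⟨?_, hgy⟩
      rw [mem_V_mul, if_neg hg1, linv_linv, if_neg hgy]
      exact hg
    cases hl : h.toWord with
    | nil => simp [turns]
    | cons z l =>
      rw [hl] at ih
      have hz : hd h = some z := by simp [hd, hl]
      unfold turns
      split_ifs with hs
      · rw [zero_add]
        exact ih.trans (Set.ncard_le_ncard hsub hfin)
      · have hins : insert 1 (D (V A) h \ {1}) ⊆
            {g | ¬(g * lt (linv y) ∈ V A ↔ g * h ∈ V A) ∧ g ≠ lt y} := by
          apply Set.insert_subset _ hsub
          simp only [Set.mem_ofPred_eq, one_mul, lt_mem_V, mem_V_of_hd hz]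
          exact ⟨hs, (lt_ne_one y).symm⟩
        have := Set.ncard_le_ncard hins hfin
        rw [Set.ncard_insert_of_notMem (by simp) ((AI_V A h).sdiff)] at this
        omega

theorem turns_le_d (A : Set (Letter k)) (h : FG k) : turns A h.toWord ≤ d (V A) h :=
  (turns_le A h).trans (Set.ncard_le_ncard Set.sdiff_subset (AI_V A h))

end EB

namespace EB
variable {k : ℕ}

theorem V1_other {x y : Letter k} (hxy : y.1 ≠ x.1) (p : FG k) :
    p * lt y ∈ V {x} ↔ p ∈ V {x} := by
  classical
  rw [mem_V_mul]
  have h1 : y ≠ x := by rintro rfl; exact hxy rfl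
  have h2 : linv y ≠ x := by rintro rfl; exact hxy rfl
  split_ifs with h3 h4
  · subst h3; simp [one_notMem_V, h1]
  · subst h4; simp [lt_mem_V, h2]
  · rfl

theorem V1_self (x : Letter k) (p : FG k) : p * lt x ∈ V {x} ↔ p = 1 ∨ p ∈ V {x} := by
  classical
  rw [mem_V_mul]
  split_ifs with h3 h4
  · simp [h3]
  · subst h4; simp [lt_mem_V, linv_ne, lt_ne_one]
  · simp [h3]

theorem V1_inv (x : Letter k) (p : FG k) :
    p * (lt x)⁻¹ ∈ V {x} ↔ p ≠ lt x ∧ p ∈ V {x} := by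
  classical
  rw [lt_inv, mem_V_mul, linv_linv]
  split_ifs with h3 h4
  · subst h3; simp [one_notMem_V, linv_ne]
  · simp [h4]
  · simp [h4]

theorem V1_other_inv {x y : Letter k} (hxy : y.1 ≠ x.1) (p : FG k) :
    p * (lt y)⁻¹ ∈ V {x} ↔ p ∈ V {x} := by
  rw [lt_inv]
  exact V1_other (by simpa [linv] using hxy) p

theorem ext_right {S T : Set (FG k)} (h1 : 1 ∈ S ↔ 1 ∈ T)
    (h : ∀ g y, (g ∈ S ↔ g ∈ T) → (g * lt y ∈ S ↔ g * lt y ∈ T)) : S = T := by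
  have key : ∀ g : FG k, g⁻¹ ∈ S ↔ g⁻¹ ∈ T := by
    intro g
    induction g using red_ind with
    | h1 => simpa using h1
    | hc x g _ ih =>
      rw [mul_inv_rev, lt_inv]
      exact h _ _ ih
  ext g
  simpa using key g⁻¹

open Classical in
noncomputable def pw (P : Prop) (c : FG k) : FG k := if P then c else 1

open Classical in
theorem V1_pw {x y : Letter k} (hxy : y.1 ≠ x.1) (P : Prop) (p : FG k) :
    p * pw P (lt y) ∈ V {x} ↔ p ∈ V {x} := by
  unfold pw; split_ifs
  · exact V1_other hxy p
  · simp

open Classical in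
theorem V1_pw_inv {x y : Letter k} (hxy : y.1 ≠ x.1) (P : Prop) (p : FG k) :
    p * (pw P (lt y))⁻¹ ∈ V {x} ↔ p ∈ V {x} := by
  unfold pw; split_ifs
  · exact V1_other_inv hxy p
  · simp

/-- `τ` is the Whitehead automorphism with multiplier `a` and cut `A` -/
structure WA (τ : MulAut (FG k)) (a : Letter k) (A : Set (Letter k)) : Prop where
  h1 : linv a ∈ A
  h2 : a ∉ A
  h3 : τ (lt a) = lt a
  h4 : ∀ x : Letter k, x.1 ≠ a.1 →
    τ (lt x) = (pw (x ∈ A) (lt a))⁻¹ * lt x * pw (linv x ∈ A) (lt a)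

theorem WA.pre_a {τ : MulAut (FG k)} {a : Letter k} {A : Set (Letter k)} (w : WA τ a A) :
    τ ⁻¹' (V {linv a}) = V A := by
  classical
  apply ext_right
  · simp [one_notMem_V]
  intro g y ih
  simp only [Set.mem_preimage, map_mul] at ih ⊢
  rw [mem_V_mul A]
  by_cases hy : y.1 = a.1
  · rcases eq_or_of_fst hy with rfl | rfl
    · have := V1_inv (linv y) (τ g)
      rw [← lt_linv, linv_linv] at this
      rw [w.h3, this]
      have e : τ g = lt (linv y) ↔ g = lt (linv y) := by
        have h0 : τ (lt (linv y)) = lt (linv y) := by rw [lt_linv, map_inv, w.h3]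
        constructor
        · intro h; exact τ.injective (by rw [h, h0])
        · intro h; rw [h, h0]
      rw [Ne, e, ih]
      split_ifs with h h'
      · subst h; simp [w.h2, one_notMem_V]
      · simp [h']
      · simp [h']
    · rw [lt_linv, map_inv, w.h3, ← lt_linv, V1_self, ih, map_eq_one_iff τ τ.injective]
      split_ifs with h h'
      · subst h; simp [w.h1]
      · rw [linv_linv] at h'
        subst h'
        simp [lt_ne_one, lt_mem_V, w.h2]
      · simp [h]
  · have hy' : y.1 ≠ (linv a).1 := by simpa [linv] using hy
    have hy'' : (linv y).1 ≠ a.1 := by simpa [linv] using hy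
    have hE : ∀ p : FG k, p * lt a ∈ V {linv a} ↔ p ≠ lt (linv a) ∧ p ∈ V {linv a} := by
      intro p
      have := V1_inv (linv a) p
      rwa [← lt_linv, linv_linv] at this
    have hE2 : ∀ p : FG k, p * (lt a)⁻¹ ∈ V {linv a} ↔ p = 1 ∨ p ∈ V {linv a} := by
      intro p
      rw [← lt_linv, V1_self]
    have hA : τ g * (pw (y ∈ A) (lt a))⁻¹ * lt y ∈ V {linv a} ↔ ((y ∈ A ∧ g = 1) ∨ g ∈ V A) := by
      rw [V1_other hy']
      unfold pw
      split_ifs with h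
      · rw [hE2, ih, map_eq_one_iff τ τ.injective]; simp [h]
      · simp [ih, h]
    have hB : τ g * τ (lt y) ∈ V {linv a} ↔
        ((linv y ∈ A → g ≠ lt (linv y)) ∧ ((y ∈ A ∧ g = 1) ∨ g ∈ V A)) := by
      rw [w.h4 y hy, ← hA]
      by_cases h : linv y ∈ A
      · have : τ g * (pw (y ∈ A) (lt a))⁻¹ * lt y = lt (linv a) ↔ g = lt (linv y) := by
          rw [← τ.injective.eq_iff (b := lt (linv y)), w.h4 _ hy'', linv_linv]
          simp only [pw, h, if_true, lt_linv]
          constructor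
          · intro h; rw [← h]; group
          · intro h; rw [h]; group
        rw [show τ g * ((pw (y ∈ A) (lt a))⁻¹ * lt y * pw (linv y ∈ A) (lt a)) =
          (τ g * (pw (y ∈ A) (lt a))⁻¹ * lt y) * pw (linv y ∈ A) (lt a) by group]
        generalize τ g * (pw (y ∈ A) (lt a))⁻¹ * lt y = q at *
        simp only [pw, h, if_true, hE, forall_true_left, Ne, this]
      · simp [h, pw, mul_assoc]
    rw [hB]
    split_ifs with h h'
    · subst h
      simp [one_notMem_V, (lt_ne_one (linv y)).symm]
    · subst h'
      simp [lt_ne_one, lt_mem_V]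
    · simp [h, h']

theorem WA.pre_x {τ : MulAut (FG k)} {a : Letter k} {A : Set (Letter k)} (w : WA τ a A)
    {x : Letter k} (hx : x.1 ≠ a.1) :
    τ ⁻¹' ((fun g => pw (x ∈ A) (lt a) * g) ⁻¹' (V {x})) = V {x} := by
  classical
  apply ext_right
  · simp only [Set.mem_preimage, map_one]
    have := V1_pw (x := x) (y := a) hx.symm (x ∈ A) 1
    rw [mul_one, ← this, one_mul]
  intro g y ih
  simp only [Set.mem_preimage, map_mul] at ih ⊢
  rw [← mul_assoc]
  by_cases hy : y.1 = a.1
  · rw [V1_other (by rw [hy]; exact hx.symm), ← ih]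
    rcases eq_or_of_fst hy with rfl | rfl
    · rw [w.h3, V1_other hx.symm]
    · rw [lt_linv, map_inv, w.h3, V1_other_inv hx.symm]
  · rw [w.h4 y hy, ← mul_assoc, ← mul_assoc, V1_pw hx.symm]
    by_cases hyx : y.1 = x.1
    · rcases eq_or_of_fst hyx with rfl | rfl
      · rw [V1_self, V1_pw_inv hx.symm, ih, V1_self]
        have : pw (y ∈ A) (lt a) * τ g * (pw (y ∈ A) (lt a))⁻¹ = 1 ↔ g = 1 := by
          constructor
          · intro h
            rw [mul_inv_eq_one] at h
            simpa using h
          · intro h; simp [h]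
        rw [this]
      · rw [lt_linv, V1_inv, V1_pw_inv hx.symm, ih, V1_inv]
        have : pw (x ∈ A) (lt a) * τ g * (pw (linv x ∈ A) (lt a))⁻¹ = lt x ↔ g = lt x := by
          constructor
          · intro h; apply τ.injective; rw [w.h4 x hx, ← h]; group
          · intro h; rw [h, w.h4 x hx]; group
        rw [Ne, this]
    · rw [V1_other hyx, V1_pw_inv hx.symm, ih, V1_other hyx]

theorem WA.len {τ : MulAut (FG k)} {a : Letter k} {A : Set (Letter k)} (w : WA τ a A) (h : FG k) :
    wordLength (τ h) + d (V {a}) h = wordLength h + d (V A) h := by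
  classical
  rw [← sum_d (τ h), ← sum_d h]
  rw [← Finset.add_sum_erase _ _ (Finset.mem_univ a.1),
    ← Finset.add_sum_erase _ (fun i => d (V {((i, true) : Letter k)}) h) (Finset.mem_univ a.1)]
  have e1 : d (V {((a.1, true) : Letter k)}) (τ h) = d (V A) h := by
    rw [← w.pre_a, d_map, d_letter, d_letter]; rfl
  have e2 : d (V {((a.1, true) : Letter k)}) h = d (V {a}) h := by
    rw [d_letter, d_letter]
  have e3 : ∀ i ∈ Finset.univ.erase a.1, d (V {((i, true) : Letter k)}) (τ h) =
      d (V {((i, true) : Letter k)}) h := by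
    intro i hi
    conv_rhs => rw [← w.pre_x (x := (i, true)) (by simpa using hi)]
    rw [d_map, d_trans]
  rw [e1, e2, Finset.sum_congr rfl e3]
  ring

theorem of_eq (i : Fin k) : FreeGroup.of i = lt (i, true) := rfl
theorem of_inv_eq (i : Fin k) : (FreeGroup.of i)⁻¹ = lt (i, false) := by
  rw [of_eq, lt_inv]; rfl

theorem mem_letterSet (g : FG k) : g ∈ letterSet k ↔ ∃ x, g = lt x := by
  constructor
  · rintro ⟨i, h | h⟩
    · exact ⟨_, h.trans (of_eq i)⟩
    · exact ⟨_, h.trans (of_inv_eq i)⟩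
  · rintro ⟨⟨i, b⟩, rfl⟩
    cases b
    · exact ⟨i, Or.inr (of_inv_eq i).symm⟩
    · exact ⟨i, Or.inl rfl⟩

theorem aut_ext {τ σ : MulAut (FG k)} (h : ∀ i : Fin k, τ (lt (i, true)) = σ (lt (i, true))) :
    τ = σ := by
  have : τ.toMonoidHom = σ.toMonoidHom := FreeGroup.ext_hom _ _ h
  ext g
  exact DFunLike.congr_fun this g

/-- the underlying endomorphism -/
noncomputable def whHom (a : Letter k) (A : Set (Letter k)) (c : FG k) : FG k →* FG k :=
  FreeGroup.lift (fun i => if i = a.1 then lt (i, true) else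
    (pw ((i, true) ∈ A) c)⁻¹ * lt (i, true) * pw ((i, false) ∈ A) c)

theorem whHom_a (a : Letter k) (A : Set (Letter k)) (c : FG k) : whHom a A c (lt a) = lt a := by
  have h : whHom a A c (lt (a.1, true)) = lt (a.1, true) := by
    rw [whHom, ← of_eq, FreeGroup.lift_apply_of]; simp; rfl
  obtain ⟨i, b⟩ := a
  cases b
  · have e : lt ((i, false) : Letter k) = (lt (i, true))⁻¹ := by rw [lt_inv]; rfl
    rw [e, map_inv, h]
  · exact h

theorem whHom_x (a : Letter k) (A : Set (Letter k)) (c : FG k) (x : Letter k) (hx : x.1 ≠ a.1) :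
    whHom a A c (lt x) = (pw (x ∈ A) c)⁻¹ * lt x * pw (linv x ∈ A) c := by
  have h : whHom a A c (lt (x.1, true)) =
      (pw ((x.1, true) ∈ A) c)⁻¹ * lt (x.1, true) * pw ((x.1, false) ∈ A) c := by
    rw [whHom, ← of_eq, FreeGroup.lift_apply_of]; simp [hx]; rfl
  obtain ⟨i, b⟩ := x
  cases b
  · have e : lt ((i, false) : Letter k) = (lt (i, true))⁻¹ := by rw [lt_inv]; rfl
    rw [e, map_inv, h]
    simp [linv, mul_assoc]
  · exact h

theorem whHom_pw (a : Letter k) (A : Set (Letter k)) (c : FG k) (P : Prop) :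
    whHom a A c (pw P (lt a)) = pw P (lt a) := by
  unfold pw; split_ifs
  · exact whHom_a a A c
  · simp

theorem pw_inv (P : Prop) (c : FG k) : pw P c⁻¹ = (pw P c)⁻¹ := by
  unfold pw; split_ifs <;> simp

theorem whHom_comp (a : Letter k) (A : Set (Letter k)) (c e : FG k)
    (hc : c = lt a ∧ e = (lt a)⁻¹ ∨ c = (lt a)⁻¹ ∧ e = lt a) :
    (whHom a A c).comp (whHom a A e) = MonoidHom.id _ := by
  apply FreeGroup.ext_hom
  intro i
  rw [of_eq]
  by_cases hi : i = a.1
  · rcases eq_or_of_fst (x := a) (y := (i, true)) hi with h | h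
    · rw [h]; simp [whHom_a]
    · rw [h, lt_linv]; simp [whHom_a]
  · simp only [MonoidHom.comp_apply, MonoidHom.id_apply]
    rw [whHom_x a A e _ hi, map_mul, map_mul, whHom_x a A c _ hi]
    rcases hc with ⟨rfl, rfl⟩ | ⟨rfl, rfl⟩
    · simp only [pw_inv, map_inv, whHom_pw]; group
    · simp only [pw_inv, map_inv, whHom_pw]; group

theorem exists_WA (a : Letter k) (A : Set (Letter k)) (h1 : linv a ∈ A) (h2 : a ∉ A) :
    ∃ τ : MulAut (FG k), WA τ a A ∧ IsWhitehead2 τ := by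
  classical
  let τ : MulAut (FG k) := MonoidHom.toMulEquiv (whHom a A (lt a)) (whHom a A (lt a)⁻¹)
    (whHom_comp a A _ _ (Or.inr ⟨rfl, rfl⟩)) (whHom_comp a A _ _ (Or.inl ⟨rfl, rfl⟩))
  have hτ : ∀ g, τ g = whHom a A (lt a) g := fun g => rfl
  have w : WA τ a A := ⟨h1, h2, whHom_a _ _ _, fun x hx => whHom_x _ _ _ _ hx⟩
  refine ⟨τ, w, lt a, (mem_letterSet _).2 ⟨a, rfl⟩, w.h3, ?_⟩
  intro g hg
  obtain ⟨x, rfl⟩ := (mem_letterSet _).1 hg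
  by_cases hx : x.1 = a.1
  · left
    rcases eq_or_of_fst hx with rfl | rfl
    · exact w.h3
    · rw [lt_linv, map_inv, w.h3]
  · rw [w.h4 x hx]
    unfold pw
    split_ifs <;> simp

theorem hd_lt_mul_other {x y : Letter k} (h : y.1 ≠ x.1) : hd (lt x * lt y) = some x := by
  apply hd_cons
  rw [hd_lt]
  simp only [ne_eq, Option.some.injEq]
  rintro rfl
  exact h rfl

theorem hd_inv_mul_other {x y : Letter k} (g : FG k) (hy : hd g = some y) (h : y.1 ≠ x.1) :
    hd ((lt x)⁻¹ * g) = some (linv x) := by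
  rw [lt_inv]
  apply hd_cons
  rw [hy]
  simp only [ne_eq, Option.some.injEq, linv_linv]
  rintro rfl
  exact h rfl

theorem exists_cut {τ : MulAut (FG k)} (hτ : IsWhitehead2 τ) (hi : ¬ IsInner τ) :
    ∃ a A, WA τ a A ∧ (∃ x ∈ A, x ≠ linv a) ∧ (∃ x, x ∉ A ∧ x ≠ a) := by
  classical
  obtain ⟨g, hg, h3, h4⟩ := hτ
  obtain ⟨a, rfl⟩ := (mem_letterSet _).1 hg
  let A : Set (Letter k) := {x | x = linv a ∨ (x.1 ≠ a.1 ∧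
    (τ (lt x) = (lt a)⁻¹ * lt x ∨ τ (lt x) = (lt a)⁻¹ * lt x * lt a))}
  have hA : ∀ x : Letter k, x.1 ≠ a.1 → (x ∈ A ↔
      (τ (lt x) = (lt a)⁻¹ * lt x ∨ τ (lt x) = (lt a)⁻¹ * lt x * lt a)) := by
    intro x hx
    simp only [A, Set.mem_ofPred_eq]
    constructor
    · rintro (rfl | h)
      · exact absurd rfl hx
      · exact h.2
    · intro h; exact Or.inr ⟨hx, h⟩
  have hA' : ∀ x : Letter k, x.1 ≠ a.1 → (linv x ∈ A ↔
      (τ (lt x) = lt x * lt a ∨ τ (lt x) = (lt a)⁻¹ * lt x * lt a)) := by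
    intro x hx
    rw [hA (linv x) hx, lt_linv, map_inv]
    rw [inv_eq_iff_eq_inv, inv_eq_iff_eq_inv]
    simp [mul_assoc]
  have w : WA τ a A := by
    refine ⟨Or.inl rfl, ?_, h3, ?_⟩
    · rintro (h | h)
      · exact linv_ne a h.symm
      · exact h.1 rfl
    · intro x hx
      have n1 : lt a ≠ (1 : FG k) := lt_ne_one a
      have n2 : lt x ≠ (lt a)⁻¹ * lt x := by simpa using n1
      have hdx : hd (lt x * lt a) = some x := hd_lt_mul_other (Ne.symm hx)
      have hla : linv a ≠ x := by rintro rfl; exact hx rfl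
      have hd1 : hd ((lt a)⁻¹ * lt x) = some (linv a) := hd_inv_mul_other _ (hd_lt x) hx
      have hd2 : hd ((lt a)⁻¹ * lt x * lt a) = some (linv a) := by
        rw [mul_assoc]; exact hd_inv_mul_other _ hdx hx
      have n3 : lt x ≠ (lt a)⁻¹ * lt x * lt a := by
        intro h; have := congrArg hd h
        rw [hd2, hd_lt] at this; exact hla (by simpa using this.symm)
      have n4 : lt x * lt a ≠ (lt a)⁻¹ * lt x := by
        intro h; have := congrArg hd h
        rw [hd1, hdx] at this; exact hla (by simpa using this.symm)
      have n5 : lt x * lt a ≠ (lt a)⁻¹ * lt x * lt a := by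
        intro h; have := congrArg hd h
        rw [hd2, hdx] at this; exact hla (by simpa using this.symm)
      have n6 : (lt a)⁻¹ * lt x ≠ (lt a)⁻¹ * lt x * lt a := by
        simpa using n1
      have n7 : lt x ≠ lt x * lt a := by simpa using n1
      unfold pw
      rw [hA x hx, hA' x hx]
      rcases h4 (lt x) ((mem_letterSet _).2 ⟨x, rfl⟩) with h | h | h | h <;> rw [h]
      · simp only [n2, n3, n7, or_self, if_false]; simp
      · simp only [n4, n5, true_or, or_self, if_false, if_true]; simp
      · simp only [n4.symm, n6, true_or, or_self, if_false, if_true]; simp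
      · simp only [or_true, if_true]
  refine ⟨a, A, w, ?_, ?_⟩
  · by_contra hc
    push Not at hc
    apply hi
    refine ⟨1, aut_ext ?_⟩
    intro i
    have hn : ∀ x : Letter k, x.1 ≠ a.1 → x ∉ A := by
      intro x hx hxA
      exact hx (by rw [hc x hxA]; rfl)
    by_cases hi' : i = a.1
    · rcases eq_or_of_fst (x := a) (y := (i, true)) hi' with h | h
      · rw [h, h3]; simp
      · rw [h, lt_linv, map_inv, h3]; simp
    · rw [w.h4 _ hi']
      have h1 := hn (i, true) hi'
      have h2 := hn (linv (i, true)) hi'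
      simp [pw, h1, h2]
  · by_contra hc
    push Not at hc
    apply hi
    refine ⟨(lt a)⁻¹, aut_ext ?_⟩
    intro i
    have hn : ∀ x : Letter k, x.1 ≠ a.1 → x ∈ A := by
      intro x hx
      by_contra hxA
      exact hx (by rw [hc x hxA])
    by_cases hi' : i = a.1
    · rcases eq_or_of_fst (x := a) (y := (i, true)) hi' with h | h
      · rw [h, h3]; simp
      · rw [h, lt_linv, map_inv, h3]; simp
    · rw [w.h4 _ hi']
      have h1 := hn (i, true) hi'
      have h2 := hn (linv (i, true)) hi'
      simp [pw, h1, h2]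

end EB

namespace EB
variable {k : ℕ}

theorem wl_one : wordLength (1 : FG k) = 0 := by simp [wordLength]
theorem wl_mul_le (g h : FG k) : wordLength (g * h) ≤ wordLength g + wordLength h :=
  FreeGroup.norm_mul_le g h
theorem wl_inv (g : FG k) : wordLength g⁻¹ = wordLength g := FreeGroup.norm_inv_eq
theorem wl_lt (x : Letter k) : wordLength (lt x) = 1 := by simp [wordLength, toWord_lt]
theorem wl_zero {g : FG k} (h : wordLength g = 0) : g = 1 := by
  apply FreeGroup.toWord_injective
  simpa [wordLength] using h

theorem cr_iff (u : FG k) : IsCyclicallyReduced u ↔ FreeGroup.IsCyclicallyReduced u.toWord := by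
  unfold IsCyclicallyReduced CyclicallyReducedWord
  rw [← FreeGroup.isReduced_iff_reduce_eq, FreeGroup.IsReduced, List.isChain_append,
    FreeGroup.isCyclicallyReduced_iff, FreeGroup.IsReduced]
  tauto

theorem cr_decomp (g : FG k) : ∃ x u : FG k, IsCyclicallyReduced u ∧ g = x * u * x⁻¹ ∧
    wordLength g = 2 * wordLength x + wordLength u := by
  have h := FreeGroup.reduceCyclically.conj_conjugator_reduceCyclically g.toWord
  have hr := FreeGroup.reduceCyclically.isCyclicallyReduced (FreeGroup.isReduced_toWord (x := g))
  set c := FreeGroup.reduceCyclically.conjugator g.toWord with hc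
  set r := FreeGroup.reduceCyclically g.toWord with hr'
  have hcr : FreeGroup.IsReduced c := by
    have := FreeGroup.isReduced_toWord (x := g)
    rw [← h] at this
    rw [FreeGroup.IsReduced, List.append_assoc, List.isChain_append] at this
    exact this.1
  have h1 : (FreeGroup.mk c).toWord = c := by rw [FreeGroup.toWord_mk, hcr.reduce_eq]
  have h2 : (FreeGroup.mk r).toWord = r := by rw [FreeGroup.toWord_mk, hr.isReduced.reduce_eq]
  refine ⟨FreeGroup.mk c, FreeGroup.mk r, ?_, ?_, ?_⟩
  · rw [cr_iff, h2]; exact hr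
  · rw [FreeGroup.inv_mk, FreeGroup.mul_mk, FreeGroup.mul_mk, h, FreeGroup.mk_toWord]
  · unfold wordLength
    rw [h1, h2]
    have := congrArg List.length h
    simp [FreeGroup.invRev_length] at this
    omega

theorem toWord_pow_cr {u : FG k} (h : IsCyclicallyReduced u) (N : ℕ) :
    (u ^ N).toWord = (List.replicate N u.toWord).flatten := by
  rw [FreeGroup.toWord_pow]
  exact (((cr_iff u).1 h).flatten_replicate N).isReduced.reduce_eq

theorem wl_pow_cr {u : FG k} (h : IsCyclicallyReduced u) (N : ℕ) :
    wordLength (u ^ N) = N * wordLength u := by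
  unfold wordLength
  rw [toWord_pow_cr h]
  simp

theorem cl_spec (h : FG k) : ∃ x u : FG k, IsCyclicallyReduced u ∧ h = x * u * x⁻¹ ∧
    wordLength u = cyclicLength h := by
  have : {n | ∃ x u : FG k, IsCyclicallyReduced u ∧ h = x * u * x⁻¹ ∧ wordLength u = n}.Nonempty := by
    obtain ⟨x, u, h1, h2, _⟩ := cr_decomp h
    exact ⟨_, x, u, h1, h2, rfl⟩
  exact Nat.sInf_mem this

theorem wl_conj_pow (x u : FG k) (hu : IsCyclicallyReduced u) (N : ℕ) :
    wordLength ((x * u * x⁻¹) ^ N) ≤ N * wordLength u + 2 * wordLength x ∧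
    N * wordLength u ≤ wordLength ((x * u * x⁻¹) ^ N) + 2 * wordLength x := by
  rw [conj_pow]
  have h0 := wl_pow_cr hu N
  constructor
  · have := wl_mul_le (x * u ^ N) x⁻¹
    have := wl_mul_le x (u ^ N)
    rw [wl_inv] at *
    omega
  · have h1 := wl_mul_le (x⁻¹ * (x * u ^ N * x⁻¹)) x
    have h2 := wl_mul_le x⁻¹ (x * u ^ N * x⁻¹)
    rw [show x⁻¹ * (x * u ^ N * x⁻¹) * x = u ^ N by group] at h1
    rw [wl_inv] at h2
    omega

theorem pow_bd (h : FG k) : ∃ C, ∀ N, wordLength (h ^ N) ≤ N * cyclicLength h + C ∧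
    N * cyclicLength h ≤ wordLength (h ^ N) + C := by
  obtain ⟨x, u, h1, h2, h3⟩ := cl_spec h
  refine ⟨2 * wordLength x, fun N => ?_⟩
  rw [← h3]
  have := wl_conj_pow x u h1 N
  rwa [← h2] at this

theorem arch {a b C : ℕ} (h : ∀ N, N * a ≤ N * b + C) : a ≤ b := by
  by_contra hc
  have h1 : b + 1 ≤ a := by omega
  have h2 := h (C + 1)
  nlinarith

theorem cl_eq {x u h : FG k} (hu : IsCyclicallyReduced u) (hh : h = x * u * x⁻¹) :
    cyclicLength h = wordLength u := by
  obtain ⟨C, hC⟩ := pow_bd h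
  apply le_antisymm
  · apply arch (C := C + 2 * wordLength x)
    intro N
    have h1 := wl_conj_pow x u hu N
    have h2 := hC N
    rw [← hh] at h1
    omega
  · apply arch (C := C + 2 * wordLength x)
    intro N
    have h1 := wl_conj_pow x u hu N
    have h2 := hC N
    rw [← hh] at h1
    omega

theorem cl_conj (x h : FG k) : cyclicLength (x * h * x⁻¹) = cyclicLength h := by
  obtain ⟨y, u, h1, h2, h3⟩ := cl_spec h
  rw [← h3]
  exact cl_eq (x := x * y) h1 (by rw [h2]; group)

theorem cl_le_wl (h : FG k) : cyclicLength h ≤ wordLength h := by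
  obtain ⟨x, u, h1, h2, h3⟩ := cr_decomp h
  rw [cl_eq h1 h2]; omega

end EB

namespace EB
variable {k : ℕ}

theorem cut_bound {w : FG k} (hw : w ∈ SM k) (b : Letter k) (A : Set (Letter k)) (h1 : b ∈ A)
    (h2 : linv b ∉ A) : ∃ C, ∀ N, d (V {b}) (w ^ N) ≤ d (V A) (w ^ N) + C := by
  obtain ⟨τ, wa, w2⟩ := exists_WA (linv b) A (by rwa [linv_linv]) h2
  have hcl : wordLength w ≤ cyclicLength (τ w) := by
    by_cases hi : IsInner τ
    · obtain ⟨g, rfl⟩ := hi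
      rw [MulAut.conj_apply, cl_eq hw.1 rfl]
    · exact (hw.2 τ w2 hi).le
  obtain ⟨C, hC⟩ := pow_bd (τ w)
  refine ⟨C, fun N => ?_⟩
  have e1 := wa.len (w ^ N)
  have e2 : d (V {linv b}) (w ^ N) = d (V {b}) (w ^ N) := by
    rw [d_letter, d_letter]; rfl
  rw [map_pow, wl_pow_cr hw.1, e2] at e1
  have := (hC N).2
  have := Nat.mul_le_mul_left N hcl
  omega

def Cone (p : FG k) (b : Letter k) : Set (FG k) := (fun g => p⁻¹ * g) ⁻¹' V {b}

theorem mem_Cone {p : FG k} {b : Letter k} {g : FG k} : g ∈ Cone p b ↔ hd (p⁻¹ * g) = some b := by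
  simp only [Cone, Set.mem_preimage, V, Set.mem_ofPred_eq, Set.mem_singleton_iff]
  constructor
  · rintro ⟨x, rfl, h⟩; exact h
  · intro h; exact ⟨b, rfl, h⟩

def nc (p : FG k) (b : Letter k) : Prop := hd p⁻¹ ≠ some b

theorem toWord_mul_nc {h : FG k} {b : Letter k} (hb : hd h = some b) (p : FG k) (hp : nc p b) :
    (p * h).toWord = p.toWord ++ h.toWord := by
  unfold nc at hp
  induction p using red_ind with
  | h1 => simp
  | hc x p hx ih =>
    by_cases h1 : p = 1
    · subst h1
      rw [mul_one, toWord_lt, red_cons]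
      · rfl
      · rw [hb]
        rwa [mul_one, lt_inv, hd_lt, Ne, eq_comm] at hp
    · have e : hd (lt x * p)⁻¹ = hd p⁻¹ := by
        rw [mul_inv_rev, lt_inv]
        apply hd_mul_lt
        · simpa using h1
        · rw [linv_linv, Ne, inv_eq_iff_eq_inv, lt_inv]
          rintro rfl
          exact hx (hd_lt _)
      rw [e] at hp
      have ih := ih hp
      rw [mul_assoc, red_cons, red_cons x p hx, ih]
      · rfl
      · unfold hd at hx ⊢
        rw [ih]
        have : p.toWord ≠ [] := by
          intro h; exact h1 (by rw [← FreeGroup.toWord_eq_nil_iff]; exact h)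
        rwa [List.head?_append_of_ne_nil _ this]

theorem mem_Cone_iff {p : FG k} {b : Letter k} (h : nc p b) (g : FG k) :
    g ∈ Cone p b ↔ p.toWord ++ [b] <+: g.toWord := by
  rw [mem_Cone]
  constructor
  · intro hg
    have e := toWord_mul_nc hg p h
    rw [mul_inv_cancel_left] at e
    rw [e]
    unfold hd at hg
    obtain ⟨l, hl⟩ : ∃ l, (p⁻¹ * g).toWord = b :: l := by
      cases hh : (p⁻¹ * g).toWord with
      | nil => rw [hh] at hg; simp at hg
      | cons y l => rw [hh] at hg; simp at hg; subst hg; exact ⟨l, rfl⟩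
    rw [hl]
    exact ⟨l, by simp⟩
  · rintro ⟨l, hl⟩
    have hr := FreeGroup.isReduced_toWord (x := g)
    rw [← hl, List.append_assoc] at hr
    have hr2 : FreeGroup.IsReduced ([b] ++ l) := by
      rw [FreeGroup.IsReduced, List.isChain_append] at hr
      exact hr.2.1
    have : p⁻¹ * g = FreeGroup.mk ([b] ++ l) := by
      rw [inv_mul_eq_iff_eq_mul]
      conv_lhs => rw [← FreeGroup.mk_toWord (x := g), ← hl]
      conv_rhs => rw [← FreeGroup.mk_toWord (x := p)]
      rw [FreeGroup.mul_mk, List.append_assoc]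
    rw [this, hd, FreeGroup.toWord_mk, hr2.reduce_eq]
    rfl

theorem cone_nested {p q g1 g2 : FG k} {b c : Letter k} (hp : nc p b) (hq : nc q c)
    (h1 : g1 ∈ Cone p b) (h2 : g1 ∈ Cone q c) (h3 : g2 ∈ Cone q c) (h4 : g2 ∉ Cone p b) :
    Cone p b ⊆ Cone q c := by
  rw [mem_Cone_iff hp] at h1 h4
  rw [mem_Cone_iff hq] at h2 h3
  intro g hg
  rw [mem_Cone_iff hp] at hg
  rw [mem_Cone_iff hq]
  rcases List.prefix_or_prefix_of_prefix h1 h2 with h | h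
  · exact absurd (h.trans h3) h4
  · exact h.trans hg

theorem toWord_lt_pow (c : Letter k) (m : ℕ) : (lt c ^ m).toWord = List.replicate m c := by
  have : IsCyclicallyReduced (lt c) := by
    rw [cr_iff, toWord_lt, FreeGroup.isCyclicallyReduced_iff]
    simp [FreeGroup.IsReduced]
  rw [toWord_pow_cr this, toWord_lt]
  simp

theorem nc_child {p : FG k} {b y : Letter k} (hp : nc p b) (hy : y ≠ linv b) : nc (p * lt b) y := by
  unfold nc at *
  rw [mul_inv_rev, lt_inv, hd_cons _ _ (by rwa [linv_linv])]
  simpa using hy.symm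

theorem toWord_mul_lt {p : FG k} {b : Letter k} (hp : nc p b) :
    (p * lt b).toWord = p.toWord ++ [b] := by
  rw [toWord_mul_nc (hd_lt b) p hp, toWord_lt]

theorem pow_in_cone {p : FG k} {b c : Letter k} (hp : nc p b) {m : ℕ} (h : lt c ^ m ∈ Cone p b)
    {n : ℕ} (hn : wordLength p + 2 ≤ n) : lt c ^ n ∈ Cone (p * lt b) b := by
  rw [mem_Cone_iff hp, toWord_lt_pow, List.prefix_replicate_iff] at h
  rw [mem_Cone_iff (nc_child hp (linv_ne b).symm), toWord_lt_pow, toWord_mul_lt hp, h.2]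
  have hb : b = c := by
    have : b ∈ List.replicate (p.toWord ++ [b]).length c := by rw [← h.2]; simp
    exact List.eq_of_mem_replicate this
  rw [hb, ← List.replicate_succ', List.prefix_replicate_iff]
  simp [wordLength] at *
  omega

theorem wl_cone {p : FG k} {b : Letter k} (hp : nc p b) {g : FG k} (hg : g ∈ Cone p b) :
    wordLength p < wordLength g := by
  have := ((mem_Cone_iff hp g).1 hg).length_le
  simp [wordLength] at *
  omega

theorem ball_finite (n : ℕ) : {g : FG k | wordLength g ≤ n}.Finite := by
  have := (List.finite_length_le (Letter k) n).preimage
    (f := FreeGroup.toWord) (FreeGroup.toWord_injective.injOn)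
  exact this

def Cst (S : Set (FG k)) (p : FG k) (b : Letter k) : Prop :=
  ∀ g h, g ∈ Cone p b → h ∈ Cone p b → (g ∈ S ↔ h ∈ S)

def Bad (S : Set (FG k)) : Set (FG k × Letter k) := {q | nc q.1 q.2 ∧ ¬ Cst S q.1 q.2}

theorem lt_mem_Cone (p : FG k) (b : Letter k) : p * lt b ∈ Cone p b := by
  rw [mem_Cone, inv_mul_cancel_left, hd_lt]

theorem Bad_finite {S : Set (FG k)} (hS : AI S) : (Bad S).Finite := by
  have hf : (⋃ x : Letter k, D S (lt x)).Finite := Set.finite_iUnion fun x => hS _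
  obtain ⟨L, hL⟩ := (hf.image wordLength).bddAbove
  apply Set.Finite.subset (((ball_finite (k := k) L)).prod (Set.finite_univ (α := Letter k)))
  rintro ⟨p, b⟩ ⟨h1, h2⟩
  simp only at h1 h2
  refine ⟨?_, Set.mem_univ _⟩
  by_contra hc
  simp only [Set.mem_ofPred_eq, not_le] at hc
  apply h2
  have key : ∀ h : FG k, h⁻¹ ∈ V {b} → (p * h⁻¹ ∈ S ↔ p * lt b ∈ S) := by
    intro h
    induction h using red_ind with
    | h1 => intro h; rw [inv_one] at h; exact absurd h (one_notMem_V _)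
    | hc x g _ ih =>
      classical
      rw [mul_inv_rev, lt_inv, mem_V_mul]
      generalize g⁻¹ = f at *
      split_ifs with e1 e2
      · intro h
        subst e1
        rw [Set.mem_singleton_iff.1 h]; simp
      · exact fun h => h.elim
      · intro h
        rw [← ih h, ← mul_assoc]
        by_contra hcc
        have hm : p * f ∈ D S (lt (linv x)) := by
          simp only [D, Set.mem_ofPred_eq]; tauto
        have := hL (Set.mem_image_of_mem wordLength (Set.mem_iUnion.2 ⟨_, hm⟩))
        have h3 : p * f ∈ Cone p b := by
          simp only [Cone, Set.mem_preimage, inv_mul_cancel_left]; exact h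
        have := wl_cone h1 h3
        omega
  intro g h hg hh
  have e1 := key (p⁻¹ * g)⁻¹ (by rw [inv_inv]; exact hg)
  have e2 := key (p⁻¹ * h)⁻¹ (by rw [inv_inv]; exact hh)
  rw [inv_inv, mul_inv_cancel_left] at e1 e2
  rw [e1, e2]

theorem AI_Cone (p : FG k) (b : Letter k) : AI (Cone p b) := (AI_V {b}).trans _

theorem d_Cone (p : FG k) (b : Letter k) (h : FG k) : d (Cone p b) h = d (V {b}) h :=
  d_trans _ _ _

theorem toWord_of_hd {f : FG k} {b : Letter k} (hy : hd f = some b) :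
    ∃ l, f.toWord = b :: l := by
  unfold hd at hy
  cases hh : f.toWord with
  | nil => rw [hh] at hy; simp at hy
  | cons y l => rw [hh] at hy; simp at hy; subst hy; exact ⟨l, rfl⟩

theorem hd_cancel {f : FG k} {b : Letter k} (hy : hd f = some (linv b)) :
    hd (lt b * f) ≠ some b := by
  intro h5
  obtain ⟨l, hl⟩ := toWord_of_hd hy
  have hr := FreeGroup.isReduced_toWord (x := f)
  have h8 : f = lt (linv b) * FreeGroup.mk l := by
    rw [← mk_cons, ← hl, FreeGroup.mk_toWord]
  have h9 : lt b * f = FreeGroup.mk l := by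
    rw [h8, lt_linv]; group
  rw [hl] at hr
  have h10 : FreeGroup.IsReduced l := by
    have : linv b :: l = [linv b] ++ l := rfl
    rw [this, FreeGroup.IsReduced, List.isChain_append] at hr
    exact hr.2.1
  rw [h9, hd, FreeGroup.toWord_mk, h10.reduce_eq] at h5
  cases l with
  | nil => simp at h5
  | cons z l =>
    simp at h5
    subst h5
    rw [FreeGroup.isReduced_cons_cons] at hr
    have := hr.1 rfl
    simp [linv] at this

open Filter in
theorem prune_step {w : ℕ → FG k}
    (hw : ∀ (b : Letter k) (A : Set (Letter k)), b ∈ A → linv b ∉ A →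
      ∃ C, ∀ N, d (V {b}) (w N) ≤ d (V A) (w N) + C)
    {S : Set (FG k)} (hS : AI S) {a : Letter k}
    (ha : ∀ᶠ m in atTop, lt a ^ m ∈ S) (ha' : ∀ᶠ m in atTop, lt (linv a) ^ m ∉ S)
    {p : FG k} {b : Letter k} (hb : (p, b) ∈ Bad S)
    (hch : ∀ y, y ≠ linv b → Cst S (p * lt b) y) (hin : p * lt b * lt b ∈ S) :
    ∃ S', AI S' ∧ (∀ᶠ m in atTop, lt a ^ m ∈ S') ∧ (∀ᶠ m in atTop, lt (linv a) ^ m ∉ S') ∧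
      Bad S' ⊂ Bad S ∧ ∃ C, ∀ N, d S' (w N) ≤ d S (w N) + C := by
  classical
  obtain ⟨hnc, hncst⟩ := hb
  simp only at hnc hncst
  refine ⟨S ∪ Cone p b, hS.union (AI_Cone p b), ?_, ?_, ?_, ?_⟩
  · filter_upwards [ha] with m hm using Or.inl hm
  · have : ∀ m, lt (linv a) ^ m ∉ Cone p b := by
      intro m hm
      obtain ⟨n, hn1, hn2⟩ := (ha'.and (eventually_ge_atTop (wordLength p + 2))).exists
      have h1 := pow_in_cone hnc hm hn2
      exact hn1 ((hch b (linv_ne b).symm _ _ h1 (lt_mem_Cone _ _)).2 hin)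
    filter_upwards [ha'] with m hm
    rintro (h | h)
    · exact hm h
    · exact this m h
  · rw [Set.ssubset_iff_of_subset]
    · refine ⟨(p, b), ⟨hnc, hncst⟩, fun h => h.2 ?_⟩
      intro g h hg hh
      simp only at hg hh
      simp [hg, hh]
    · rintro ⟨q, c⟩ ⟨hq1, hq2⟩
      refine ⟨hq1, fun hq3 => hq2 ?_⟩
      simp only at hq1 hq2 hq3 ⊢
      intro g h hg hh
      have hgh := hq3 g h hg hh
      by_cases e1 : g ∈ Cone p b <;> by_cases e2 : h ∈ Cone p b
      · simp [e1, e2]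
      · exact absurd (fun x y hx hy => hq3 x y (cone_nested hnc hq1 e1 hg hh e2 hx)
          (cone_nested hnc hq1 e1 hg hh e2 hy)) hncst
      · exact absurd (fun x y hx hy => hq3 x y (cone_nested hnc hq1 e2 hh hg e1 hx)
          (cone_nested hnc hq1 e2 hh hg e1 hy)) hncst
      · simp [e1, e2, hgh]
  · let A : Set (Letter k) := {y | y ≠ linv b ∧ p * lt b * lt y ∈ S}
    obtain ⟨C, hC⟩ := hw b A ⟨(linv_ne b).symm, hin⟩ (fun h => h.1 rfl)
    refine ⟨C + 2, fun N => ?_⟩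
    have h1 := submod hS (AI_Cone p b) (w N)
    have h2 : d ((fun g => (p * lt b)⁻¹ * g) ⁻¹' V A) (w N) ≤
        d (S ∩ Cone p b) (w N) + 2 * ({p * lt b} : Set (FG k)).ncard := by
      apply d_finite_change (hS.inter (AI_Cone p b)) (Set.finite_singleton _)
      intro g hg
      obtain ⟨f, rfl⟩ : ∃ f, g = p * lt b * f := ⟨(p * lt b)⁻¹ * g, by group⟩
      have hf : f ≠ 1 := by rintro rfl; simp at hg
      obtain ⟨y, hy⟩ : ∃ y, hd f = some y := by
        cases hh : hd f with
        | none => exact absurd (hd_none hh) hf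
        | some y => exact ⟨y, rfl⟩
      simp only [Set.mem_preimage, inv_mul_cancel_left]
      rw [mem_V_of_hd hy, Set.mem_inter_iff, mem_Cone,
        show p⁻¹ * (p * lt b * f) = lt b * f by group]
      by_cases hyb : y = linv b
      · have : hd (lt b * f) ≠ some b := by
          exact hd_cancel (by rw [hy, hyb])
        simp [A, hyb, this]
      · rw [hd_cons b f (by rw [hy]; simpa using hyb)]
        have h3 : p * lt b * f ∈ Cone (p * lt b) y := by
          rw [mem_Cone, inv_mul_cancel_left, hy]
        simp only [A, Set.mem_ofPred_eq, ne_eq, hyb, not_false_eq_true, true_and, and_true]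
        exact (hch y hyb _ _ (lt_mem_Cone _ _) h3)
    rw [Set.ncard_singleton, d_trans] at h2
    rw [d_Cone] at h1
    have := hC N
    omega


theorem Bad_compl (S : Set (FG k)) : Bad Sᶜ = Bad S := by
  ext q
  simp only [Bad, Cst, Set.mem_ofPred_eq, Set.mem_compl_iff, not_iff_not]

open Filter in
theorem prune {w : ℕ → FG k}
    (hw : ∀ (b : Letter k) (A : Set (Letter k)), b ∈ A → linv b ∉ A →
      ∃ C, ∀ N, d (V {b}) (w N) ≤ d (V A) (w N) + C) (n : ℕ) :
    ∀ {S : Set (FG k)} (_ : AI S) {a : Letter k}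
    (_ : ∀ᶠ m in atTop, lt a ^ m ∈ S) (_ : ∀ᶠ m in atTop, lt (linv a) ^ m ∉ S)
    (_ : (Bad S).ncard ≤ n),
    ∃ C, ∀ N, d (V {a}) (w N) ≤ d S (w N) + C := by
  induction n with
  | zero =>
    intro S hS a ha ha' hn
    have hE : Bad S = ∅ := by
      rw [← Set.ncard_eq_zero (Bad_finite hS)]; omega
    have hc : ∀ y, Cst S 1 y := by
      intro y
      by_contra h
      have : ((1 : FG k), y) ∈ Bad S := ⟨by simp [nc, hd_one], h⟩
      rw [hE] at this
      exact this
    have hc' : ∀ g y, hd g = some y → (g ∈ S ↔ lt y ∈ S) := by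
      intro g y hg
      apply hc y <;> rw [mem_Cone]
      · simpa using hg
      · simp [hd_lt]
    have hpow : ∀ (c : Letter k) (m : ℕ), 1 ≤ m → hd (lt c ^ m) = some c := by
      intro c m hm
      unfold hd
      rw [toWord_lt_pow]
      obtain ⟨m, rfl⟩ : ∃ j, m = j + 1 := ⟨m - 1, by omega⟩
      rfl
    let A : Set (Letter k) := {y | lt y ∈ S}
    have h1 : a ∈ A := by
      obtain ⟨m, hm, hm'⟩ := (ha.and (eventually_ge_atTop 1)).exists
      exact (hc' _ _ (hpow a m hm')).1 hm
    have h2 : linv a ∉ A := by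
      obtain ⟨m, hm, hm'⟩ := (ha'.and (eventually_ge_atTop 1)).exists
      exact fun h => hm ((hc' _ _ (hpow (linv a) m hm')).2 h)
    obtain ⟨C, hC⟩ := hw a A h1 h2
    refine ⟨C + 2, fun N => ?_⟩
    have h3 : d (V A) (w N) ≤ d S (w N) + 2 * ({1} : Set (FG k)).ncard := by
      apply d_finite_change hS (Set.finite_singleton _)
      intro g hg
      obtain ⟨y, hy⟩ : ∃ y, hd g = some y := by
        cases hh : hd g with
        | none => exact absurd (hd_none hh) hg
        | some y => exact ⟨y, rfl⟩
      rw [mem_V_of_hd hy, hc' g y hy]; rfl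
    rw [Set.ncard_singleton] at h3
    have := hC N
    omega
  | succ n ih =>
    intro S hS a ha ha' hn
    by_cases hne : (Bad S).Nonempty
    · obtain ⟨⟨p, b⟩, hpb, hmax⟩ := Set.exists_max_image (Bad S) (fun q => wordLength q.1)
        (Bad_finite hS) hne
      have hch : ∀ y, y ≠ linv b → Cst S (p * lt b) y := by
        intro y hy
        by_contra h
        have := hmax (p * lt b, y) ⟨nc_child hpb.1 hy, h⟩
        simp only [wordLength] at this
        rw [toWord_mul_lt hpb.1] at this
        simp at this
      by_cases hin : p * lt b * lt b ∈ S
      · obtain ⟨S', h1, h2, h3, h4, C, hC⟩ := prune_step hw hS ha ha' hpb hch hin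
        have h5 := Set.ncard_lt_ncard h4 (Bad_finite hS)
        obtain ⟨C', hC'⟩ := ih h1 h2 h3 (by omega)
        refine ⟨C + C', fun N => ?_⟩
        have := hC N
        have := hC' N
        omega
      · obtain ⟨S', h1, h2, h3, h4, C, hC⟩ := prune_step (a := linv a) (S := Sᶜ) hw hS.compl ha'
          (by rw [linv_linv]; filter_upwards [ha] with m hm using fun h => h hm)
          (by rw [Bad_compl]; exact hpb)
          (by
            intro y hy g h hg hh
            have := hch y hy g h hg hh
            simp only [Set.mem_compl_iff, not_iff_not]
            exact this) hin
        rw [Bad_compl] at h4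
        have h5 := Set.ncard_lt_ncard h4 (Bad_finite hS)
        obtain ⟨C', hC'⟩ := ih h1 h2 h3 (by omega)
        refine ⟨C + C', fun N => ?_⟩
        have h6 := hC N
        have h7 := hC' N
        rw [d_compl] at h6
        have e2 : d (V {linv a}) (w N) = d (V {a}) (w N) := by
          rw [d_letter, d_letter]; rfl
        omega
    · apply ih hS ha ha'
      rw [Set.not_nonempty_iff_eq_empty] at hne
      rw [hne]; simp

end EB

namespace EB
variable {k : ℕ}

theorem hd_mul_of_lt (y : FG k) : ∀ g : FG k, wordLength y < wordLength g → hd (g * y) = hd g := by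
  induction y using red_ind with
  | h1 => intro g _; simp
  | hc x y hx ih =>
    intro g hg
    have e : wordLength (lt x * y) = wordLength y + 1 := by
      unfold wordLength; rw [red_cons x y hx]; simp
    rw [e] at hg
    have h1 : wordLength g ≤ wordLength (g * lt x) + 1 := by
      have := wl_mul_le (g * lt x) (lt x)⁻¹
      rwa [mul_inv_cancel_right, wl_inv, wl_lt] at this
    rw [← mul_assoc, ih _ (by omega)]
    apply hd_mul_lt
    · rintro rfl; rw [wl_one] at hg; omega
    · rintro rfl; rw [wl_lt] at hg; omega

theorem cr_hd {u : FG k} (hu : IsCyclicallyReduced u) {c : Letter k} (hc : hd u = some c) :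
    hd u⁻¹ ≠ some c := by
  intro h
  obtain ⟨l, hl⟩ := toWord_of_hd hc
  obtain ⟨l', hl'⟩ := toWord_of_hd h
  have e1 : u = lt c * FreeGroup.mk l := by rw [← mk_cons, ← hl, FreeGroup.mk_toWord]
  have e2 : u⁻¹ = lt c * FreeGroup.mk l' := by rw [← mk_cons, ← hl', FreeGroup.mk_toWord]
  have e3 : u ^ 2 = (FreeGroup.mk l')⁻¹ * FreeGroup.mk l := by
    rw [pow_two]
    nth_rw 1 [← inv_inv u]
    rw [e2]
    nth_rw 1 [e1]
    group
  have h1 := wl_pow_cr hu 2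
  rw [e3] at h1
  have h2 := wl_mul_le (FreeGroup.mk l' : FG k)⁻¹ (FreeGroup.mk l)
  have h3 : wordLength (FreeGroup.mk l : FG k) ≤ l.length := FreeGroup.norm_mk_le
  have h4 : wordLength (FreeGroup.mk l' : FG k) ≤ l'.length := FreeGroup.norm_mk_le
  have h5 : wordLength u = l.length + 1 := by unfold wordLength; rw [hl]; simp
  have h6 : wordLength u⁻¹ = l'.length + 1 := by unfold wordLength; rw [hl']; simp
  rw [wl_inv] at h2 h6
  omega

theorem cr_rotate {u : FG k} (hu : IsCyclicallyReduced u) {c : Letter k} (hc : c ∈ u.toWord) :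
    ∃ x v : FG k, IsCyclicallyReduced v ∧ u = x * v * x⁻¹ ∧ hd v = some c := by
  obtain ⟨l1, l2, hl⟩ := List.append_of_mem hc
  have h3 := (((cr_iff u).1 hu).flatten_replicate 3).isReduced
  rw [hl] at h3
  have h4 : FreeGroup.IsReduced ((c :: l2 ++ l1) ++ (c :: l2 ++ l1)) := by
    apply List.IsChain.infix h3
    exact ⟨l1, c :: l2, by simp [List.replicate]⟩
  have h5 : FreeGroup.IsReduced (c :: l2 ++ l1) := by
    apply List.IsChain.infix h4
    exact ⟨[], c :: l2 ++ l1, by simp⟩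
  have h6 : (FreeGroup.mk (c :: l2 ++ l1) : FG k).toWord = c :: l2 ++ l1 := by
    rw [FreeGroup.toWord_mk, h5.reduce_eq]
  refine ⟨FreeGroup.mk l1, FreeGroup.mk (c :: l2 ++ l1), ?_, ?_, ?_⟩
  · unfold IsCyclicallyReduced CyclicallyReducedWord
    rw [h6]; exact h4.reduce_eq
  · rw [← FreeGroup.mk_toWord (x := u), hl, ← FreeGroup.mul_mk, ← FreeGroup.mul_mk]
    group
  · rw [hd, h6]; rfl

noncomputable def es (j : Fin k) : FG k →* Multiplicative ℤ :=
  FreeGroup.lift (fun i => Multiplicative.ofAdd (if i = j then (1 : ℤ) else 0))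

theorem es_of (j i : Fin k) :
    es j (lt (i, true)) = Multiplicative.ofAdd (if i = j then (1 : ℤ) else 0) := by
  rw [es, ← of_eq, FreeGroup.lift_apply_of]

theorem es_lt_ne {j : Fin k} {x : Letter k} (h : x.1 ≠ j) : es j (lt x) = 1 := by
  have h1 : es j (lt (x.1, true)) = 1 := by rw [es_of]; simp [h]
  rcases eq_or_of_fst (x := (x.1, true)) (y := x) rfl with e | e
  · rw [e]; exact h1
  · rw [e, lt_linv, map_inv, h1, inv_one]

theorem es_mk {j : Fin k} (L : List (Letter k)) (h : ∀ x ∈ L, x.1 ≠ j) :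
    es j (FreeGroup.mk L) = 1 := by
  induction L with
  | nil => exact map_one _
  | cons x L ih =>
    rw [mk_cons, map_mul, es_lt_ne (h x (by simp)), ih (fun y hy => h y (by simp [hy])), one_mul]

open Filter in
theorem sep {h : FG k} {j : Fin k} (hj : es j h ≠ 1) : ∃ (v : FG k) (c : Letter k), c.1 = j ∧
    (∀ᶠ m in atTop, h ^ m ∈ Cone v c) ∧ (∀ᶠ m in atTop, (h⁻¹) ^ m ∉ Cone v c) := by
  obtain ⟨x, u, hu, rfl, _⟩ := cr_decomp h
  have h1 : es j u ≠ 1 := by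
    intro h; apply hj; simp [h]
  obtain ⟨c, hc, hcj⟩ : ∃ c ∈ u.toWord, c.1 = j := by
    by_contra hcon
    push Not at hcon
    apply h1
    rw [← FreeGroup.mk_toWord (x := u)]
    exact es_mk _ hcon
  obtain ⟨y, v, hv, rfl, hdv⟩ := cr_rotate hu hc
  have hlen : 1 ≤ wordLength v := by
    by_contra hcon
    have : v = 1 := wl_zero (by omega)
    rw [this, hd_one] at hdv
    simp at hdv
  have hpos : ∀ u : FG k, IsCyclicallyReduced u → 1 ≤ wordLength u → ∀ m, 1 ≤ m →
      hd (u ^ m) = hd u := by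
    intro u hu hl m hm
    obtain ⟨m, rfl⟩ : ∃ j, m = j + 1 := ⟨m - 1, by omega⟩
    unfold hd
    rw [toWord_pow_cr hu, List.replicate_succ, List.flatten_cons, List.head?_append_of_ne_nil]
    intro h0
    rw [wordLength, h0] at hl
    simp at hl
  have hvi : IsCyclicallyReduced v⁻¹ := by
    obtain ⟨z, t, ht, e, hl⟩ := cr_decomp v⁻¹
    have h3 : v = z * t⁻¹ * z⁻¹ := by rw [← inv_inv v, e]; group
    have h4 : cyclicLength v = wordLength v := cl_eq (x := 1) hv (by simp)
    have h5 : wordLength v ≤ wordLength t := by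
      rw [← h4, h3, cl_conj, ← wl_inv t]; exact cl_le_wl _
    rw [wl_inv] at hl
    have : z = 1 := wl_zero (by omega)
    rw [e, this]; simpa using ht
  refine ⟨x * y, c, hcj, ?_, ?_⟩
  · filter_upwards [eventually_gt_atTop (wordLength (x * y))] with m hm
    rw [mem_Cone, show x * (y * v * y⁻¹) * x⁻¹ = (x * y) * v * (x * y)⁻¹ by group, conj_pow,
      mul_assoc, inv_mul_cancel_left, hd_mul_of_lt, hpos v hv hlen _ (by omega), hdv]
    rw [wl_inv, wl_pow_cr hv]
    nlinarith
  · filter_upwards [eventually_gt_atTop (wordLength (x * y))] with m hm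
    rw [mem_Cone, show (x * (y * v * y⁻¹) * x⁻¹)⁻¹ = (x * y) * v⁻¹ * (x * y)⁻¹ by group, conj_pow,
      mul_assoc, inv_mul_cancel_left, hd_mul_of_lt, hpos v⁻¹ hvi (by rwa [wl_inv]) _ (by omega)]
    · exact cr_hd hv hdv
    · rw [wl_inv, wl_pow_cr hvi, wl_inv]
      nlinarith

noncomputable def esM (α : MulAut (FG k)) : Matrix (Fin k) (Fin k) ℤ :=
  fun i j => Multiplicative.toAdd (es j (α (lt (i, true))))

theorem es_aut (α : MulAut (FG k)) (j : Fin k) (g : FG k) :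
    Multiplicative.toAdd (es j (α g)) = ∑ i, Multiplicative.toAdd (es i g) * esM α i j := by
  let F : FG k →* Multiplicative ℤ := (es j).comp α.toMonoidHom
  let G : FG k →* Multiplicative ℤ :=
    { toFun := fun g => Multiplicative.ofAdd (∑ i, Multiplicative.toAdd (es i g) * esM α i j)
      map_one' := by simp
      map_mul' := by
        intro a b
        rw [← ofAdd_add, ← Finset.sum_add_distrib]
        congr 1
        apply Finset.sum_congr rfl
        intro i _
        rw [map_mul, toAdd_mul, add_mul] }
  have : F = G := by
    apply FreeGroup.ext_hom
    intro l
    show es j (α (lt (l, true))) = Multiplicative.ofAdd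
      (∑ i, Multiplicative.toAdd (es i (lt (l, true))) * esM α i j)
    simp only [es_of]
    simp [esM]
  have h2 := DFunLike.congr_fun this g
  exact congrArg Multiplicative.toAdd h2

theorem esM_det (α : MulAut (FG k)) : (esM α).det ≠ 0 := by
  have h : esM (α⁻¹) * esM α = 1 := by
    ext l j
    rw [Matrix.mul_apply]
    have := es_aut α j (α⁻¹ (lt (l, true)))
    rw [show α (α⁻¹ (lt (l, true))) = lt (l, true) from MulAut.apply_inv_self _ _ _] at this
    rw [es_of] at this
    simp only [toAdd_ofAdd] at this
    rw [Matrix.one_apply, this]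
    rfl
  intro h0
  have := congrArg Matrix.det h
  rw [Matrix.det_mul, h0] at this
  simp at this

theorem exists_perm (α : MulAut (FG k)) : ∃ σ : Equiv.Perm (Fin k),
    ∀ i, es i (α (lt (σ i, true))) ≠ 1 := by
  have h := esM_det α
  rw [Matrix.det_apply] at h
  obtain ⟨σ, _, hσ⟩ := Finset.exists_ne_zero_of_sum_ne_zero h
  refine ⟨σ, fun i hi => hσ ?_⟩
  rw [Finset.prod_eq_zero (Finset.mem_univ i), smul_zero]
  simp [esM, hi]

open Filter in
theorem letter_bound {w : FG k} (hw : w ∈ SM k) (α : MulAut (FG k)) {i j : Fin k}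
    (h : es j (α (lt (i, true))) ≠ 1) :
    ∃ C, ∀ N, d (V {((i, true) : Letter k)}) (w ^ N) ≤
      d (V {((j, true) : Letter k)}) ((α w) ^ N) + C := by
  obtain ⟨v, c, hc, h1, h2⟩ := sep h
  have hS := (AI_Cone v c).map α
  obtain ⟨C, hC⟩ := prune (w := fun N => w ^ N) (fun b A hb hb' => cut_bound hw b A hb hb')
    _ (S := α ⁻¹' Cone v c) hS (a := (i, true))
    (by filter_upwards [h1] with m hm; rwa [Set.mem_preimage, map_pow])
    (by filter_upwards [h2] with m hm; rwa [Set.mem_preimage, map_pow, lt_linv, map_inv]) le_rfl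
  refine ⟨C, fun N => ?_⟩
  have := hC N
  rw [d_map, d_Cone, map_pow] at this
  have e : d (V {c}) (α w ^ N) = d (V {((j, true) : Letter k)}) (α w ^ N) := by
    rw [d_letter, d_letter, hc]
  rw [← e]
  exact this

theorem SM_min {w : FG k} (hw : w ∈ SM k) (α : MulAut (FG k)) :
    wordLength w ≤ cyclicLength (α w) := by
  obtain ⟨σ, hσ⟩ := exists_perm α
  choose C hC using fun i => letter_bound hw α (hσ i)
  obtain ⟨C', hC'⟩ := pow_bd (α w)
  apply arch (C := (∑ i, C i) + C')
  intro N
  rw [← wl_pow_cr hw.1, ← sum_d, ← Equiv.sum_comp σ]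
  have h1 := Finset.sum_le_sum (fun i (_ : i ∈ Finset.univ) => hC i N)
  rw [Finset.sum_add_distrib, sum_d] at h1
  have := (hC' N).1
  omega

theorem SM_orbit {w u : FG k} (hw : w ∈ SM k) (hu : u ∈ SM k) (α : MulAut (FG k)) (x : FG k)
    (h : α w = x * u * x⁻¹) : wordLength w = wordLength u := by
  apply le_antisymm
  · have := SM_min hw α
    rwa [cl_eq hu.1 h] at this
  · have h2 : α⁻¹ u = (α⁻¹ x)⁻¹ * w * (α⁻¹ x)⁻¹⁻¹ := by
      have : u = x⁻¹ * α w * x := by rw [h]; group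
      rw [this, map_mul, map_mul, MulAut.inv_apply_self, map_inv, inv_inv]
    have := SM_min hu α⁻¹
    rwa [cl_eq hw.1 h2] at this

end EB

namespace EB
variable {k : ℕ}

theorem turns_append (A : Set (Letter k)) (l1 l2 : List (Letter k)) :
    turns A l1 + turns A l2 ≤ turns A (l1 ++ l2) := by
  induction l1 with
  | nil => simp [turns]
  | cons x l ih =>
    cases l with
    | nil =>
      cases l2 with
      | nil => simp [turns]
      | cons y l2 => simp [turns]
    | cons y l =>
      simp only [turns, List.cons_append] at ih ⊢
      omega

theorem turns_replicate (A : Set (Letter k)) (l : List (Letter k)) (N : ℕ) :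
    N * turns A l ≤ turns A (List.replicate N l).flatten := by
  induction N with
  | zero => simp
  | succ N ih =>
    rw [List.replicate_succ, List.flatten_cons]
    have := turns_append A l (List.replicate N l).flatten
    nlinarith

theorem countP_replicate (p : Letter k → Bool) (l : List (Letter k)) (N : ℕ) :
    (List.replicate N l).flatten.countP p = N * l.countP p := by
  induction N with
  | zero => simp
  | succ N ih => rw [List.replicate_succ, List.flatten_cons, List.countP_append, ih]; ring

/-- data of a nontrivial cut -/
def Cut (a : Letter k) (A : Set (Letter k)) : Prop :=
  linv a ∈ A ∧ a ∉ A ∧ (∃ x ∈ A, x ≠ linv a) ∧ (∃ x, x ∉ A ∧ x ≠ a)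

theorem nonSM_turns {u : FG k} (hu : IsCyclicallyReduced u) (hn : u ∉ SM k) :
    ∃ a A, Cut a A ∧ turns A u.toWord ≤ u.toWord.countP (fun y => decide (y.1 = a.1)) := by
  have : ∃ τ : MulAut (FG k), IsWhitehead2 τ ∧ ¬ IsInner τ ∧ cyclicLength (τ u) ≤ wordLength u := by
    by_contra hc
    push Not at hc
    exact hn ⟨hu, hc⟩
  obtain ⟨τ, h1, h2, h3⟩ := this
  obtain ⟨a, A, wa, hA, hA'⟩ := exists_cut h1 h2
  refine ⟨a, A, ⟨wa.h1, wa.h2, hA, hA'⟩, ?_⟩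
  obtain ⟨C, hC⟩ := pow_bd (τ u)
  apply arch (C := C)
  intro N
  have e1 := wa.len (u ^ N)
  have e2 := turns_le_d A (u ^ N)
  have e3 := turns_replicate A u.toWord N
  rw [toWord_pow_cr hu] at e2
  rw [d_letter, toWord_pow_cr hu, countP_replicate, map_pow, wl_pow_cr hu] at e1
  have := (hC N).1
  have := Nat.mul_le_mul_left N h3
  omega

/-- additive functional along words -/
noncomputable def fw (φ : Letter k → Letter k → ℝ) : List (Letter k) → ℝ
  | [] => 0
  | [_] => 0
  | (y :: z :: l) => φ y z + fw φ (z :: l)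

def nb (x : Letter k) : Finset (Letter k) := Finset.univ.erase (linv x)

theorem card_nb (x : Letter k) : (nb x).card = 2 * k - 1 := by
  rw [nb, Finset.card_erase_of_mem (Finset.mem_univ _)]
  simp [mul_comm]

theorem mem_nb {x y : Letter k} : y ∈ nb x ↔ y ≠ linv x := by simp [nb]

noncomputable def Zs (φ : Letter k → Letter k → ℝ) (s : ℝ) : ℕ → Letter k → ℝ
  | 0, _ => 1
  | n + 1, x => ∑ y ∈ nb x, Real.exp (s * φ x y) * Zs φ s n y

def Q (φ : Letter k → Letter k → ℝ) (n : ℕ) (x : Letter k) (t : ℝ) : Set (List (Letter k)) :=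
  {l | l.length = n ∧ FreeGroup.IsReduced (x :: l) ∧ t ≤ fw φ (x :: l)}

theorem Q_finite (φ : Letter k → Letter k → ℝ) (n : ℕ) (x : Letter k) (t : ℝ) :
    (Q φ n x t).Finite :=
  (List.finite_length_eq (Letter k) n).subset (fun _ h => h.1)

theorem Q_bound (φ : Letter k → Letter k → ℝ) {s : ℝ} (hs : 0 ≤ s) (n : ℕ) :
    ∀ (x : Letter k) (t : ℝ), ((Q φ n x t).ncard : ℝ) ≤ Real.exp (-s * t) * Zs φ s n x := by
  induction n with
  | zero =>
    intro x t
    by_cases ht : t ≤ 0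
    · have : Q φ 0 x t ⊆ {[]} := by
        intro l hl
        simpa using hl.1
      have h1 := Set.ncard_le_ncard this
      rw [Set.ncard_singleton] at h1
      have h2 : 1 ≤ Real.exp (-s * t) := Real.one_le_exp (by nlinarith)
      have h3 : ((Q φ 0 x t).ncard : ℝ) ≤ 1 := by exact_mod_cast h1
      simp only [Zs]; linarith
    · have : Q φ 0 x t = ∅ := by
        ext l
        simp only [Q, Set.mem_ofPred_eq, Set.mem_empty_iff_false, iff_false]
        rintro ⟨h1, h2, h3⟩
        rw [List.length_eq_zero_iff] at h1
        subst h1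
        simp only [fw] at h3
        exact ht h3
      rw [this]
      simp only [Set.ncard_empty, Nat.cast_zero, Zs]
      positivity
  | succ n ih =>
    intro x t
    have hsub : Q φ (n + 1) x t ⊆ ⋃ y ∈ nb x, (fun l => y :: l) '' Q φ n y (t - φ x y) := by
      rintro l ⟨h1, h2, h3⟩
      cases l with
      | nil => simp at h1
      | cons y l =>
        rw [FreeGroup.isReduced_cons_cons, cancel_iff] at h2
        simp only [fw] at h3
        simp only [Set.mem_iUnion, Set.mem_image]
        refine ⟨y, mem_nb.2 h2.1, l, ⟨by simpa using h1, h2.2, by linarith⟩, rfl⟩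
    have hfin : (⋃ y ∈ nb x, (fun l => y :: l) '' Q φ n y (t - φ x y)).Finite := by
      apply Set.Finite.biUnion (Finset.finite_toSet _)
      intro y _
      exact (Q_finite _ _ _ _).image _
    have h1 := (Set.ncard_le_ncard hsub hfin).trans (Finset.set_ncard_biUnion_le _ _)
    have h2 : ((Q φ (n + 1) x t).ncard : ℝ) ≤
        ∑ y ∈ nb x, (((fun l => y :: l) '' Q φ n y (t - φ x y)).ncard : ℝ) := by
      exact_mod_cast h1
    refine h2.trans ?_
    simp only [Zs]
    rw [Finset.mul_sum]
    apply Finset.sum_le_sum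
    intro y _
    have h3 : (((fun l => y :: l) '' Q φ n y (t - φ x y)).ncard : ℝ) ≤
        ((Q φ n y (t - φ x y)).ncard : ℝ) := by
      exact_mod_cast Set.ncard_image_le (Q_finite _ _ _ _)
    refine h3.trans ((ih y (t - φ x y)).trans (le_of_eq ?_))
    rw [← mul_assoc, ← Real.exp_add]
    congr 2
    ring

theorem Zs_pos (φ : Letter k → Letter k → ℝ) (s : ℝ) (n : ℕ) : ∀ x, 0 ≤ Zs φ s n x := by
  induction n with
  | zero => intro x; simp [Zs]
  | succ n ih =>
    intro x
    simp only [Zs]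
    exact Finset.sum_nonneg fun y _ => mul_nonneg (Real.exp_pos _).le (ih y)

/-- if two-step row sums are at most `r²` we get exponential bounds -/
theorem Zs_bound (φ : Letter k → Letter k → ℝ) {s r C : ℝ} (hr : 1 ≤ r)
    (h2 : ∀ x, ∑ y ∈ nb x, ∑ z ∈ nb y, Real.exp (s * (φ x y + φ y z)) ≤ r ^ 2)
    (hC : 1 ≤ C) (h1 : ∀ x, ∑ y ∈ nb x, Real.exp (s * φ x y) ≤ C) (n : ℕ) :
    ∀ x, Zs φ s n x ≤ C * r ^ n := by
  induction n using Nat.strong_induction_on with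
  | _ n ih =>
    intro x
    match n, ih with
    | 0, _ => simpa [Zs] using hC
    | 1, _ =>
      simp only [Zs, mul_one, pow_one]
      have := h1 x
      nlinarith
    | n + 2, ih =>
      simp only [Zs]
      calc ∑ y ∈ nb x, Real.exp (s * φ x y) * ∑ z ∈ nb y, Real.exp (s * φ y z) * Zs φ s n z
          = ∑ y ∈ nb x, ∑ z ∈ nb y, Real.exp (s * (φ x y + φ y z)) * Zs φ s n z := by
            apply Finset.sum_congr rfl
            intro y _
            rw [Finset.mul_sum]
            apply Finset.sum_congr rfl
            intro z _
            rw [mul_add, Real.exp_add, mul_assoc]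
        _ ≤ ∑ y ∈ nb x, ∑ z ∈ nb y, Real.exp (s * (φ x y + φ y z)) * (C * r ^ n) := by
            gcongr with y _ z _
            exact ih n (by omega) z
        _ = (∑ y ∈ nb x, ∑ z ∈ nb y, Real.exp (s * (φ x y + φ y z))) * (C * r ^ n) := by
            rw [Finset.sum_mul]
            apply Finset.sum_congr rfl
            intro y _
            rw [Finset.sum_mul]
        _ ≤ r ^ 2 * (C * r ^ n) := by
            gcongr
            exact h2 x
        _ = C * r ^ (n + 2) := by ring

end EB

namespace EB
variable {k : ℕ}

open Classical in
noncomputable def ph (a : Letter k) (A : Set (Letter k)) (x y : Letter k) : ℝ :=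
  (if y.1 = a.1 then 1 else 0) - (if (linv x ∈ A ↔ y ∈ A) then 0 else 1)

theorem ph_abs (a : Letter k) (A : Set (Letter k)) (x y : Letter k) : |ph a A x y| ≤ 1 := by
  unfold ph; split_ifs <;> simp

theorem m_bound {a : Letter k} {A : Set (Letter k)} (hc : Cut a A) (x : Letter k) :
    ∑ y ∈ nb x, ph a A x y ≤ 0 ∧ (x.1 = a.1 → ∑ y ∈ nb x, ph a A x y ≤ -1) := by
  classical
  obtain ⟨h1, h2, ⟨x1, h3, h4⟩, ⟨x0, h5, h6⟩⟩ := hc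
  have e : ∑ y ∈ nb x, ph a A x y = (((nb x).filter (fun y => y.1 = a.1)).card : ℝ) -
      (((nb x).filter (fun y => ¬(linv x ∈ A ↔ y ∈ A))).card : ℝ) := by
    unfold ph
    rw [Finset.sum_sub_distrib]
    congr 1
    · rw [Finset.sum_boole]
    · rw [← Finset.sum_boole]
      apply Finset.sum_congr rfl
      intro y _
      rw [ite_not]
  have hge : 2 ≤ ((nb x).filter (fun y => ¬(linv x ∈ A ↔ y ∈ A))).card := by
    by_cases hx : linv x ∈ A
    · have hs : ({a, x0} : Finset (Letter k)) ⊆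
          (nb x).filter (fun y => ¬(linv x ∈ A ↔ y ∈ A)) := by
        intro y hy
        rw [Finset.mem_insert, Finset.mem_singleton] at hy
        have hyA : y ∉ A := by rcases hy with rfl | rfl <;> assumption
        rw [Finset.mem_filter, mem_nb]
        refine ⟨by rintro rfl; exact hyA hx, by tauto⟩
      have := Finset.card_le_card hs
      rwa [Finset.card_pair (Ne.symm h6)] at this
    · have hs : ({linv a, x1} : Finset (Letter k)) ⊆
          (nb x).filter (fun y => ¬(linv x ∈ A ↔ y ∈ A)) := by
        intro y hy
        rw [Finset.mem_insert, Finset.mem_singleton] at hy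
        have hyA : y ∈ A := by rcases hy with rfl | rfl <;> assumption
        rw [Finset.mem_filter, mem_nb]
        refine ⟨by rintro rfl; exact hx hyA, by tauto⟩
      have := Finset.card_le_card hs
      rwa [Finset.card_pair (Ne.symm h4)] at this
  have hge' : (2 : ℝ) ≤ (((nb x).filter (fun y => ¬(linv x ∈ A ↔ y ∈ A))).card : ℝ) := by
    exact_mod_cast hge
  have hle : ((nb x).filter (fun y => y.1 = a.1)).card ≤ 2 := by
    have hs : (nb x).filter (fun y => y.1 = a.1) ⊆ {a, linv a} := by
      intro y hy
      rw [Finset.mem_filter] at hy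
      rw [Finset.mem_insert, Finset.mem_singleton]
      exact eq_or_of_fst hy.2
    exact (Finset.card_le_card hs).trans Finset.card_le_two
  have hle' : (((nb x).filter (fun y => y.1 = a.1)).card : ℝ) ≤ 2 := by exact_mod_cast hle
  refine ⟨by rw [e]; linarith, fun hx => ?_⟩
  have hle1 : ((nb x).filter (fun y => y.1 = a.1)).card ≤ 1 := by
    have hs : (nb x).filter (fun y => y.1 = a.1) ⊆ {x} := by
      intro y hy
      rw [Finset.mem_filter, mem_nb] at hy
      rw [Finset.mem_singleton]
      rcases eq_or_of_fst (x := x) (y := y) (hy.2.trans hx.symm) with h | h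
      · exact h
      · exact absurd h hy.1
    simpa using Finset.card_le_card hs
  have hle1' : (((nb x).filter (fun y => y.1 = a.1)).card : ℝ) ≤ 1 := by exact_mod_cast hle1
  rw [e]; linarith

theorem two_step {a : Letter k} {A : Set (Letter k)} (hc : Cut a A) (x : Letter k) :
    ∑ y ∈ nb x, ∑ z ∈ nb y, (ph a A x y + ph a A y z) ≤ -1 := by
  have h0 : ∀ y : Letter k, ∑ z ∈ nb y, (ph a A x y + ph a A y z) =
      ((2 * k - 1 : ℕ) : ℝ) * ph a A x y + ∑ z ∈ nb y, ph a A y z := by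
    intro y
    rw [Finset.sum_add_distrib, Finset.sum_const, card_nb, nsmul_eq_mul]
  simp only [h0]
  rw [Finset.sum_add_distrib, ← Finset.mul_sum]
  have h1 := (m_bound hc x).1
  have h2 : ∑ y ∈ nb x, ∑ z ∈ nb y, ph a A y z ≤ -1 := by
    obtain ⟨y0, hy0, hy0'⟩ : ∃ y ∈ nb x, y.1 = a.1 := by
      by_cases h : a = linv x
      · exact ⟨linv a, mem_nb.2 (by rw [← h]; exact linv_ne a), rfl⟩
      · exact ⟨a, mem_nb.2 h, rfl⟩
    have h3 := Finset.single_le_sum (f := fun y => -∑ z ∈ nb y, ph a A y z) (s := nb x)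
      (fun y _ => by have := (m_bound hc y).1; linarith) hy0
    have h4 := (m_bound hc y0).2 hy0'
    rw [Finset.sum_neg_distrib] at h3
    linarith
  have h3 : (0 : ℝ) ≤ ((2 * k - 1 : ℕ) : ℝ) := by positivity
  nlinarith

noncomputable def rr (k : ℕ) : ℝ :=
  Real.sqrt ((2 * (k : ℝ) - 1) ^ 2 - 1 / (16 * (2 * (k : ℝ) - 1) ^ 2))

theorem rr_facts (hk : 2 ≤ k) : rr k ^ 2 = (2 * (k : ℝ) - 1) ^ 2 - 1 / (16 * (2 * (k : ℝ) - 1) ^ 2) ∧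
    1 ≤ rr k ∧ rr k < 2 * (k : ℝ) - 1 ∧ 2 * (k : ℝ) - 1 ≤ rr k ^ 2 := by
  have hk' : (2 : ℝ) ≤ k := by exact_mod_cast hk
  have hq : (3 : ℝ) ≤ 2 * (k : ℝ) - 1 := by linarith
  unfold rr
  generalize 2 * (k : ℝ) - 1 = q at hq
  have h1 : 1 / (16 * q ^ 2) ≤ 1 := by
    rw [div_le_one (by positivity)]; nlinarith
  have h2 : 0 < 1 / (16 * q ^ 2) := by positivity
  have h3 : 0 ≤ q ^ 2 - 1 / (16 * q ^ 2) := by nlinarith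
  have e : Real.sqrt (q ^ 2 - 1 / (16 * q ^ 2)) ^ 2 = q ^ 2 - 1 / (16 * q ^ 2) := Real.sq_sqrt h3
  refine ⟨e, ?_, ?_, ?_⟩
  · rw [Real.one_le_sqrt]; nlinarith
  · rw [Real.sqrt_lt' (by linarith)]; linarith
  · rw [e]; nlinarith

theorem exp_two_step (hk : 2 ≤ k) {a : Letter k} {A : Set (Letter k)} (hc : Cut a A) :
    ∃ s : ℝ, 0 ≤ s ∧ s ≤ 1 ∧
    ∀ x, ∑ y ∈ nb x, ∑ z ∈ nb y, Real.exp (s * (ph a A x y + ph a A y z)) ≤ rr k ^ 2 := by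
  have hk' : (2 : ℝ) ≤ k := by exact_mod_cast hk
  have hq : (3 : ℝ) ≤ 2 * (k : ℝ) - 1 := by linarith
  have hcast : ((2 * k - 1 : ℕ) : ℝ) = 2 * (k : ℝ) - 1 := by
    rw [Nat.cast_sub (by omega)]; push_cast; ring
  rw [(rr_facts hk).1]
  generalize hqq : 2 * (k : ℝ) - 1 = q at *
  have hs1 : 1 / (8 * q ^ 2) ≤ 1 / 2 := by
    apply one_div_le_one_div_of_le (by norm_num); nlinarith
  have hs0 : 0 < 1 / (8 * q ^ 2) := by positivity
  refine ⟨1 / (8 * q ^ 2), hs0.le, by linarith, fun x => ?_⟩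
  have hsq : 1 / (8 * q ^ 2) * q ^ 2 = 1 / 8 := by field_simp
  have h16 : 1 / (16 * q ^ 2) = 1 / (8 * q ^ 2) / 2 := by field_simp; norm_num
  rw [h16]
  generalize 1 / (8 * q ^ 2) = s at *
  have hb : ∀ y z, Real.exp (s * (ph a A x y + ph a A y z)) ≤
      1 + s * (ph a A x y + ph a A y z) + 4 * s ^ 2 := by
    intro y z
    have e1 := abs_le.1 (ph_abs a A x y)
    have e2 := abs_le.1 (ph_abs a A y z)
    have e3 : |ph a A x y + ph a A y z| ≤ 2 := abs_le.2 ⟨by linarith, by linarith⟩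
    generalize ph a A x y + ph a A y z = t at *
    have e4 : |s * t| ≤ 1 := by
      rw [abs_mul, abs_of_pos hs0]; nlinarith [abs_nonneg t]
    have e5 := (abs_le.1 (Real.abs_exp_sub_one_sub_id_le e4)).2
    have e6 : t ^ 2 ≤ 4 := by
      rw [← sq_abs]; nlinarith [abs_nonneg t]
    have e7 : (s * t) ^ 2 ≤ 4 * s ^ 2 := by
      rw [mul_pow]; nlinarith [sq_nonneg s]
    linarith
  calc ∑ y ∈ nb x, ∑ z ∈ nb y, Real.exp (s * (ph a A x y + ph a A y z))
      ≤ ∑ y ∈ nb x, ∑ z ∈ nb y, (s * (ph a A x y + ph a A y z) + (1 + 4 * s ^ 2)) := by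
        gcongr with y _ z _
        have := hb y z
        linarith
    _ = s * (∑ y ∈ nb x, ∑ z ∈ nb y, (ph a A x y + ph a A y z)) + q * (q * (1 + 4 * s ^ 2)) := by
        simp only [Finset.sum_add_distrib (f := fun z => s * _), Finset.sum_const, card_nb,
          nsmul_eq_mul, hcast, ← Finset.mul_sum]
    _ ≤ q ^ 2 - s / 2 := by
        have := two_step hc x
        nlinarith

end EB

namespace EB
variable {k : ℕ}

theorem ncard_cover {α ι : Type*} [Fintype ι] {S : Set α} {T : ι → Set α} {b : ℝ}
    (h : S ⊆ ⋃ i, T i) (hf : ∀ i, (T i).Finite) (hb : ∀ i, ((T i).ncard : ℝ) ≤ b) :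
    (S.ncard : ℝ) ≤ Fintype.card ι * b := by
  have h1 : S ⊆ ⋃ i ∈ (Finset.univ : Finset ι), T i := by simpa using h
  have hfin : (⋃ i ∈ (Finset.univ : Finset ι), T i).Finite :=
    Set.Finite.biUnion (Finset.finite_toSet _) (fun i _ => hf i)
  have h2 := (Set.ncard_le_ncard h1 hfin).trans (Finset.set_ncard_biUnion_le _ _)
  have h3 : (S.ncard : ℝ) ≤ ∑ i, ((T i).ncard : ℝ) := by exact_mod_cast h2
  refine h3.trans ((Finset.sum_le_sum (fun i _ => hb i)).trans ?_)
  simp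

theorem fw_ph (a : Letter k) (A : Set (Letter k)) (l : List (Letter k)) : ∀ x : Letter k,
    fw (ph a A) (x :: l) =
      (l.countP (fun y => decide (y.1 = a.1)) : ℝ) - (turns A (x :: l) : ℝ) := by
  induction l with
  | nil => intro x; simp [fw, turns]
  | cons y l ih =>
    intro x
    simp only [fw, turns, ih, ph, List.countP_cons, decide_eq_true_eq]
    push_cast
    split_ifs <;> simp <;> ring

theorem Zs_zero (hk : 2 ≤ k) (n : ℕ) : ∀ x : Letter k,
    Zs (fun _ _ => 0) 0 n x = (2 * (k : ℝ) - 1) ^ n := by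
  have hcast : ((2 * k - 1 : ℕ) : ℝ) = 2 * (k : ℝ) - 1 := by
    rw [Nat.cast_sub (by omega)]; push_cast; ring
  induction n with
  | zero => intro x; simp [Zs]
  | succ n ih =>
    intro x
    simp only [Zs, ih, mul_zero, Real.exp_zero, one_mul, Finset.sum_const, card_nb, nsmul_eq_mul,
      hcast]
    ring

theorem toWord_cover (S : Set (FG k)) : S.ncard = (FreeGroup.toWord '' S).ncard :=
  (Set.ncard_image_of_injective _ FreeGroup.toWord_injective).symm

theorem fw_zero (l : List (Letter k)) : fw (fun _ _ => 0) l = 0 := by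
  induction l with
  | nil => rfl
  | cons x l ih =>
    cases l with
    | nil => rfl
    | cons y l => simp [fw, ih]

theorem sphere_bound (hk : 2 ≤ k) (n : ℕ) :
    (({g : FG k | wordLength g = n}).ncard : ℝ) ≤ 2 * k * (2 * (k : ℝ) - 1) ^ n := by
  have hk' : (2 : ℝ) ≤ k := by exact_mod_cast hk
  have hq : (3 : ℝ) ≤ 2 * (k : ℝ) - 1 := by linarith
  cases n with
  | zero =>
    have : {g : FG k | wordLength g = 0} ⊆ {1} := by
      intro g hg
      exact wl_zero hg
    have h1 := Set.ncard_le_ncard this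
    rw [Set.ncard_singleton] at h1
    have h3 : ((({g : FG k | wordLength g = 0}).ncard : ℕ) : ℝ) ≤ 1 := by exact_mod_cast h1
    simp only [pow_zero]
    linarith
  | succ n =>
    rw [toWord_cover]
    have h1 : FreeGroup.toWord '' {g : FG k | wordLength g = n + 1} ⊆
        ⋃ x : Letter k, (fun l => x :: l) '' Q (fun _ _ => 0) n x 0 := by
      rintro _ ⟨g, hg, rfl⟩
      have hr := FreeGroup.isReduced_toWord (x := g)
      simp only [Set.mem_ofPred_eq, wordLength] at hg
      cases hl : g.toWord with
      | nil => rw [hl] at hg; simp at hg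
      | cons x l =>
        rw [hl] at hr hg
        exact Set.mem_iUnion.2 ⟨x, l, ⟨by simpa using hg, hr, by rw [fw_zero]⟩, rfl⟩
    have h2 := ncard_cover (b := (2 * (k : ℝ) - 1) ^ n) h1
      (fun x => (Q_finite _ _ _ _).image _) (fun x => by
        have h3 : (((fun l => x :: l) '' Q (fun _ _ => 0) n x 0).ncard : ℝ) ≤
            ((Q (fun _ _ => 0) n x 0).ncard : ℝ) := by
          exact_mod_cast Set.ncard_image_le (Q_finite _ _ _ _)
        have h4 := Q_bound (fun _ _ => 0) (le_refl (0 : ℝ)) n x 0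
        rw [Zs_zero hk] at h4
        simp only [neg_zero, mul_zero, Real.exp_zero, one_mul] at h4
        exact h3.trans h4)
    have e : (Fintype.card (Letter k) : ℝ) = 2 * k := by simp [mul_comm]
    rw [e] at h2
    refine h2.trans ?_
    gcongr
    · linarith
    · omega

theorem B_bound (hk : 2 ≤ k) : ∃ C : ℝ, 1 ≤ C ∧ ∀ n : ℕ,
    (({u : FG k | (IsCyclicallyReduced u ∧ u ∉ SM k) ∧ wordLength u = n}).ncard : ℝ) ≤
      C * rr k ^ n := by
  classical
  have hk' : (2 : ℝ) ≤ k := by exact_mod_cast hk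
  have hq : (3 : ℝ) ≤ 2 * (k : ℝ) - 1 := by linarith
  have hcast : ((2 * k - 1 : ℕ) : ℝ) = 2 * (k : ℝ) - 1 := by
    rw [Nat.cast_sub (by omega)]; push_cast; ring
  obtain ⟨_, hr1, _, _⟩ := rr_facts hk
  let ι := {p : Letter k × Set (Letter k) // Cut p.1 p.2} × Letter k
  letI : Fintype ι := Fintype.ofFinite ι
  let q := 2 * (k : ℝ) - 1
  refine ⟨1 + Fintype.card ι * (3 * (3 * q)), ?_, ?_⟩
  · have : 0 ≤ (Fintype.card ι : ℝ) * (3 * (3 * q)) := by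
      have : 0 ≤ q := by linarith
      positivity
    linarith
  intro n
  have hnn : 0 ≤ (Fintype.card ι : ℝ) * (3 * (3 * q)) := by
    have : 0 ≤ q := by linarith
    positivity
  have he : Real.exp 1 ≤ 3 := Real.exp_one_lt_three.le
  cases n with
  | zero =>
    have : {u : FG k | (IsCyclicallyReduced u ∧ u ∉ SM k) ∧ wordLength u = 0} ⊆ {1} := by
      intro g hg
      exact wl_zero hg.2
    have h1 := Set.ncard_le_ncard this
    rw [Set.ncard_singleton] at h1
    have h3 : ((({u : FG k | (IsCyclicallyReduced u ∧ u ∉ SM k) ∧ wordLength u = 0}).ncard : ℕ) : ℝ)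
      ≤ 1 := by exact_mod_cast h1
    simp only [pow_zero]
    linarith
  | succ n =>
    rw [toWord_cover]
    have h1 : FreeGroup.toWord ''
          {u : FG k | (IsCyclicallyReduced u ∧ u ∉ SM k) ∧ wordLength u = n + 1} ⊆
        ⋃ i : ι, (fun l => i.2 :: l) '' Q (ph i.1.1.1 i.1.1.2) n i.2 (-1) := by
      rintro _ ⟨g, ⟨⟨hg1, hg2⟩, hg⟩, rfl⟩
      obtain ⟨a, A, hc, ht⟩ := nonSM_turns hg1 hg2
      have hr := FreeGroup.isReduced_toWord (x := g)
      simp only [wordLength] at hg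
      cases hl : g.toWord with
      | nil => rw [hl] at hg; simp at hg
      | cons x l =>
        rw [hl] at hr hg ht
        refine Set.mem_iUnion.2 ⟨(⟨(a, A), hc⟩, x), l, ⟨by simpa using hg, hr, ?_⟩, rfl⟩
        rw [fw_ph]
        have h5 : turns A (x :: l) ≤ l.countP (fun y => decide (y.1 = a.1)) + 1 := by
          rw [List.countP_cons] at ht
          refine ht.trans ?_
          split_ifs <;> omega
        have h6 : (turns A (x :: l) : ℝ) ≤ (l.countP (fun y => decide (y.1 = a.1)) : ℝ) + 1 := by
          exact_mod_cast h5
        simp only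
        linarith
    have h2 := ncard_cover (b := 3 * (3 * q * rr k ^ n)) h1
      (fun x => (Q_finite _ _ _ _).image _) (fun i => by
        obtain ⟨⟨⟨a, A⟩, hc⟩, x⟩ := i
        simp only at hc ⊢
        have h3 : (((fun l => x :: l) '' Q (ph a A) n x (-1)).ncard : ℝ) ≤
            ((Q (ph a A) n x (-1)).ncard : ℝ) := by
          exact_mod_cast Set.ncard_image_le (Q_finite _ _ _ _)
        obtain ⟨s, hs0, hs1, hs⟩ := exp_two_step hk hc
        have h4 := Q_bound (ph a A) hs0 n x (-1)
        have h5 := Zs_bound (ph a A) (C := 3 * q) hr1 hs (by linarith) (by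
          intro x
          calc ∑ y ∈ nb x, Real.exp (s * ph a A x y) ≤ ∑ y ∈ nb x, (3 : ℝ) := by
                gcongr with y _
                refine le_trans (Real.exp_le_exp.2 ?_) he
                have := (abs_le.1 (ph_abs a A x y)).2
                nlinarith
            _ = 3 * q := by
                rw [Finset.sum_const, card_nb, nsmul_eq_mul, hcast, mul_comm]) n x
        refine h3.trans (h4.trans ?_)
        have h6 : Real.exp (-s * -1) ≤ 3 := le_trans (Real.exp_le_exp.2 (by linarith)) he
        gcongr
        exact Zs_pos _ _ _ _)
    refine h2.trans ?_
    have h7 : rr k ^ n ≤ rr k ^ (n + 1) := pow_le_pow_right₀ hr1 (by omega)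
    have h8 : 0 ≤ rr k ^ n := by positivity
    calc (Fintype.card ι : ℝ) * (3 * (3 * q * rr k ^ n))
        = (Fintype.card ι * (3 * (3 * q))) * rr k ^ n := by ring
      _ ≤ (1 + Fintype.card ι * (3 * (3 * q))) * rr k ^ (n + 1) := by
          gcongr; linarith

/-- map from sequences to reduced words -/
noncomputable def bld (e : Letter k → Fin (2 * k - 1) → Letter k) :
    List (Fin (2 * k - 1)) → Letter k → List (Letter k)
  | [], _ => []
  | i :: L, x => e x i :: bld e L (e x i)

theorem sphere_lower (hk : 2 ≤ k) (n : ℕ) :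
    (2 * (k : ℝ) - 1) ^ n ≤ (({g : FG k | wordLength g ≤ n}).ncard : ℝ) := by
  classical
  have hcast : ((2 * k - 1 : ℕ) : ℝ) = 2 * (k : ℝ) - 1 := by
    rw [Nat.cast_sub (by omega)]; push_cast; ring
  let e : Letter k → Fin (2 * k - 1) → Letter k := fun x i =>
    ((nb x).equivFinOfCardEq (card_nb x)).symm i
  have he : ∀ x, Function.Injective (e x) := by
    intro x i j hij
    exact ((nb x).equivFinOfCardEq (card_nb x)).symm.injective (Subtype.ext hij)
  have he' : ∀ x i, e x i ≠ linv x := fun x i =>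
    mem_nb.1 (((nb x).equivFinOfCardEq (card_nb x)).symm i).2
  have hinj : ∀ L L' x, L.length = L'.length → bld e L x = bld e L' x → L = L' := by
    intro L
    induction L with
    | nil => intro L' x h _; symm; simpa using h.symm
    | cons i L ih =>
      intro L' x h h'
      cases L' with
      | nil => simp at h
      | cons j L' =>
        simp only [bld, List.cons.injEq] at h'
        have := he x h'.1
        subst this
        rw [ih L' _ (by simpa using h) h'.2]
  have hred : ∀ L x, FreeGroup.IsReduced (x :: bld e L x) := by
    intro L
    induction L with
    | nil => intro x; simp [bld]
    | cons i L ih =>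
      intro x
      rw [bld, FreeGroup.isReduced_cons_cons, cancel_iff]
      exact ⟨he' x i, ih _⟩
  have hred2 : ∀ L x, FreeGroup.IsReduced (bld e L x) := fun L x =>
    (hred L x).infix ⟨[x], [], by simp⟩
  have hlen : ∀ L x, (bld e L x).length = L.length := by
    intro L
    induction L with
    | nil => intro x; rfl
    | cons i L ih => intro x; simp [bld, ih]
  let x0 : Letter k := (⟨0, by omega⟩, true)
  have hcard : Nat.card (List.Vector (Fin (2 * k - 1)) n) = (2 * k - 1) ^ n := by
    rw [Nat.card_eq_fintype_card, card_vector, Fintype.card_fin]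
  have hmain : (2 * k - 1) ^ n ≤ ({g : FG k | wordLength g ≤ n}).ncard := by
    rw [← hcard, ← Set.ncard_univ]
    apply Set.ncard_le_ncard_of_injOn (fun v => FreeGroup.mk (bld e v.1 x0)) ?_ ?_ (ball_finite n)
    · intro v _
      simp only [Set.mem_ofPred_eq, wordLength, FreeGroup.toWord_mk]
      rw [(hred2 _ _).reduce_eq, hlen, v.2]
    · intro v _ v' _ h
      have h1 := congrArg FreeGroup.toWord h
      simp only [FreeGroup.toWord_mk] at h1
      rw [(hred2 _ _).reduce_eq, (hred2 _ _).reduce_eq] at h1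
      exact Subtype.ext (hinj _ _ _ (by rw [v.2, v'.2]) h1)
  rw [← hcast]
  exact_mod_cast hmain

end EB

namespace EB
variable {k : ℕ}
open Filter Topology

theorem tend_aux {C β : ℝ} (hC : 0 < C) (hβ : 0 < β) :
    Tendsto (fun n : ℕ => (C * ((n : ℝ) + 1) ^ 2 * β ^ n) ^ ((n : ℝ)⁻¹)) atTop (𝓝 β) := by
  have h1 : Tendsto (fun n : ℕ => C ^ ((n : ℝ)⁻¹)) atTop (𝓝 1) := by
    have h := (tendsto_inv_atTop_nhds_zero_nat (𝕜 := ℝ))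
    have h2 := (Real.continuous_const_rpow hC.ne').tendsto 0
    rw [Real.rpow_zero] at h2
    exact h2.comp h
  have h2 : Tendsto (fun n : ℕ => ((n : ℝ) + 1) ^ ((n : ℝ)⁻¹)) atTop (𝓝 1) := by
    have h := tendsto_rpow_div_mul_add 1 1 (-1) (by norm_num)
    have h3 : Tendsto (fun n : ℕ => (n : ℝ) + 1) atTop atTop :=
      tendsto_atTop_add_const_right _ _ tendsto_natCast_atTop_atTop
    refine (h.comp h3).congr (fun n => ?_)
    simp [Function.comp]
  have h3 := (h1.mul (h2.pow 2)).mul (tendsto_const_nhds (x := β))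
  simp only [one_pow, one_mul] at h3
  refine h3.congr' ?_
  filter_upwards [eventually_ge_atTop 1] with n hn
  have hn0 : (n : ℝ) ≠ 0 := by positivity
  rw [Real.mul_rpow (by positivity) (by positivity), Real.mul_rpow (by positivity) (by positivity),
    ← Real.rpow_natCast β n, ← Real.rpow_mul hβ.le, mul_inv_cancel₀ hn0, Real.rpow_one,
    ← Real.rpow_natCast _ 2, ← Real.rpow_mul (by positivity), ← Real.rpow_natCast _ 2,
    ← Real.rpow_mul (by positivity), mul_comm ((2 : ℕ) : ℝ)]

theorem le_aux {S : Set (FG k)} {C β : ℝ}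
    (h : ∀ᶠ n : ℕ in atTop, (rhoC S n : ℝ) ≤ C * ((n : ℝ) + 1) ^ 2 * β ^ n) :
    (fun n : ℕ => (rhoC S n : ℝ) ^ ((n : ℝ)⁻¹)) ≤ᶠ[atTop]
      (fun n : ℕ => (C * ((n : ℝ) + 1) ^ 2 * β ^ n) ^ ((n : ℝ)⁻¹)) := by
  filter_upwards [h] with n hn
  exact Real.rpow_le_rpow (by positivity) hn (by positivity)

theorem cob (S : Set (FG k)) :
    IsCoboundedUnder (· ≤ ·) atTop (fun n : ℕ => (rhoC S n : ℝ) ^ ((n : ℝ)⁻¹)) :=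
  isCoboundedUnder_le_of_le (x := 0) _ (fun n => by positivity)

theorem ent_le {S : Set (FG k)} {C β : ℝ} (hC : 0 < C) (hβ : 0 < β)
    (h : ∀ᶠ n : ℕ in atTop, (rhoC S n : ℝ) ≤ C * ((n : ℝ) + 1) ^ 2 * β ^ n) :
    entropyH S ≤ β := by
  have ht := tend_aux hC hβ
  rw [← ht.limsup_eq]
  exact limsup_le_limsup (le_aux h) (cob S) ht.isBoundedUnder_le

theorem rho_univ (hk : 2 ≤ k) (n : ℕ) :
    (rhoC (Set.univ : Set (FG k)) n : ℝ) ≤ (2 * k) * ((n : ℝ) + 1) ^ 2 * (2 * (k : ℝ) - 1) ^ n := by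
  have hk' : (2 : ℝ) ≤ k := by exact_mod_cast hk
  have hq : (1 : ℝ) ≤ 2 * (k : ℝ) - 1 := by linarith
  have h := ncard_cover (ι := Fin (n + 1)) (S := {g ∈ (Set.univ : Set (FG k)) | wordLength g ≤ n})
    (T := fun i => {g : FG k | wordLength g = i}) (b := 2 * k * (2 * (k : ℝ) - 1) ^ n)
    (by
      rintro g ⟨-, hg⟩
      exact Set.mem_iUnion.2 ⟨⟨wordLength g, by omega⟩, rfl⟩)
    (fun i => (ball_finite i).subset (fun g hg => le_of_eq hg))
    (fun i => (sphere_bound hk i).trans (by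
      have : (i : ℕ) ≤ n := by omega
      gcongr))
  refine h.trans ?_
  rw [Fintype.card_fin]; push_cast
  have h1 : (0 : ℝ) ≤ n := by positivity
  have h2 : 0 ≤ (2 * k * (2 * (k : ℝ) - 1) ^ n) := by positivity
  have h3 : (n : ℝ) + 1 ≤ ((n : ℝ) + 1) ^ 2 := by nlinarith
  calc _ ≤ ((n : ℝ) + 1) ^ 2 * (2 * k * (2 * (k : ℝ) - 1) ^ n) := by gcongr
    _ = _ := by ring

theorem fin_ball (S : Set (FG k)) (n : ℕ) : {g ∈ S | wordLength g ≤ n}.Finite :=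
  (ball_finite n).subset (fun _ hg => hg.2)

theorem rho_mono {S T : Set (FG k)} (h : S ⊆ T) {m n : ℕ} (hmn : m ≤ n) : rhoC S m ≤ rhoC T n :=
  Set.ncard_le_ncard (fun _ hg => ⟨h hg.1, hg.2.trans hmn⟩) (fin_ball _ _)

theorem bdd (hk : 2 ≤ k) (S : Set (FG k)) :
    IsBoundedUnder (· ≤ ·) atTop (fun n : ℕ => (rhoC S n : ℝ) ^ ((n : ℝ)⁻¹)) := by
  have hk' : (2 : ℝ) ≤ k := by exact_mod_cast hk
  have ht := tend_aux (C := 2 * k) (β := 2 * (k : ℝ) - 1) (by linarith) (by linarith)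
  refine ht.isBoundedUnder_le.mono_le (le_aux (Eventually.of_forall fun n => ?_))
  refine le_trans ?_ (rho_univ hk n)
  exact_mod_cast rho_mono (Set.subset_univ S) le_rfl

theorem le_ent (hk : 2 ≤ k) {S : Set (FG k)} {β : ℝ} (hβ : 0 ≤ β)
    (h : ∀ᶠ n : ℕ in atTop, β ^ n ≤ (rhoC S n : ℝ)) : β ≤ entropyH S := by
  refine le_limsup_of_frequently_le (Eventually.frequently ?_) (bdd hk S)
  filter_upwards [h, eventually_ge_atTop 1] with n hn h1
  have hn0 : (n : ℝ) ≠ 0 := by positivity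
  calc β = (β ^ n) ^ ((n : ℝ)⁻¹) := by
        rw [← Real.rpow_natCast β n, ← Real.rpow_mul hβ, mul_inv_cancel₀ hn0, Real.rpow_one]
    _ ≤ _ := Real.rpow_le_rpow (by positivity) hn (by positivity)

theorem ent_univ (hk : 2 ≤ k) : entropyH (Set.univ : Set (FG k)) = 2 * (k : ℝ) - 1 := by
  have hk' : (2 : ℝ) ≤ k := by exact_mod_cast hk
  apply le_antisymm
  · exact ent_le (C := 2 * k) (by linarith) (by linarith) (Eventually.of_forall (rho_univ hk))
  · refine le_ent hk (by linarith) (Eventually.of_forall fun n => (sphere_lower hk n).trans ?_)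
    simp [rhoC]

theorem rho_nonSM (hk : 2 ≤ k) : ∃ C : ℝ, 0 < C ∧ ∀ n : ℕ,
    (rhoC ((Set.univ : Set (FG k)) \ SM' k) n : ℝ) ≤ C * ((n : ℝ) + 1) ^ 2 * rr k ^ n := by
  have hk' : (2 : ℝ) ≤ k := by exact_mod_cast hk
  obtain ⟨C, hC, hB⟩ := B_bound hk
  obtain ⟨-, hr1, -, hr2⟩ := rr_facts hk
  refine ⟨2 * k * C, by positivity, fun n => ?_⟩
  have hq : (0 : ℝ) ≤ 2 * (k : ℝ) - 1 := by linarith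
  let T : Fin (n + 1) × Fin (n + 1) → Set (FG k) := fun p =>
    (fun xu : FG k × FG k => xu.1 * xu.2 * xu.1⁻¹) ''
      ({p' : FG k × FG k | 2 * (p.1 : ℕ) + p.2 ≤ n ∧ wordLength p'.1 = p.1 ∧
        (IsCyclicallyReduced p'.2 ∧ p'.2 ∉ SM k) ∧ wordLength p'.2 = p.2})
  have hfin : ∀ p : Fin (n + 1) × Fin (n + 1), ({x : FG k | wordLength x = p.1} ×ˢ
      {u : FG k | (IsCyclicallyReduced u ∧ u ∉ SM k) ∧ wordLength u = p.2}).Finite := fun p =>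
    Set.Finite.prod ((ball_finite p.1).subset (fun g hg => le_of_eq hg))
      ((ball_finite p.2).subset (fun g hg => le_of_eq hg.2))
  have hsub : ∀ p : Fin (n + 1) × Fin (n + 1),
      ({p' : FG k × FG k | 2 * (p.1 : ℕ) + p.2 ≤ n ∧ wordLength p'.1 = p.1 ∧
        (IsCyclicallyReduced p'.2 ∧ p'.2 ∉ SM k) ∧ wordLength p'.2 = p.2}) ⊆
      ({x : FG k | wordLength x = p.1} ×ˢ
      {u : FG k | (IsCyclicallyReduced u ∧ u ∉ SM k) ∧ wordLength u = p.2}) :=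
    fun p x hx => ⟨hx.2.1, hx.2.2⟩
  have h := ncard_cover (S := {g ∈ ((Set.univ : Set (FG k)) \ SM' k) | wordLength g ≤ n})
    (T := T) (b := 2 * k * C * rr k ^ n)
    (by
      rintro g ⟨hg, hgn⟩
      obtain ⟨x, u, hu, hgx, hl⟩ := cr_decomp g
      refine Set.mem_iUnion.2 ⟨(⟨wordLength x, by omega⟩, ⟨wordLength u, by omega⟩), (x, u), ?_,
        hgx.symm⟩
      refine ⟨by simp only; omega, rfl, ⟨hu, fun h => hg.2 ⟨x, u, h, hgx⟩⟩, rfl⟩)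
    (fun p => ((hfin p).subset (hsub p)).image _)
    (fun p => by
      by_cases hp : 2 * (p.1 : ℕ) + p.2 ≤ n
      · have h1 : (T p).ncard ≤ _ := (Set.ncard_image_le ((hfin p).subset (hsub p))).trans
          (Set.ncard_le_ncard (hsub p) (hfin p))
        rw [Set.ncard_prod] at h1
        have h2 : ((T p).ncard : ℝ) ≤ (({x : FG k | wordLength x = p.1}).ncard : ℝ) *
          (({u : FG k | (IsCyclicallyReduced u ∧ u ∉ SM k) ∧ wordLength u = p.2}).ncard : ℝ) := by
          exact_mod_cast h1
        calc ((T p).ncard : ℝ) ≤ _ := h2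
          _ ≤ (2 * k * (2 * (k : ℝ) - 1) ^ (p.1 : ℕ)) * (C * rr k ^ (p.2 : ℕ)) :=
              mul_le_mul (sphere_bound hk p.1) (hB p.2) (by positivity) (by positivity)
          _ ≤ (2 * k * (rr k ^ 2) ^ (p.1 : ℕ)) * (C * rr k ^ (p.2 : ℕ)) := by gcongr
          _ = 2 * k * C * rr k ^ (2 * (p.1 : ℕ) + p.2) := by rw [pow_add, pow_mul]; ring
          _ ≤ _ := by gcongr
      · have : T p = ∅ := by
          simp only [T, Set.image_eq_empty]
          ext x
          simp only [Set.mem_ofPred_eq, Set.mem_empty_iff_false, iff_false]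
          exact fun h => hp h.1
        rw [this, Set.ncard_empty]
        push_cast
        positivity)
  refine h.trans (le_of_eq ?_)
  rw [Fintype.card_prod, Fintype.card_fin]; push_cast; ring

theorem ent_nonSM (hk : 2 ≤ k) :
    entropyH ((Set.univ : Set (FG k)) \ SM' k) < 2 * (k : ℝ) - 1 := by
  obtain ⟨C, hC, h⟩ := rho_nonSM hk
  obtain ⟨-, hr1, hr, -⟩ := rr_facts hk
  exact (ent_le hC (by linarith) (Eventually.of_forall h)).trans_lt hr

end EB

namespace EB
variable {k : ℕ}
open Filter Topology

theorem prim_notMem {a b : Letter k} (hab : b.1 ≠ a.1) (y : FG k) : y * lt a * y⁻¹ ∉ SM' k := by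
  rintro ⟨x, u, hu, h⟩
  obtain ⟨τ, w, hτ⟩ := exists_WA a {linv a, linv b} (by simp) (by
    rintro (h | h)
    · exact linv_ne a h.symm
    · exact hab (congrArg Prod.fst h).symm)
  have hb : τ (lt b) = lt b * lt a := by
    rw [w.h4 b hab]
    have h1 : b ∉ ({linv a, linv b} : Set (Letter k)) := by
      rintro (h | h)
      · exact hab (by rw [h]; rfl)
      · exact linv_ne b h.symm
    have h2 : linv b ∈ ({linv a, linv b} : Set (Letter k)) := by simp
    unfold pw
    rw [if_neg h1, if_pos h2]; simp
  have hni : ¬ IsInner τ := by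
    rintro ⟨g, hg⟩
    have h1 : es a.1 (τ (lt b)) = es a.1 (lt b) := by
      rw [hg, MulAut.conj_apply, map_mul, map_mul, map_inv, mul_comm (es a.1 g), mul_inv_cancel_right]
    rw [hb, map_mul, mul_eq_left] at h1
    rcases eq_or_of_fst (x := (a.1, true)) (y := a) rfl with e | e
    · rw [e, es_of] at h1
      simp at h1
    · rw [e, lt_linv, map_inv, inv_eq_one] at h1
      have h2 : es a.1 (lt (a.1, true)) = 1 := by rw [← e] at h1 <;> exact h1
      rw [es_of] at h2
      simp at h2
  have h1 := hu.2 τ hτ hni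
  have h2 : u = (x⁻¹ * y) * lt a * (x⁻¹ * y)⁻¹ := by
    have : u = x⁻¹ * (x * u * x⁻¹) * x := by group
    rw [this, ← h]; group
  have h3 : τ u = τ (x⁻¹ * y) * lt a * (τ (x⁻¹ * y))⁻¹ := by
    conv_lhs => rw [h2]
    rw [map_mul τ, map_mul τ, w.h3, map_inv]
  rw [h3, cl_conj] at h1
  have h4 := cl_le_wl (lt a)
  rw [wl_lt] at h4
  have h5 : u = 1 := wl_zero (by omega)
  rw [h5] at h
  have h6 : lt a = 1 := by
    have : lt a = y⁻¹ * (y * lt a * y⁻¹) * y := by group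
    rw [this, h]; group
  exact lt_ne_one a h6

theorem conj_word {a b : Letter k} (hab : b.1 ≠ a.1) {x : FG k} (hx : nc x b) :
    ∃ L, (x * lt b * lt a * (x * lt b)⁻¹).toWord = x.toWord ++ L ∧
      wordLength (x * lt b * lt a * (x * lt b)⁻¹) = 2 * wordLength x + 3 := by
  have hy : (x * lt b).toWord = x.toWord ++ [b] := toWord_mul_lt hx
  have hi : hd (x * lt b)⁻¹ = some (linv b) := by
    rw [mul_inv_rev, ← lt_linv]
    exact hd_cons _ _ (by rw [linv_linv]; exact hx)
  have h1 : hd (x * lt b)⁻¹ ≠ some (linv a) := by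
    rw [hi]; intro h; have h' := congrArg Prod.fst (Option.some.inj h); exact hab h'
  have h2 : hd (x * lt b)⁻¹ ≠ some a := by
    rw [hi]; intro h; have h' := congrArg Prod.fst (Option.some.inj h); exact hab h'
  have h3 := toWord_mul_nc (hd_cons a _ h1) (x * lt b) h2
  rw [hy, red_cons a _ h1, ← mul_assoc] at h3
  refine ⟨[b] ++ a :: (x * lt b)⁻¹.toWord, by rw [h3, List.append_assoc], ?_⟩
  have h4 : (x * lt b)⁻¹.toWord.length = x.toWord.length + 1 := by
    have := wl_inv (x * lt b)
    unfold wordLength at this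
    rw [this, hy]; simp
  unfold wordLength
  rw [h3]
  simp only [List.length_append, List.length_cons, List.length_nil, h4]
  omega

theorem exists_nc {a b : Letter k} (hab : b.1 ≠ a.1) (x : FG k) :
    ∃ b' : Letter k, b'.1 ≠ a.1 ∧ nc x b' := by
  by_cases h : nc x b
  · exact ⟨b, hab, h⟩
  · refine ⟨linv b, hab, ?_⟩
    unfold nc at h ⊢
    push Not at h
    rw [h]
    intro h'
    exact linv_ne b (Option.some.inj h').symm

theorem half_ball (hk : 2 ≤ k) (n : ℕ) :
    ({x : FG k | 2 * wordLength x ≤ n}).ncard ≤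
      rhoC ((Set.univ : Set (FG k)) \ SM' k) (n + 3) := by
  let a : Letter k := (⟨0, by omega⟩, true)
  let b : Letter k := (⟨1, by omega⟩, true)
  have hab : b.1 ≠ a.1 := by simp [a, b]
  choose β hβ hn using fun x : FG k => exists_nc hab x
  refine Set.ncard_le_ncard_of_injOn (fun x => x * lt (β x) * lt a * (x * lt (β x))⁻¹) ?_ ?_
    (fin_ball _ _)
  · intro x hx
    obtain ⟨L, -, hl⟩ := conj_word (hβ x) (hn x)
    have hx' : 2 * wordLength x ≤ n := hx
    exact ⟨⟨trivial, prim_notMem hab _⟩, by rw [hl]; omega⟩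
  · intro x _ y _ hxy
    obtain ⟨L, h1, h2⟩ := conj_word (hβ x) (hn x)
    obtain ⟨M, h3, h4⟩ := conj_word (hβ y) (hn y)
    simp only at hxy
    rw [hxy] at h1 h2
    apply FreeGroup.toWord_injective
    refine List.append_inj_left (h1.symm.trans h3) ?_
    have : wordLength x = wordLength y := by omega
    exact this

theorem one_le_ent (hk : 2 ≤ k) : 1 ≤ entropyH ((Set.univ : Set (FG k)) \ SM' k) := by
  refine le_ent hk zero_le_one ?_
  filter_upwards [eventually_ge_atTop 3] with n hn
  obtain ⟨m, rfl⟩ := Nat.exists_eq_add_of_le' hn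
  rw [one_pow]
  have h1 : 1 ≤ ({x : FG k | 2 * wordLength x ≤ m}).ncard := by
    have hf : ({x : FG k | 2 * wordLength x ≤ m}).Finite :=
      (ball_finite m).subset (fun x (hx : 2 * wordLength x ≤ m) => by
        show wordLength x ≤ m
        omega)
    refine (Set.ncard_pos hf).2 ?_
    exact ⟨1, by show 2 * wordLength (1 : FG k) ≤ m; rw [wl_one]; omega⟩
  exact_mod_cast h1.trans (half_ball hk m)

theorem orbit_rho (hk : 2 ≤ k) (w : FG k) : ∃ C : ℕ, ∀ n,
    rhoC (autOrbit w) n ≤ C * rhoC ((Set.univ : Set (FG k)) \ SM' k) (n + 3) := by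
  obtain ⟨m, hm⟩ : ∃ m, ∀ g ∈ autOrbit w, g ∈ SM' k → cyclicLength g = m := by
    by_cases h : ∃ g ∈ autOrbit w, g ∈ SM' k
    · obtain ⟨g, ⟨α, hα⟩, ⟨x, u, hu, hg⟩⟩ := h
      refine ⟨wordLength u, ?_⟩
      rintro g' ⟨α', hα'⟩ ⟨x', u', hu', hg'⟩
      rw [cl_eq hu'.1 hg']
      have h1 : (α * α'⁻¹) g' = g := by
        rw [← hα', MulAut.mul_apply, MulAut.inv_apply_self, hα]
      set γ := α * α'⁻¹
      refine SM_orbit hu' hu γ ((γ x')⁻¹ * x) ?_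
      rw [hg', hg, map_mul, map_mul, map_inv] at h1
      have : γ u' = (γ x')⁻¹ * (γ x' * γ u' * (γ x')⁻¹) * γ x' := by group
      rw [this, h1]; group
    · push Not at h
      exact ⟨0, fun g hg hg' => absurd hg' (h g hg)⟩
  refine ⟨1 + ({u : FG k | wordLength u ≤ m}).ncard, fun n => ?_⟩
  have hfin : ({x : FG k | 2 * wordLength x ≤ n}).Finite :=
    (ball_finite n).subset (fun x (hx : 2 * wordLength x ≤ n) => by
        show wordLength x ≤ n
        omega)
  have hsub : {g ∈ autOrbit w | wordLength g ≤ n} ⊆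
      {g ∈ (Set.univ : Set (FG k)) \ SM' k | wordLength g ≤ n} ∪
      (fun p : FG k × FG k => p.2 * p.1 * p.2⁻¹) ''
        ({u : FG k | wordLength u ≤ m} ×ˢ {x : FG k | 2 * wordLength x ≤ n}) := by
    rintro g ⟨hg, hn⟩
    by_cases h : g ∈ SM' k
    · right
      obtain ⟨x, u, hu, hgx, hl⟩ := cr_decomp g
      refine ⟨(u, x), ⟨?_, ?_⟩, hgx.symm⟩
      · show wordLength u ≤ m
        rw [← hm g hg h, cl_eq hu hgx]
      · show 2 * wordLength x ≤ n
        omega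
    · left; exact ⟨⟨trivial, h⟩, hn⟩
  have h1 := (Set.ncard_le_ncard hsub ((fin_ball _ _).union
    (((ball_finite m).prod hfin).image _))).trans (Set.ncard_union_le _ _)
  have h2 := Set.ncard_image_le (f := fun p : FG k × FG k => p.2 * p.1 * p.2⁻¹)
    ((ball_finite (k := k) m).prod hfin)
  rw [Set.ncard_prod] at h2
  have h3 := Nat.mul_le_mul_left ({u : FG k | wordLength u ≤ m}).ncard (half_ball hk n)
  have h4 : rhoC ((Set.univ : Set (FG k)) \ SM' k) n ≤
    rhoC ((Set.univ : Set (FG k)) \ SM' k) (n + 3) := rho_mono subset_rfl (by omega)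
  unfold rhoC at h3 h4 ⊢
  rw [add_mul, one_mul]
  omega

theorem ent_orbit (hk : 2 ≤ k) (w : FG k) :
    entropyH (autOrbit w) ≤ entropyH ((Set.univ : Set (FG k)) \ SM' k) := by
  obtain ⟨C, hC⟩ := orbit_rho hk w
  refine le_of_forall_gt_imp_ge_of_dense fun β hβ => ?_
  have h1 : 1 ≤ β := (one_le_ent hk).trans hβ.le
  have h2 := eventually_lt_of_limsup_lt hβ (bdd hk _)
  refine ent_le (C := (C + 1) * β ^ 3) (by positivity) (by positivity) ?_
  filter_upwards [(tendsto_add_atTop_nat 3).eventually h2] with n hn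
  have hr : (rhoC ((Set.univ : Set (FG k)) \ SM' k) (n + 3) : ℝ) ≤ β ^ (n + 3) := by
    rw [Real.rpow_inv_lt_iff_of_pos (by positivity) (by positivity) (by positivity),
      Real.rpow_natCast] at hn
    exact hn.le
  have h3 : (rhoC (autOrbit w) n : ℝ) ≤
    C * (rhoC ((Set.univ : Set (FG k)) \ SM' k) (n + 3) : ℝ) := by exact_mod_cast hC n
  have h4 : (1 : ℝ) ≤ ((n : ℝ) + 1) ^ 2 := one_le_pow₀ (by linarith [Nat.cast_nonneg (α := ℝ) n])
  calc (rhoC (autOrbit w) n : ℝ) ≤ C * β ^ (n + 3) := h3.trans (by gcongr)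
    _ ≤ (C + 1) * β ^ (n + 3) := by gcongr; linarith
    _ = (C + 1) * β ^ 3 * 1 * β ^ n := by ring
    _ ≤ _ := by gcongr

end EB

/-- `H(Aut(F_k) w) ≤ H(F_k − SM') < 2k − 1 = H(F_k)` for all `w`; in
particular a single `α < 2k − 1` bounds the entropy of every automorphic orbit. -/
theorem autOrbit_entropy_bound (k : ℕ) (hk : 2 ≤ k) :
    entropyH (Set.univ : Set (FG k)) = 2 * (k : ℝ) - 1 ∧
    entropyH ((Set.univ : Set (FG k)) \ SM' k) < 2 * (k : ℝ) - 1 ∧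
    (∀ w : FG k, entropyH (autOrbit w) ≤ entropyH ((Set.univ : Set (FG k)) \ SM' k)) ∧
    (∃ α : ℝ, α < 2 * (k : ℝ) - 1 ∧ ∀ w : FG k, entropyH (autOrbit w) ≤ α) :=
  ⟨EB.ent_univ hk, EB.ent_nonSM hk, EB.ent_orbit hk, _, EB.ent_nonSM hk, EB.ent_orbit hk⟩
end
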